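/- arXiv:1605.03519 — 7 statements merged into one kernel-verified Lean document; each statement's English description precedes it below -/
import Mathlib

section
/- Let E be a normed space over ℂ, H a complex Hilbert space, (Λ, μ) a finite measure space, and U : H → L²(Λ, μ; ℂ) a unitary (linear isometric isomorphism). Let j : E → H be a continuous linear map, (f_k)_{k∈ℕ} continuous linear functionals on E with ∑_k ‖f_k‖ < ∞, and (u_k)_{k∈ℕ} vectors in H with ‖u_k‖ = 1 such that j(φ) = ∑_k ⟨f_k, φ⟩ u_k (convergence in H) for every φ ∈ E. Fix measurable representatives û_k : Λ → ℂ of U u_k. Then for every φ ∈ E the series ∑_k ⟨f_k, φ⟩ û_k(λ) converges absolutely for μ-almost every λ ∈ Λ, and the function λ ↦ ∑_k ⟨f_k, φ⟩ û_k(λ) is a representative of U(j(φ)), i.e. it equals U(j(φ)) μ-almost everywhere. -/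
open MeasureTheory

/-- Let `E` be a normed `ℂ`-space, `H` a complex Hilbert space, `(Λ, μ)` a
finite measure space, and `U : H → L²(Λ, μ; ℂ)` unitary. Let `j : E → H` be continuous
linear, `(f k)` continuous linear functionals with `∑ ‖f k‖ < ∞`, `(u k)` unit vectors of `H`
with `j φ = ∑' k, ⟨f k, φ⟩ • u k` for every `φ`, and let `û k` be measurable representatives
of `U (u k)`. Then for every `φ ∈ E` the series `∑ k, ⟨f k, φ⟩ * û k λ` converges absolutely
for `μ`-a.e. `λ`, and `λ ↦ ∑' k, ⟨f k, φ⟩ * û k λ` is a representative of `U (j φ)`. -/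
theorem nuclear_decomposition_pointwise_transform
    {E : Type*} [NormedAddCommGroup E] [NormedSpace ℂ E]
    {H : Type*} [NormedAddCommGroup H] [InnerProductSpace ℂ H] [CompleteSpace H]
    {Λ : Type*} [MeasurableSpace Λ] (μ : Measure Λ) [IsFiniteMeasure μ]
    (U : H ≃ₗᵢ[ℂ] Lp ℂ 2 μ)
    (j : E →L[ℂ] H)
    (f : ℕ → E →L[ℂ] ℂ) (hS : Summable fun k => ‖f k‖)
    (u : ℕ → H) (hu : ∀ k, ‖u k‖ = 1)
    (hj : ∀ φ : E, j φ = ∑' k, (f k φ) • u k)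
    (uhat : ℕ → Λ → ℂ) (huhat_meas : ∀ k, Measurable (uhat k))
    (huhat : ∀ k, uhat k =ᵐ[μ] (U (u k) : Λ → ℂ)) :
    ∀ φ : E,
      (∀ᵐ l ∂μ, Summable fun k => ‖f k φ * uhat k l‖) ∧
      (fun l => ∑' k, f k φ * uhat k l) =ᵐ[μ] (U (j φ) : Λ → ℂ) := by
  intro φ
  have hsum : Summable fun k => ‖f k φ • u k‖ := by
    refine (hS.mul_right ‖φ‖).of_nonneg_of_le (fun k => norm_nonneg _) fun k => ?_
    simpa [norm_smul, hu k] using (f k).le_opNorm φ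
  have hU : U (j φ) = ∑' k, U (f k φ • u k) := by
    rw [hj φ]
    exact U.toContinuousLinearEquiv.map_tsum
  have hfin : ∑' k, ‖U (f k φ • u k)‖ₑ ≠ ⊤ := by
    rw [tsum_enorm_ne_top_iff_summable_norm]
    simpa only [U.norm_map] using hsum
  have hcoe : ∀ᵐ l ∂μ, ∀ k, U (f k φ • u k) l = f k φ * uhat k l := by
    refine ae_all_iff.2 fun k => ?_
    rw [map_smul]
    filter_upwards [Lp.coeFn_smul (f k φ) (U (u k)), huhat k] with l h₁ h₂
    rw [h₁, Pi.smul_apply, smul_eq_mul, h₂]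
  constructor
  · have hae : ∀ᵐ l ∂μ, Summable fun k => ‖U (f k φ • u k) l‖ :=
      summable_norm_of_tsum_eLpNorm_ne_top one_le_two
        (fun k => Lp.aestronglyMeasurable (U (f k φ • u k)))
        (by simpa only [Lp.enorm_def] using hfin)
    filter_upwards [hae, hcoe] with l h₁ h₂
    simpa only [h₂] using h₁
  · rw [hU]
    filter_upwards [Lp.coeFn_tsum hfin, hcoe] with l h₁ h₂
    simp only [h₁, h₂]
end

section
/- Let H be a separable complex Hilbert space, (Λ, μ) a finite measure space, U : H → L²(Λ, μ; ℂ) a unitary (linear isometric isomorphism), and E ⊆ H a dense linear subspace. If Λ₀ ⊆ Λ is a measurable set such that for every φ ∈ E the function U φ vanishes μ-almost everywhere on Λ₀, then μ(Λ₀) = 0. -/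
open MeasureTheory

/-- Let `H` be a separable complex Hilbert space, `(Λ, μ)` a finite measure
space, `U : H → L²(Λ, μ; ℂ)` unitary, and `E ⊆ H` a dense linear subspace. If `Λ₀ ⊆ Λ` is a
measurable set such that for every `φ ∈ E` the function `U φ` vanishes `μ`-a.e. on `Λ₀`,
then `μ Λ₀ = 0`. -/
theorem completeness_of_generalized_eigenvectors
    {H : Type*} [NormedAddCommGroup H] [InnerProductSpace ℂ H] [CompleteSpace H]
    [TopologicalSpace.SeparableSpace H]
    {Λ : Type*} [MeasurableSpace Λ] (μ : Measure Λ) [IsFiniteMeasure μ]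
    (U : H ≃ₗᵢ[ℂ] Lp ℂ 2 μ)
    (E : Submodule ℂ H) (hE : Dense (E : Set H))
    (Λ₀ : Set Λ) (hΛ₀ : MeasurableSet Λ₀)
    (hvanish : ∀ φ ∈ E, ∀ᵐ l ∂μ, l ∈ Λ₀ → (U φ : Λ → ℂ) l = 0) :
    μ Λ₀ = 0 := by
  have hμ : μ Λ₀ ≠ ⊤ := measure_ne_top μ Λ₀
  set u : Lp ℂ 2 μ := indicatorConstLp 2 hΛ₀ hμ (1 : ℂ) with hu
  have h_orth : ∀ φ ∈ E, inner ℂ (U.symm u) φ = 0 := fun φ hφ => by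
    rw [← U.inner_map_map, U.apply_symm_apply, hu, L2.inner_indicatorConstLp_one hΛ₀ hμ]
    exact setIntegral_eq_zero_of_ae_eq_zero (hvanish φ hφ)
  have hu₀ : U.symm u = 0 := hE.eq_zero_of_inner_left ℂ fun φ hφ => h_orth φ hφ
  have h_zero : u = 0 := by simpa using hu₀
  have h_norm : ‖u‖ = 0 := by rw [h_zero, norm_zero]
  rw [hu, norm_indicatorConstLp (by norm_num) (by norm_num)] at h_norm
  simpa [measureReal_eq_zero_iff hμ, Real.rpow_eq_zero] using h_norm
end

section
/- Under the hypotheses: E a normed space over ℂ, H a separable complex Hilbert space, (Λ, μ) a finite measure space, U : H → L²(Λ, μ; ℂ) unitary, j : E → H a continuous injective linear map with dense range, (f_k)_{k∈ℕ} continuous linear functionals on E with ∑_k ‖f_k‖ < ∞, (u_k)_{k∈ℕ} vectors in H with ‖u_k‖ = 1 and j(φ) = ∑_k ⟨f_k, φ⟩ u_k for every φ ∈ E, and û_k measurable representatives of U u_k — the following holds: for μ-almost every λ ∈ Λ the map f(λ) : φ ↦ ∑_k ⟨f_k, φ⟩ û_k(λ) is a well-defined (absolutely convergent) continuous linear functional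 on E which is not identically zero, and for each φ ∈ E the function λ ↦ ⟨f(λ), φ⟩ represents U(j(φ)) in L²(Λ, μ; ℂ). -/
open MeasureTheory

/-- If `∑ ‖a k‖ < ∞` and `∫ ‖g k‖ ≤ C < ∞` for all `k`, then `∑ ‖a k‖ ‖g k x‖ < ∞` for almost
every `x`. -/
theorem ae_summable_norm_mul_norm_of_lintegral_le {X V G : Type*} [MeasurableSpace X]
    {μ : Measure X} [SeminormedAddCommGroup V] [NormedAddCommGroup G] {a : ℕ → V} {g : ℕ → X → G}
    (ha : Summable fun k => ‖a k‖) (hg : ∀ k, AEStronglyMeasurable (g k) μ)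
    {C : ENNReal} (hC : C ≠ ⊤) (hgC : ∀ k, ∫⁻ x, ‖g k x‖ₑ ∂μ ≤ C) :
    ∀ᵐ x ∂μ, Summable fun k => ‖a k‖ * ‖g k x‖ := by
  have ha' : ∑' k, ‖a k‖ₑ ≠ ⊤ := by
    simpa only [ofReal_norm] using ha.tsum_ofReal_ne_top
  have hmeas : ∀ k, AEMeasurable (fun x => ‖a k‖ₑ * ‖g k x‖ₑ) μ :=
    fun k => (hg k).enorm.const_mul _
  have hfin : ∫⁻ x, ∑' k, ‖a k‖ₑ * ‖g k x‖ₑ ∂μ ≠ ⊤ := by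
    rw [lintegral_tsum hmeas]
    refine ne_top_of_le_ne_top (ENNReal.mul_ne_top ha' hC) ?_
    rw [← ENNReal.tsum_mul_right]
    refine ENNReal.tsum_le_tsum fun k => ?_
    rw [lintegral_const_mul'' _ (hg k).enorm]
    gcongr
    exact hgC k
  filter_upwards [ae_lt_top' (AEMeasurable.tsum hmeas) hfin] with x hx
  simpa using ENNReal.summable_toReal hx.ne

/-- A sequence converging in `Lp` has a subsequence converging almost everywhere. -/
theorem exists_seq_tendsto_ae_of_tendsto_Lp {X G : Type*} [MeasurableSpace X] {μ : Measure X}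
    [NormedAddCommGroup G] {p : ENNReal} [Fact (1 ≤ p)] {g : ℕ → Lp G p μ} {g₀ : Lp G p μ}
    (h : Filter.Tendsto g Filter.atTop (nhds g₀)) :
    ∃ ns : ℕ → ℕ, StrictMono ns ∧
      ∀ᵐ x ∂μ, Filter.Tendsto (fun i => g (ns i) x) Filter.atTop (nhds (g₀ x)) :=
  (tendstoInMeasure_of_tendsto_Lp h).exists_seq_tendsto_ae

/-- If a series converges in `Lp` and the series of representatives converges pointwise almost
everywhere, then the two sums agree almost everywhere. -/
theorem tsum_ae_eq_of_hasSum_Lp {X G : Type*} [MeasurableSpace X] {μ : Measure X}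
    [NormedAddCommGroup G] {p : ENNReal} [Fact (1 ≤ p)] {g : ℕ → Lp G p μ} {g₀ : Lp G p μ}
    (h : HasSum g g₀) {v : ℕ → X → G} (hv : ∀ k, v k =ᵐ[μ] g k)
    (hsum : ∀ᵐ x ∂μ, Summable fun k => v k x) :
    (fun x => ∑' k, v k x) =ᵐ[μ] g₀ := by
  obtain ⟨ns, hns, hlim⟩ := exists_seq_tendsto_ae_of_tendsto_Lp h.tendsto_sum_nat
  have hcoe : ∀ᵐ x ∂μ, ∀ n : ℕ,
      (∑ k ∈ Finset.range n, g k : Lp G p μ) x = ∑ k ∈ Finset.range n, g k x :=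
    ae_all_iff.2 fun n => by
      filter_upwards [Lp.coeFn_finsetSum (Finset.range n) g] with x hx
      simpa using hx
  filter_upwards [hlim, hcoe, ae_all_iff.2 hv, hsum] with x hx hc hvx hs
  refine tendsto_nhds_unique (hs.hasSum.tendsto_sum_nat.comp hns.tendsto_atTop) (hx.congr ?_)
  intro i
  simp only [Function.comp_apply, hc, hvx]

/-- If a map into `Lp` has dense range, then whatever representatives of its values are chosen,
for almost every `x` one of them does not vanish at `x`. -/
theorem ae_exists_ne_zero_of_denseRange_Lp {X S : Type*} [MeasurableSpace X] {μ : Measure X}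
    [IsFiniteMeasure μ] {p : ENNReal} [Fact (1 ≤ p)] {T : S → Lp ℂ p μ} (hT : DenseRange T)
    {v : S → X → ℂ} (hv : ∀ s, v s =ᵐ[μ] T s) :
    ∀ᵐ x ∂μ, ∃ s, v s x ≠ 0 := by
  obtain ⟨g, hgT, hg⟩ := mem_closure_iff_seq_limit.1 (hT (Lp.const p μ (1 : ℂ)))
  choose s hs using hgT
  obtain ⟨ns, -, hlim⟩ := exists_seq_tendsto_ae_of_tendsto_Lp hg
  filter_upwards [hlim, Lp.coeFn_const (p := p) (μ := μ) (1 : ℂ),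
    ae_all_iff.2 fun n => hv (s n)] with x hx h1 hvx
  rw [h1] at hx
  obtain ⟨i, hi⟩ := (hx.eventually_ne one_ne_zero).exists
  exact ⟨s (ns i), by rwa [hvx, hs]⟩

/-- analytic core of the Gelfand–Maurin nuclear spectral theorem.
Let `E` be a normed `ℂ`-space, `H` a separable complex Hilbert space, `(Λ, μ)` a finite
measure space, `U : H → L²(Λ, μ; ℂ)` unitary, `j : E → H` a continuous injective linear map
with dense range, `(f k)` continuous linear functionals with `∑ ‖f k‖ < ∞`, `(u k)` unit
vectors of `H` with `j φ = ∑' k, ⟨f k, φ⟩ • u k`, and `û k` measurable representatives of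
`U (u k)`. Then for `μ`-a.e. `λ` the map `f(λ) : φ ↦ ∑' k, ⟨f k, φ⟩ * û k λ` is a
well-defined (absolutely convergent) continuous linear functional on `E` which is not
identically zero, and for each `φ` the function `λ ↦ ⟨f(λ), φ⟩` represents `U (j φ)`. -/
theorem maurin_generalized_eigenvectors
    {E : Type*} [NormedAddCommGroup E] [NormedSpace ℂ E]
    {H : Type*} [NormedAddCommGroup H] [InnerProductSpace ℂ H] [CompleteSpace H]
    [TopologicalSpace.SeparableSpace H]
    {Λ : Type*} [MeasurableSpace Λ] (μ : Measure Λ) [IsFiniteMeasure μ]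
    (U : H ≃ₗᵢ[ℂ] Lp ℂ 2 μ)
    (j : E →L[ℂ] H) (hj_inj : Function.Injective j)
    (hj_dense : DenseRange j)
    (f : ℕ → E →L[ℂ] ℂ) (hS : Summable fun k => ‖f k‖)
    (u : ℕ → H) (hu : ∀ k, ‖u k‖ = 1)
    (hj : ∀ φ : E, j φ = ∑' k, (f k φ) • u k)
    (uhat : ℕ → Λ → ℂ) (huhat_meas : ∀ k, Measurable (uhat k))
    (huhat : ∀ k, uhat k =ᵐ[μ] (U (u k) : Λ → ℂ)) :
    (∀ᵐ l ∂μ, (∀ φ : E, Summable fun k => ‖f k φ * uhat k l‖) ∧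
      ∃ F : E →L[ℂ] ℂ, F ≠ 0 ∧ ∀ φ : E, F φ = ∑' k, f k φ * uhat k l) ∧
    (∀ φ : E, (fun l => ∑' k, f k φ * uhat k l) =ᵐ[μ] (U (j φ) : Λ → ℂ)) := by
  have hC : ∀ k, ∫⁻ l, ‖uhat k l‖ₑ ∂μ ≤ μ Set.univ ^ (1 / 2 : ℝ) := fun k => by
    have hnorm : eLpNorm (uhat k) 2 μ = 1 := by
      rw [eLpNorm_congr_ae (huhat k), ← Lp.enorm_def, ← ofReal_norm, U.norm_map, hu,
        ENNReal.ofReal_one]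
    have hle := eLpNorm_le_eLpNorm_mul_rpow_measure_univ (μ := μ) (p := 1) (q := 2)
      one_le_two (huhat_meas k).aestronglyMeasurable
    rw [hnorm, one_mul, eLpNorm_one_eq_lintegral_enorm] at hle
    refine hle.trans_eq ?_
    norm_num
  have hsum : ∀ᵐ l ∂μ, Summable fun k => ‖f k‖ * ‖uhat k l‖ :=
    ae_summable_norm_mul_norm_of_lintegral_le hS
      (fun k => (huhat_meas k).aestronglyMeasurable)
      (ENNReal.rpow_ne_top_of_nonneg (by norm_num) (measure_ne_top μ _)) hC
  have hsumφ : ∀ l, (Summable fun k => ‖f k‖ * ‖uhat k l‖) →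
      ∀ φ : E, Summable fun k => ‖f k φ * uhat k l‖ := fun l hl φ => by
    refine (hl.mul_right ‖φ‖).of_nonneg_of_le (fun k => norm_nonneg _) fun k => ?_
    rw [norm_mul, mul_right_comm]
    gcongr
    exact (f k).le_opNorm φ
  have hrep : ∀ φ : E, (fun l => ∑' k, f k φ * uhat k l) =ᵐ[μ] (U (j φ) : Λ → ℂ) := fun φ => by
    have hH : HasSum (fun k => f k φ • u k) (j φ) := by
      rw [hj φ]
      refine (Summable.of_norm_bounded (hS.mul_right ‖φ‖) fun k => ?_).hasSum
      rw [norm_smul, hu, mul_one]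
      exact (f k).le_opNorm φ
    have hL : HasSum (fun k => f k φ • U (u k)) (U (j φ)) := by
      simpa [Function.comp_def] using hH.map U U.continuous
    refine tsum_ae_eq_of_hasSum_Lp hL (fun k => ?_)
      (hsum.mono fun l hl => (hsumφ l hl φ).of_norm)
    filter_upwards [huhat k, Lp.coeFn_smul (f k φ) (U (u k))] with l h1 h2
    rw [h2, Pi.smul_apply, smul_eq_mul, h1]
  refine ⟨?_, hrep⟩
  filter_upwards [hsum, ae_exists_ne_zero_of_denseRange_Lp (T := fun φ => U (j φ))
    (U.surjective.denseRange.comp hj_dense U.continuous) hrep] with l hl ⟨φ₀, hφ₀⟩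
  have hF : Summable fun k => uhat k l • f k :=
    Summable.of_norm (by simpa only [norm_smul, mul_comm] using hl)
  have hFapply : ∀ φ : E, (∑' k, uhat k l • f k) φ = ∑' k, f k φ * uhat k l := fun φ => by
    simpa [mul_comm] using (ContinuousLinearMap.apply ℂ ℂ φ).map_tsum hF
  refine ⟨hsumφ l hl, ∑' k, uhat k l • f k, fun h0 => hφ₀ ?_, hFapply⟩
  rw [← hFapply, h0, zero_apply]
end

section
/- Let n ≥ 1, let a^{ij} : ℝⁿ → ℝ (1 ≤ i, j ≤ n) be smooth symmetric coefficients, uniformly elliptic (there are 0 < λ₀ ≤ λ₁ with λ₀|ξ|² ≤ ∑_{i,j} a^{ij}(x) ξ_i ξ_j ≤ λ₁|ξ|² for all x, ξ ∈ ℝⁿ), with all derivatives bounded, and let c : ℝⁿ → ℝ be smooth with all derivatives bounded. Define A φ = −∑_{i,j} ∂_i(a^{ij} ∂_j φ) + c φ. Let μ ∈ ℝ and let f be a tempered distribution on ℝⁿ satisfying ⟨f, A φ⟩ = μ ⟨f, φ⟩ for all Schwartz functions φ. Then f is represented by a smooth function g : ℝⁿ → ℂ (i.e. ⟨f, φ⟩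 = ∫_{ℝⁿ} g φ for all Schwartz φ), and for every m ∈ ℕ there exist constants C_m > 0 and N ∈ ℕ such that ∑_{|α| ≤ m} |D^α g(x)| ≤ C_m (1 + |x|)^N for all x ∈ ℝⁿ. -/
open MeasureTheory

namespace EllipticRegularity

open scoped SchwartzMap ContDiff LineDeriv BoundedContinuousFunction FourierTransform
  RealInnerProductSpace

section Seminorms

variable {E : Type*} [NormedAddCommGroup E] [NormedSpace ℝ E]

/-- The supremum of the Schwartz seminorms with both indices at most `N`. -/
noncomputable def supSeminorm (E : Type*) [NormedAddCommGroup E] [NormedSpace ℝ E] (N : ℕ) :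
    Seminorm ℂ 𝓢(E, ℂ) :=
  (Finset.Iic (N, N)).sup (schwartzSeminormFamily ℂ E ℂ)

lemma supSeminorm_mono {N M : ℕ} (h : N ≤ M) : supSeminorm E N ≤ supSeminorm E M :=
  Finset.sup_mono (Finset.Iic_subset_Iic.2 ⟨h, h⟩)

lemma seminorm_le_supSeminorm {N k l : ℕ} (hk : k ≤ N) (hl : l ≤ N) (φ : 𝓢(E, ℂ)) :
    SchwartzMap.seminorm ℂ k l φ ≤ supSeminorm E N φ := by
  have h : schwartzSeminormFamily ℂ E ℂ (k, l) ≤ supSeminorm E N :=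
    Finset.le_sup (f := schwartzSeminormFamily ℂ E ℂ) (Finset.mem_Iic.2 ⟨hk, hl⟩)
  exact h φ

lemma supSeminorm_le {N : ℕ} {φ : 𝓢(E, ℂ)} {M : ℝ} (hM : 0 ≤ M)
    (h : ∀ k ≤ N, ∀ l ≤ N, SchwartzMap.seminorm ℂ k l φ ≤ M) : supSeminorm E N φ ≤ M :=
  Seminorm.finset_sup_apply_le hM fun i hi ↦ by
    obtain ⟨h₁, h₂⟩ := Finset.mem_Iic.1 hi
    exact h i.1 h₁ i.2 h₂

lemma continuous_supSeminorm (N : ℕ) : Continuous (supSeminorm E N) :=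
  Finset.sup_induction (p := fun q : Seminorm ℂ 𝓢(E, ℂ) ↦ Continuous q) continuous_const
    (fun _ h₁ _ h₂ ↦ h₁.sup h₂)
    fun i _ ↦ (schwartz_withSeminorms ℂ E ℂ).continuous_seminorm i

/-- Every continuous seminorm on Schwartz space is dominated by some `supSeminorm`. -/
lemma exists_le_supSeminorm (q : Seminorm ℂ 𝓢(E, ℂ)) (hq : Continuous q) :
    ∃ C : ℝ, 0 ≤ C ∧ ∃ N, ∀ φ, q φ ≤ C * supSeminorm E N φ := by
  obtain ⟨s, C, -, h⟩ := Seminorm.bound_of_continuous (schwartz_withSeminorms ℂ E ℂ) q hq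
  refine ⟨C, C.2, s.sup fun i ↦ max i.1 i.2, fun φ ↦ (h φ).trans ?_⟩
  have h₁ : s.sup (schwartzSeminormFamily ℂ E ℂ) ≤ supSeminorm E (s.sup fun i ↦ max i.1 i.2) :=
    Finset.sup_mono fun i hi ↦ by
      have := Finset.le_sup (f := fun i : ℕ × ℕ ↦ max i.1 i.2) hi
      exact Finset.mem_Iic.2 ⟨(le_max_left _ _).trans this, (le_max_right _ _).trans this⟩
  exact mul_le_mul_of_nonneg_left (h₁ φ) C.2

lemma exists_norm_apply_le_supSeminorm (f : 𝓢(E, ℂ) →L[ℂ] ℂ) :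
    ∃ C : ℝ, 0 ≤ C ∧ ∃ N, ∀ φ, ‖f φ‖ ≤ C * supSeminorm E N φ :=
  exists_le_supSeminorm ((normSeminorm ℂ ℂ).comp f.toLinearMap) (f.continuous.norm)

lemma exists_seminorm_le_supSeminorm (k l : ℕ) (φ : 𝓢(E, ℂ)) :
    SchwartzMap.seminorm ℂ k l φ ≤ supSeminorm E (k + l) φ :=
  seminorm_le_supSeminorm (by lia) (by lia) φ

/-- Multiplication by a smooth function of at most linear growth, quantitatively. -/
lemma seminorm_mul_le {h : E → ℂ} (hh : ContDiff ℝ ∞ h) {k l : ℕ} {B : ℝ} (hB : 0 ≤ B)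
    (hb : ∀ j ≤ l, ∀ y, ‖iteratedFDeriv ℝ j h y‖ ≤ B * (1 + ‖y‖)) {φ ψ : 𝓢(E, ℂ)}
    (hψ : ∀ y, ψ y = h y * φ y) :
    SchwartzMap.seminorm ℂ k l ψ ≤ 2 ^ l * 2 * B * supSeminorm E (k + l + 1) φ := by
  have hP : 0 ≤ supSeminorm E (k + l + 1) φ := apply_nonneg _ _
  refine SchwartzMap.seminorm_le_bound ℂ k l ψ (by positivity) fun y ↦ ?_
  have hfun : (ψ : E → ℂ) = fun y ↦ h y * φ y := funext hψ
  rw [hfun]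
  have key : ∀ m ≤ l, ‖y‖ ^ k * ((1 + ‖y‖) * ‖iteratedFDeriv ℝ m φ y‖)
      ≤ 2 * supSeminorm E (k + l + 1) φ := fun m hm ↦ by
    have h₁ := (SchwartzMap.le_seminorm ℂ k m φ y).trans
      (seminorm_le_supSeminorm (N := k + l + 1) (by lia) (by lia) φ)
    have h₂ := (SchwartzMap.le_seminorm ℂ (k + 1) m φ y).trans
      (seminorm_le_supSeminorm (N := k + l + 1) (by lia) (by lia) φ)
    calc _ = ‖y‖ ^ k * ‖iteratedFDeriv ℝ m φ y‖ + ‖y‖ ^ (k + 1) * ‖iteratedFDeriv ℝ m φ y‖ := by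
          ring
      _ ≤ _ := by linarith
  calc ‖y‖ ^ k * ‖iteratedFDeriv ℝ l (fun y ↦ h y * φ y) y‖
      ≤ ‖y‖ ^ k * ∑ i ∈ Finset.range (l + 1), (l.choose i : ℝ) * ‖iteratedFDeriv ℝ i h y‖
          * ‖iteratedFDeriv ℝ (l - i) φ y‖ := by
        gcongr
        exact norm_iteratedFDeriv_mul_le hh (φ.smooth ⊤) y (mod_cast le_top)
    _ ≤ ‖y‖ ^ k * ∑ i ∈ Finset.range (l + 1), (l.choose i : ℝ) * (B * (1 + ‖y‖))
          * ‖iteratedFDeriv ℝ (l - i) φ y‖ := by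
        gcongr with i hi
        exact hb i (Finset.mem_range_succ_iff.1 hi) y
    _ = ∑ i ∈ Finset.range (l + 1), (l.choose i : ℝ) * B *
          (‖y‖ ^ k * ((1 + ‖y‖) * ‖iteratedFDeriv ℝ (l - i) φ y‖)) := by
        rw [Finset.mul_sum]
        exact Finset.sum_congr rfl fun i _ ↦ by ring
    _ ≤ ∑ i ∈ Finset.range (l + 1), (l.choose i : ℝ) * B *
          (2 * supSeminorm E (k + l + 1) φ) := by
        refine Finset.sum_le_sum fun i _ ↦ mul_le_mul_of_nonneg_left (key _ (Nat.sub_le _ _)) ?_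
        positivity
    _ = 2 ^ l * 2 * B * supSeminorm E (k + l + 1) φ := by
        rw [← Finset.sum_mul, ← Finset.sum_mul, ← Nat.cast_sum, Nat.sum_range_choose]
        push_cast
        ring

lemma supSeminorm_mul_le {h : E → ℂ} (hh : ContDiff ℝ ∞ h) {N : ℕ} {B : ℝ} (hB : 0 ≤ B)
    (hb : ∀ j ≤ N, ∀ y, ‖iteratedFDeriv ℝ j h y‖ ≤ B * (1 + ‖y‖)) {φ ψ : 𝓢(E, ℂ)}
    (hψ : ∀ y, ψ y = h y * φ y) :
    supSeminorm E N ψ ≤ 2 ^ N * 2 * B * supSeminorm E (N + N + 1) φ := by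
  have hP : 0 ≤ supSeminorm E (N + N + 1) φ := apply_nonneg _ _
  refine supSeminorm_le (by positivity) fun k hk l hl ↦
    (seminorm_mul_le hh hB (fun j hj ↦ hb j (hj.trans hl)) hψ).trans ?_
  gcongr
  · norm_num
  · exact supSeminorm_mono (by lia) φ

end Seminorms

section OperatorFamilies

variable {E : Type*} [NormedAddCommGroup E] [NormedSpace ℝ E] {ι : Type*}

/-- A family of operators on Schwartz space is bounded, in every Schwartz seminorm,
by a multiple of the weight `ρ`. -/
def OpBound (T : ι → 𝓢(E, ℂ) →L[ℂ] 𝓢(E, ℂ)) (ρ : ι → ℝ) : Prop :=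
  ∀ M, ∃ C : ℝ, 0 ≤ C ∧ ∃ N, ∀ i φ, supSeminorm E M (T i φ) ≤ C * ρ i * supSeminorm E N φ

variable {T S : ι → 𝓢(E, ℂ) →L[ℂ] 𝓢(E, ℂ)} {ρ σ : ι → ℝ}

lemma OpBound.const (T : 𝓢(E, ℂ) →L[ℂ] 𝓢(E, ℂ)) (hρ : ∀ i, 1 ≤ ρ i) :
    OpBound (fun _ ↦ T) ρ := fun M ↦ by
  obtain ⟨C, hC, N, h⟩ := exists_le_supSeminorm ((supSeminorm E M).comp T.toLinearMap)
    ((continuous_supSeminorm M).comp T.continuous)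
  refine ⟨C, hC, N, fun i φ ↦ (h φ).trans ?_⟩
  gcongr
  exact le_mul_of_one_le_right hC (hρ i)

lemma OpBound.comp (hT : OpBound T ρ) (hS : OpBound S σ) (hρ : ∀ i, 0 ≤ ρ i) :
    OpBound (fun i ↦ T i ∘L S i) (fun i ↦ ρ i * σ i) := fun M ↦ by
  obtain ⟨C, hC, N, h⟩ := hT M
  obtain ⟨C', hC', N', h'⟩ := hS N
  refine ⟨C * C', by positivity, N', fun i φ ↦ (h i (S i φ)).trans ?_⟩
  have := mul_le_mul_of_nonneg_left (h' i φ) (mul_nonneg hC (hρ i))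
  exact this.trans_eq (by ring)

lemma OpBound.smul {s : ι → ℂ} (hs : ∀ i, ‖s i‖ ≤ ρ i) (hT : OpBound T fun _ ↦ 1) :
    OpBound (fun i ↦ s i • T i) ρ := fun M ↦ by
  obtain ⟨C, hC, N, h⟩ := hT M
  refine ⟨C, hC, N, fun i φ ↦ ?_⟩
  have h₁ := h i φ
  rw [mul_one] at h₁
  have h₀ : 0 ≤ C * supSeminorm E N φ := mul_nonneg hC (apply_nonneg _ _)
  calc supSeminorm E M ((s i • T i) φ) = ‖s i‖ * supSeminorm E M (T i φ) := by
        rw [smul_apply, map_smul_eq_mul]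
    _ ≤ ρ i * (C * supSeminorm E N φ) := by
        gcongr
        exact (norm_nonneg _).trans (hs i)
        exact hs i
    _ = _ := by ring

lemma OpBound.add (hT : OpBound T ρ) (hS : OpBound S ρ) (hρ : ∀ i, 0 ≤ ρ i) :
    OpBound (fun i ↦ T i + S i) ρ := fun M ↦ by
  obtain ⟨C, hC, N, h⟩ := hT M
  obtain ⟨C', hC', N', h'⟩ := hS M
  refine ⟨C + C', by positivity, max N N', fun i φ ↦ ?_⟩
  have h₁ := supSeminorm_mono (le_max_left N N') φ
  have h₂ := supSeminorm_mono (le_max_right N N') φ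
  calc _ ≤ supSeminorm E M (T i φ) + supSeminorm E M (S i φ) := map_add_le_add _ _ _
    _ ≤ C * ρ i * supSeminorm E N φ + C' * ρ i * supSeminorm E N' φ := add_le_add (h i φ) (h' i φ)
    _ ≤ C * ρ i * supSeminorm E (max N N') φ + C' * ρ i * supSeminorm E (max N N') φ :=
        add_le_add (mul_le_mul_of_nonneg_left h₁ (mul_nonneg hC (hρ i)))
          (mul_le_mul_of_nonneg_left h₂ (mul_nonneg hC' (hρ i)))
    _ = _ := by ring

lemma OpBound.sum {κ : Type*} (s : Finset κ) {T : κ → ι → 𝓢(E, ℂ) →L[ℂ] 𝓢(E, ℂ)}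
    (hT : ∀ k ∈ s, OpBound (T k) ρ) (hρ : ∀ i, 0 ≤ ρ i) :
    OpBound (fun i ↦ ∑ k ∈ s, T k i) ρ := by
  classical
  induction s using Finset.induction_on with
  | empty => exact fun M ↦ ⟨0, le_rfl, 0, fun i φ ↦ by simp⟩
  | insert a s ha ih =>
    simp only [Finset.sum_insert ha]
    exact (hT a (Finset.mem_insert_self a s)).add
      (ih fun k hk ↦ hT k (Finset.mem_insert_of_mem hk)) hρ

lemma OpBound.pow (hT : OpBound T ρ) (hρ : ∀ i, 0 ≤ ρ i) (K : ℕ) :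
    OpBound (fun i ↦ T i ^ K) (fun i ↦ ρ i ^ K) := by
  induction K with
  | zero => simpa using OpBound.const (1 : 𝓢(E, ℂ) →L[ℂ] 𝓢(E, ℂ)) fun _ : ι ↦ le_rfl
  | succ K ih =>
    simp only [pow_succ]
    exact ih.comp hT fun i ↦ pow_nonneg (hρ i) K

lemma OpBound.of_mul {h : ι → E → ℂ} (hh : ∀ i, ContDiff ℝ ∞ (h i)) (hρ : ∀ i, 0 ≤ ρ i)
    (hb : ∀ l, ∃ C : ℝ, 0 ≤ C ∧ ∀ j ≤ l, ∀ i y, ‖iteratedFDeriv ℝ j (h i) y‖ ≤ C * ρ i)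
    (hT : ∀ i φ y, T i φ y = h i y * φ y) : OpBound T ρ := fun M ↦ by
  obtain ⟨C, hC, hC'⟩ := hb M
  refine ⟨2 ^ M * 2 * C, by positivity, M + M + 1, fun i φ ↦ ?_⟩
  have h₁ := supSeminorm_mul_le (hh i) (mul_nonneg hC (hρ i)) (fun j hj y ↦
    (hC' j hj i y).trans (le_mul_of_one_le_right (mul_nonneg hC (hρ i)) (by simp))) (hT i φ)
  exact h₁.trans_eq (by ring)

end OperatorFamilies

section Dilations

variable {E G : Type*} [NormedAddCommGroup E] [NormedSpace ℝ E]
  [NormedAddCommGroup G] [NormedSpace ℝ G]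

lemma norm_iteratedFDeriv_comp_clm_le {h : G → ℂ} (hh : ContDiff ℝ ∞ h) (L : E →L[ℝ] G)
    (j : ℕ) (y : E) :
    ‖iteratedFDeriv ℝ j (fun y ↦ h (L y)) y‖ ≤ ‖iteratedFDeriv ℝ j h (L y)‖ * ‖L‖ ^ j := by
  have h₁ := L.iteratedFDeriv_comp_right hh y (i := j) (mod_cast le_top)
  rw [Function.comp_def] at h₁
  rw [h₁]
  simpa using ContinuousMultilinearMap.norm_compContinuousLinearMap_le
    (iteratedFDeriv ℝ j h (L y)) fun _ ↦ L

/-- If `h` has bounded derivatives, multiplication by `h ∘ L - h 0` tends to zero as `L → 0`. -/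
lemma seminorm_comp_clm_sub_mul_le {h : G → ℂ} (hh : ContDiff ℝ ∞ h) {k l : ℕ} {B : ℝ}
    (hb : ∀ j ≤ l + 1, ∀ y, ‖iteratedFDeriv ℝ j h y‖ ≤ B) {L : E →L[ℝ] G} (hL : ‖L‖ ≤ 1)
    {φ ψ : 𝓢(E, ℂ)} (hψ : ∀ y, ψ y = (h (L y) - h 0) * φ y) :
    SchwartzMap.seminorm ℂ k l ψ ≤ 2 ^ l * 2 * (B * ‖L‖) * supSeminorm E (k + l + 1) φ := by
  have hB : 0 ≤ B := (norm_nonneg _).trans (hb 0 (by lia) 0)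
  have hcomp : ContDiff ℝ ∞ fun y ↦ h (L y) := hh.comp L.contDiff
  refine seminorm_mul_le (hcomp.sub contDiff_const) (by positivity) (fun j hj y ↦ ?_) hψ
  have hle : B * ‖L‖ * 1 ≤ B * ‖L‖ * (1 + ‖y‖) := by
    gcongr
    linarith [norm_nonneg y]
  rcases Nat.eq_zero_or_pos j with rfl | hj0
  · rw [norm_iteratedFDeriv_zero]
    have h₁ : ‖h (L y) - h 0‖ ≤ B * ‖L y - 0‖ :=
      Convex.norm_image_sub_le_of_norm_fderiv_le (𝕜 := ℝ) (s := Set.univ)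
        (fun x _ ↦ (hh.differentiable (by simp)).differentiableAt)
        (fun x _ ↦ by simpa using hb 1 (by lia) x) convex_univ trivial trivial
    rw [sub_zero] at h₁
    calc _ ≤ B * ‖L y‖ := h₁
      _ ≤ B * (‖L‖ * ‖y‖) := by gcongr; exact L.le_opNorm y
      _ ≤ B * ‖L‖ * (1 + ‖y‖) := by nlinarith [mul_nonneg hB (norm_nonneg L)]
  · have h₁ : iteratedFDeriv ℝ j (fun y ↦ h (L y) - h 0) y
        = iteratedFDeriv ℝ j (fun y ↦ h (L y)) y := by
      rw [fun_iteratedFDeriv_sub_apply (hcomp.contDiffAt.of_le (mod_cast le_top))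
        contDiffAt_const, iteratedFDeriv_const_of_ne (by lia)]
      simp
    rw [h₁]
    calc _ ≤ ‖iteratedFDeriv ℝ j h (L y)‖ * ‖L‖ ^ j := norm_iteratedFDeriv_comp_clm_le hh L j y
      _ ≤ B * ‖L‖ := by
        gcongr
        · exact hb j (by lia) _
        · exact pow_le_of_le_one (norm_nonneg _) hL (by lia)
      _ ≤ _ := by linarith

end Dilations

section Characters

lemma iteratedDeriv_fourierChar (j : ℕ) :
    iteratedDeriv j (fun t : ℝ ↦ (Real.fourierChar t : ℂ))
      = fun t ↦ (2 * Real.pi * Complex.I) ^ j * (Real.fourierChar t : ℂ) := by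
  induction j with
  | zero => simp
  | succ j ih =>
    rw [iteratedDeriv_succ, ih]
    ext t
    rw [deriv_const_mul_field, Real.deriv_fourierChar]
    ring

lemma contDiff_fourierChar : ContDiff ℝ ∞ fun t : ℝ ↦ (Real.fourierChar t : ℂ) := by
  simp only [Real.fourierChar_apply]
  exact Complex.contDiff_exp.comp
    ((Complex.ofRealCLM.contDiff.comp (contDiff_const.mul contDiff_id)).mul contDiff_const)

lemma norm_iteratedFDeriv_fourierChar (j : ℕ) (t : ℝ) :
    ‖iteratedFDeriv ℝ j (fun t : ℝ ↦ (Real.fourierChar t : ℂ)) t‖ = (2 * Real.pi) ^ j := by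
  rw [norm_iteratedFDeriv_eq_norm_iteratedDeriv, iteratedDeriv_fourierChar]
  simp [abs_of_pos Real.pi_pos, Circle.norm_coe]

variable {E : Type*} [NormedAddCommGroup E] [InnerProductSpace ℝ E]

/-- The plane wave `y ↦ exp (2πi ⟪ξ, y⟫)`. -/
noncomputable def planeWave (ξ : E) (y : E) : ℂ := Real.fourierChar (innerSL ℝ ξ y)

lemma contDiff_planeWave (ξ : E) : ContDiff ℝ ∞ (planeWave ξ) :=
  contDiff_fourierChar.comp (innerSL ℝ ξ).contDiff

lemma planeWave_add (ξ η : E) (y : E) : planeWave (ξ + η) y = planeWave ξ y * planeWave η y := by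
  simp [planeWave, AddChar.map_add_eq_mul, Circle.coe_mul]

lemma norm_iteratedFDeriv_planeWave_le (j : ℕ) (ξ y : E) :
    ‖iteratedFDeriv ℝ j (planeWave ξ) y‖ ≤ (2 * Real.pi) ^ j * ‖ξ‖ ^ j := by
  have h := norm_iteratedFDeriv_comp_clm_le contDiff_fourierChar (innerSL ℝ ξ) j y
  rwa [norm_iteratedFDeriv_fourierChar, innerSL_apply_norm] at h

lemma norm_iteratedFDeriv_planeWave_le_pow {j N : ℕ} (h : j ≤ N) (ξ y : E) :
    ‖iteratedFDeriv ℝ j (planeWave ξ) y‖ ≤ (2 * Real.pi) ^ N * (1 + ‖ξ‖) ^ N := by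
  have hpi : 1 ≤ 2 * Real.pi := by linarith [Real.pi_gt_three]
  have hξ : 1 ≤ 1 + ‖ξ‖ := by simp
  calc _ ≤ (2 * Real.pi) ^ j * ‖ξ‖ ^ j := norm_iteratedFDeriv_planeWave_le j ξ y
    _ ≤ (2 * Real.pi) ^ N * (1 + ‖ξ‖) ^ j := by
      gcongr
      linarith
    _ ≤ _ := by gcongr

lemma hasTemperateGrowth_planeWave (ξ : E) : (planeWave ξ).HasTemperateGrowth :=
  ⟨contDiff_planeWave ξ, fun j ↦ ⟨0, _, fun y ↦ by
    simpa using norm_iteratedFDeriv_planeWave_le j ξ y⟩⟩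

/-- Multiplication by a plane wave on Schwartz space. -/
noncomputable def modulation (ξ : E) : 𝓢(E, ℂ) →L[ℂ] 𝓢(E, ℂ) :=
  SchwartzMap.smulLeftCLM ℂ (planeWave ξ)

@[simp]
lemma modulation_apply (ξ : E) (φ : 𝓢(E, ℂ)) (y : E) :
    modulation ξ φ y = planeWave ξ y * φ y := by
  simp [modulation, hasTemperateGrowth_planeWave ξ]

lemma supSeminorm_modulation_le (N : ℕ) (ξ : E) (φ : 𝓢(E, ℂ)) :
    supSeminorm E N (modulation ξ φ)
      ≤ 2 ^ N * 2 * ((2 * Real.pi) ^ N * (1 + ‖ξ‖) ^ N) * supSeminorm E (N + N + 1) φ := by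
  refine supSeminorm_mul_le (contDiff_planeWave ξ) (by positivity) (fun j hj y ↦ ?_)
    (modulation_apply ξ φ)
  exact (norm_iteratedFDeriv_planeWave_le_pow hj ξ y).trans
    (le_mul_of_one_le_right (by positivity) (by simp))

lemma continuous_modulation (φ : 𝓢(E, ℂ)) : Continuous fun ξ ↦ modulation ξ φ := by
  rw [continuous_iff_continuousAt]
  intro ξ₀
  rw [ContinuousAt, (schwartz_withSeminorms ℂ E ℂ).tendsto_nhds]
  rintro ⟨k, l⟩ ε hε
  have hpi : 1 ≤ 2 * Real.pi := by linarith [Real.pi_gt_three]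
  have hlim : Filter.Tendsto (fun ξ : E ↦ 2 ^ l * 2 * ((2 * Real.pi) ^ (l + 1) * ‖ξ - ξ₀‖)
      * supSeminorm E (k + l + 1) (modulation ξ₀ φ)) (nhds ξ₀) (nhds 0) := by
    have : Continuous (fun ξ : E ↦ 2 ^ l * 2 * ((2 * Real.pi) ^ (l + 1) * ‖ξ - ξ₀‖)
      * supSeminorm E (k + l + 1) (modulation ξ₀ φ)) := by fun_prop
    simpa using this.tendsto ξ₀
  filter_upwards [hlim.eventually_lt_const hε, Metric.ball_mem_nhds ξ₀ one_pos] with ξ h₁ h₂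
  refine lt_of_le_of_lt ?_ h₁
  have h₃ := seminorm_comp_clm_sub_mul_le (k := k) (l := l) (B := (2 * Real.pi) ^ (l + 1))
    (L := innerSL ℝ (ξ - ξ₀)) (φ := modulation ξ₀ φ) (ψ := modulation ξ φ - modulation ξ₀ φ)
    contDiff_fourierChar
    (fun j hj t ↦ (norm_iteratedFDeriv_fourierChar j t).trans_le (pow_le_pow_right₀ hpi hj))
    (by rw [innerSL_apply_norm]; exact (mem_ball_iff_norm.1 h₂).le)
    (fun y ↦ by
      have h := planeWave_add (ξ - ξ₀) ξ₀ y
      rw [sub_add_cancel] at h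
      rw [sub_apply, modulation_apply, modulation_apply, h, AddChar.map_zero_eq_one,
        Circle.coe_one, planeWave]
      ring)
  rwa [innerSL_apply_norm] at h₃

end Characters

section UniformlySmooth

variable {E F : Type*} [NormedAddCommGroup E] [NormedSpace ℝ E]
  [NormedAddCommGroup F] [NormedSpace ℝ F] {ι : Type*}

/-- A family of smooth functions whose derivatives of each order are uniformly bounded. -/
structure UniformlySmooth (h : ι → E → F) : Prop where
  contDiff : ∀ i, ContDiff ℝ ∞ (h i)
  bound : ∀ l, ∃ C : ℝ, ∀ i y, ‖iteratedFDeriv ℝ l (h i) y‖ ≤ C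

namespace UniformlySmooth

variable {h g : ι → E → F}

lemma exists_bound_le (hh : UniformlySmooth h) (l : ℕ) :
    ∃ C : ℝ, 1 ≤ C ∧ ∀ j ≤ l, ∀ i y, ‖iteratedFDeriv ℝ j (h i) y‖ ≤ C := by
  choose C hC using hh.bound
  have h₀ : ∀ j ∈ Finset.range (l + 1), 0 ≤ |C j| := fun _ _ ↦ abs_nonneg _
  refine ⟨1 + ∑ j ∈ Finset.range (l + 1), |C j|, by simpa using Finset.sum_nonneg h₀,
    fun j hj i y ↦ ?_⟩
  have h₁ := Finset.single_le_sum h₀ (Finset.mem_range_succ_iff.2 hj)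
  linarith [hC j i y, le_abs_self (C j)]

lemma add (hh : UniformlySmooth h) (hg : UniformlySmooth g) :
    UniformlySmooth fun i y ↦ h i y + g i y := by
  refine ⟨fun i ↦ (hh.contDiff i).add (hg.contDiff i), fun l ↦ ?_⟩
  obtain ⟨C, hC⟩ := hh.bound l
  obtain ⟨C', hC'⟩ := hg.bound l
  refine ⟨C + C', fun i y ↦ ?_⟩
  rw [fun_iteratedFDeriv_add_apply ((hh.contDiff i).contDiffAt.of_le (mod_cast le_top))
    ((hg.contDiff i).contDiffAt.of_le (mod_cast le_top))]
  exact (norm_add_le _ _).trans (add_le_add (hC i y) (hC' i y))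

lemma const (v : F) : UniformlySmooth fun (_ : ι) (_ : E) ↦ v := by
  refine ⟨fun i ↦ contDiff_const, fun l ↦ ⟨‖v‖, fun i y ↦ ?_⟩⟩
  rcases Nat.eq_zero_or_pos l with rfl | hl
  · simp
  · rw [iteratedFDeriv_const_of_ne (by lia)]
    simp

lemma sum {κ : Type*} (s : Finset κ) {h : κ → ι → E → F} (hh : ∀ k ∈ s, UniformlySmooth (h k)) :
    UniformlySmooth fun i y ↦ ∑ k ∈ s, h k i y := by
  classical
  induction s using Finset.induction_on with
  | empty => simpa using const (0 : F)
  | insert a s ha ih =>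
    simp only [Finset.sum_insert ha]
    exact (hh a (Finset.mem_insert_self a s)).add (ih fun k hk ↦ hh k (Finset.mem_insert_of_mem hk))

lemma smul (hh : UniformlySmooth h) {s : ι → ℝ} {B : ℝ} (hs : ∀ i, |s i| ≤ B) :
    UniformlySmooth fun i y ↦ s i • h i y := by
  refine ⟨fun i ↦ contDiff_const.smul (hh.contDiff i), fun l ↦ ?_⟩
  obtain ⟨C, hC⟩ := hh.bound l
  refine ⟨B * C, fun i y ↦ ?_⟩
  have h₁ : iteratedFDeriv ℝ l (fun y ↦ s i • h i y) y = s i • iteratedFDeriv ℝ l (h i) y :=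
    iteratedFDeriv_const_smul_apply ((hh.contDiff i).contDiffAt.of_le (mod_cast le_top))
  rw [h₁, norm_smul, Real.norm_eq_abs]
  have := abs_nonneg (s i)
  gcongr
  · linarith [hs i]
  · exact hs i
  · exact hC i y

lemma inv {h : ι → E → ℝ} (hh : UniformlySmooth h) {κ : ℝ} (hκ : 0 < κ)
    (hle : ∀ i y, κ ≤ h i y) : UniformlySmooth fun i y ↦ (h i y)⁻¹ := by
  have hpos : ∀ i y, 0 < h i y := fun i y ↦ hκ.trans_le (hle i y)
  refine ⟨fun i ↦ (hh.contDiff i).inv fun y ↦ (hpos i y).ne', fun l ↦ ?_⟩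
  obtain ⟨D, hD, hD'⟩ := hh.exists_bound_le l
  refine ⟨l.factorial * (∑ j ∈ Finset.range (l + 1), j.factorial * κ ^ (-1 - j : ℤ)) * D ^ l,
    fun i y ↦ ?_⟩
  have h₁ := norm_iteratedFDerivWithin_comp_le (𝕜 := ℝ) (g := fun t : ℝ ↦ t⁻¹) (f := h i) (n := l)
    (s := Set.univ) (t := Set.Ioi 0) (x := y) (N := ∞)
    (fun t ht ↦ (contDiffAt_inv ℝ (ne_of_gt ht)).contDiffWithinAt)
    (hh.contDiff i).contDiffOn (mod_cast le_top) (uniqueDiffOn_Ioi 0) uniqueDiffOn_univ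
    (fun y _ ↦ hpos i y) trivial
    (C := ∑ j ∈ Finset.range (l + 1), j.factorial * κ ^ (-1 - j : ℤ)) (D := D)
    (fun j hj ↦ ?_) (fun j hj hjl ↦ ?_)
  · rwa [iteratedFDerivWithin_univ] at h₁
  · rw [iteratedFDerivWithin_of_isOpen j isOpen_Ioi (hpos i y),
      norm_iteratedFDeriv_eq_norm_iteratedDeriv, iteratedDeriv_eq_iterate]
    have h₂ := iter_deriv_inv j (h i y)
    have h₃ : ‖deriv^[j] (fun t : ℝ ↦ t⁻¹) (h i y)‖ = j.factorial * (h i y) ^ (-1 - j : ℤ) := by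
      rw [show (fun t : ℝ ↦ t⁻¹) = Inv.inv from rfl, h₂]
      simp [abs_of_pos (hpos i y)]
    rw [h₃]
    have h₄ : (h i y) ^ (-1 - j : ℤ) ≤ κ ^ (-1 - j : ℤ) := by
      rw [show (-1 - j : ℤ) = -((1 + j : ℕ) : ℤ) by push_cast; ring, zpow_neg, zpow_neg,
        zpow_natCast, zpow_natCast]
      gcongr
      exact hle i y
    refine (mul_le_mul_of_nonneg_left h₄ (by positivity)).trans ?_
    exact Finset.single_le_sum (f := fun j : ℕ ↦ (j.factorial : ℝ) * κ ^ (-1 - j : ℤ))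
      (fun _ _ ↦ by positivity) (Finset.mem_range_succ_iff.2 hj)
  · rw [iteratedFDerivWithin_univ]
    exact (hD' j hjl i y).trans (le_self_pow₀ hD (by lia))

lemma ofReal {h : ι → E → ℝ} (hh : UniformlySmooth h) :
    UniformlySmooth fun i y ↦ (h i y : ℂ) := by
  refine ⟨fun i ↦ Complex.ofRealCLM.contDiff.comp (hh.contDiff i), fun l ↦ ?_⟩
  obtain ⟨C, hC⟩ := hh.bound l
  refine ⟨C, fun i y ↦ ?_⟩
  have h₁ := Complex.ofRealLI.norm_iteratedFDeriv_comp_left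
    ((hh.contDiff i).contDiffAt (x := y)) (i := l) (mod_cast le_top)
  exact h₁.trans_le (hC i y)

lemma hasTemperateGrowth (hh : UniformlySmooth h) (i : ι) : (h i).HasTemperateGrowth :=
  ⟨hh.contDiff i, fun l ↦ by
    obtain ⟨C, hC⟩ := hh.bound l
    exact ⟨0, C, fun y ↦ by simpa using hC i y⟩⟩

lemma opBound {h : ι → E → ℂ} (hh : UniformlySmooth h) :
    OpBound (fun i ↦ SchwartzMap.smulLeftCLM ℂ (h i) : ι → 𝓢(E, ℂ) →L[ℂ] 𝓢(E, ℂ))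
      fun _ ↦ 1 := by
  refine OpBound.of_mul hh.contDiff (fun _ ↦ zero_le_one) (fun l ↦ ?_) fun i φ y ↦ by
    rw [SchwartzMap.smulLeftCLM_apply_apply (hh.hasTemperateGrowth i), smul_eq_mul]
  obtain ⟨C, hC, h₁⟩ := hh.exists_bound_le l
  exact ⟨C, by linarith, by simpa using h₁⟩

end UniformlySmooth

end UniformlySmooth

lemma OpBound.mono {E ι : Type*} [NormedAddCommGroup E] [NormedSpace ℝ E]
    {T : ι → 𝓢(E, ℂ) →L[ℂ] 𝓢(E, ℂ)} {ρ σ : ι → ℝ} (hT : OpBound T ρ) {B : ℝ} (hB : 0 ≤ B)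
    (hle : ∀ i, ρ i ≤ B * σ i) : OpBound T σ := fun M ↦ by
  obtain ⟨C, hC, N, h⟩ := hT M
  refine ⟨C * B, by positivity, N, fun i φ ↦ (h i φ).trans ?_⟩
  rw [mul_assoc C B]
  gcongr
  exact hle i

section Decay

variable {E : Type*} [NormedAddCommGroup E] [InnerProductSpace ℝ E]

/-- If testing `f` against `e_ξ w` gains a power of `ξ` at each step, then `ξ ↦ f (e_ξ w)`
decays rapidly. -/
lemma exists_decay_of_opBound {f : 𝓢(E, ℂ) →L[ℂ] ℂ} {T : E → 𝓢(E, ℂ) →L[ℂ] 𝓢(E, ℂ)}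
    (hT : OpBound T fun ξ ↦ (1 + ‖ξ‖)⁻¹)
    (hf : ∀ ξ w, f (modulation ξ w) = f (modulation ξ (T ξ w))) (K : ℕ) :
    ∃ C : ℝ, 0 ≤ C ∧ ∃ N, ∀ ξ w,
      ‖f (modulation ξ w)‖ ≤ C * ((1 + ‖ξ‖) ^ K)⁻¹ * supSeminorm E N w := by
  obtain ⟨C, hC, N, h⟩ := exists_norm_apply_le_supSeminorm f
  obtain ⟨C', hC', N', h'⟩ := hT.pow (fun ξ ↦ by positivity) (N + K) (N + N + 1)
  have hiter : ∀ (m : ℕ) ξ w, f (modulation ξ w) = f (modulation ξ ((T ξ ^ m) w)) := by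
    intro m ξ
    induction m with
    | zero => simp
    | succ m ih => exact fun w ↦ by rw [hf, ih, pow_succ]; rfl
  refine ⟨C * (2 ^ N * 2 * (2 * Real.pi) ^ N) * C', by positivity, N', fun ξ w ↦ ?_⟩
  have hξ : 1 + ‖ξ‖ ≠ 0 := by positivity
  calc ‖f (modulation ξ w)‖ = ‖f (modulation ξ ((T ξ ^ (N + K)) w))‖ := by rw [← hiter]
    _ ≤ C * supSeminorm E N (modulation ξ ((T ξ ^ (N + K)) w)) := h _
    _ ≤ C * (2 ^ N * 2 * ((2 * Real.pi) ^ N * (1 + ‖ξ‖) ^ N)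
        * (C' * (1 + ‖ξ‖)⁻¹ ^ (N + K) * supSeminorm E N' w)) := by
      gcongr
      exact (supSeminorm_modulation_le N ξ _).trans (by gcongr; exact h' ξ w)
    _ = _ := by
      rw [pow_add, inv_pow, inv_pow]
      field_simp

end Decay

section Elliptic

variable {n : ℕ}

local notation "𝔼" => EuclideanSpace ℝ (Fin n)

/-- The frequency `2πi ξᵢ`. -/
noncomputable def frequency (ξ : EuclideanSpace ℝ (Fin n)) (i : Fin n) : ℂ :=
  2 * Real.pi * Complex.I * ξ i

/-- The partial derivative `∂ᵢ` on Schwartz space. -/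
noncomputable def partialDeriv (i : Fin n) : 𝓢(EuclideanSpace ℝ (Fin n), ℂ) →L[ℂ]
    𝓢(EuclideanSpace ℝ (Fin n), ℂ) :=
  LineDeriv.lineDerivOpCLM ℂ 𝓢(EuclideanSpace ℝ (Fin n), ℂ) (EuclideanSpace.single i (1 : ℝ))

lemma partialDeriv_apply (i : Fin n) (φ : 𝓢(𝔼, ℂ)) (y : 𝔼) :
    partialDeriv i φ y = fderiv ℝ φ y (EuclideanSpace.single i 1) := by
  rw [partialDeriv, LineDeriv.lineDerivOpCLM_apply, SchwartzMap.lineDerivOp_apply_eq_fderiv]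

lemma fderiv_planeWave_single (ξ y : 𝔼) (i : Fin n) :
    fderiv ℝ (planeWave ξ) y (EuclideanSpace.single i 1)
      = frequency ξ i * planeWave ξ y := by
  have h₁ : HasFDerivAt (fun y ↦ innerSL ℝ ξ y) (innerSL ℝ ξ) y := (innerSL ℝ ξ).hasFDerivAt
  have h₂ := ((contDiff_fourierChar.differentiable (by simp)).differentiableAt
    (x := innerSL ℝ ξ y)).hasFDerivAt.comp y h₁
  have h₃ : HasFDerivAt (planeWave ξ) _ y := h₂
  rw [h₃.fderiv, ContinuousLinearMap.comp_apply, fderiv_eq_smul_deriv, Real.deriv_fourierChar]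
  simp [planeWave, frequency, EuclideanSpace.inner_single_right]
  ring

lemma partialDeriv_modulation (i : Fin n) (ξ : 𝔼) (φ : 𝓢(𝔼, ℂ)) :
    partialDeriv i (modulation ξ φ)
      = modulation ξ (partialDeriv i φ + frequency ξ i • φ) := by
  ext y
  have h₁ : (modulation ξ φ : 𝔼 → ℂ) = fun y ↦ planeWave ξ y * φ y :=
    funext (modulation_apply ξ φ)
  rw [partialDeriv_apply, h₁, modulation_apply,
    fderiv_fun_mul ((contDiff_planeWave ξ).differentiable (by simp)).differentiableAt
      φ.differentiableAt]
  simp only [add_apply, smul_apply, fderiv_planeWave_single, partialDeriv_apply, smul_eq_mul]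
  ring

lemma smulLeftCLM_modulation {h : 𝔼 → ℂ} (hh : h.HasTemperateGrowth) (ξ : 𝔼) (φ : 𝓢(𝔼, ℂ)) :
    SchwartzMap.smulLeftCLM ℂ h (modulation ξ φ)
      = modulation ξ (SchwartzMap.smulLeftCLM ℂ h φ) := by
  ext y
  simp only [SchwartzMap.smulLeftCLM_apply_apply hh, modulation_apply, smul_eq_mul]
  ring

variable (b : Fin n → Fin n → 𝓢(EuclideanSpace ℝ (Fin n), ℂ) →L[ℂ] 𝓢(EuclideanSpace ℝ (Fin n), ℂ))
  (d : 𝓢(EuclideanSpace ℝ (Fin n), ℂ) →L[ℂ] 𝓢(EuclideanSpace ℝ (Fin n), ℂ))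

/-- The operator `-∑ ∂ᵢ bᵢⱼ ∂ⱼ + d`. -/
noncomputable def divergenceForm :
    𝓢(EuclideanSpace ℝ (Fin n), ℂ) →L[ℂ] 𝓢(EuclideanSpace ℝ (Fin n), ℂ) :=
  d - ∑ i, ∑ j, partialDeriv i ∘L b i j ∘L partialDeriv j

/-- The leading part of the conjugate of `divergenceForm b d` by `e_ξ`, plus the identity. -/
noncomputable def leadingPart (ξ : EuclideanSpace ℝ (Fin n)) :
    𝓢(EuclideanSpace ℝ (Fin n), ℂ) →L[ℂ] 𝓢(EuclideanSpace ℝ (Fin n), ℂ) :=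
  1 - ∑ i, ∑ j, (frequency ξ j * frequency ξ i) • b i j

/-- The lower order part of the conjugate of `divergenceForm b d` by `e_ξ`, minus the identity. -/
noncomputable def lowerPart (ξ : EuclideanSpace ℝ (Fin n)) :
    𝓢(EuclideanSpace ℝ (Fin n), ℂ) →L[ℂ] 𝓢(EuclideanSpace ℝ (Fin n), ℂ) :=
  (divergenceForm b d - 1) + ∑ i, ∑ j, (frequency ξ i • -(b i j ∘L partialDeriv j)
    + frequency ξ j • -(partialDeriv i ∘L b i j))

variable {b d}

lemma divergenceForm_modulation (hb : ∀ i j ξ φ, b i j (modulation ξ φ) = modulation ξ (b i j φ))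
    (hd : ∀ ξ φ, d (modulation ξ φ) = modulation ξ (d φ)) (ξ : 𝔼) (φ : 𝓢(𝔼, ℂ)) :
    divergenceForm b d (modulation ξ φ)
      = modulation ξ (leadingPart b ξ φ + lowerPart b d ξ φ) := by
  simp only [divergenceForm, leadingPart, lowerPart, sub_apply, add_apply, sum_apply,
    ContinuousLinearMap.comp_apply, partialDeriv_modulation, hb, hd, map_sum, map_sub,
    map_add, map_neg, map_smul, smul_apply, neg_apply, one_apply_eq_self,
    Finset.sum_add_distrib, smul_neg, Finset.sum_neg_distrib, smul_add, smul_smul]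
  abel

lemma norm_frequency_le (ξ : 𝔼) (i : Fin n) : ‖frequency ξ i‖ ≤ 2 * Real.pi * (1 + ‖ξ‖) := by
  have h₁ : ‖ξ i‖ ≤ ‖ξ‖ := PiLp.norm_apply_le ξ i
  rw [frequency]
  simp only [norm_mul, Complex.norm_real, Complex.norm_I, Real.norm_eq_abs,
    abs_of_pos Real.pi_pos, Complex.norm_ofNat, mul_one]
  rw [Real.norm_eq_abs] at h₁
  gcongr
  linarith

lemma opBound_lowerPart : OpBound (lowerPart b d) fun ξ ↦ 2 * Real.pi * (1 + ‖ξ‖) := by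
  have h₀ : ∀ ξ : 𝔼, 0 ≤ 2 * Real.pi * (1 + ‖ξ‖) := fun ξ ↦ by positivity
  have h₁ : ∀ ξ : 𝔼, 1 ≤ 2 * Real.pi * (1 + ‖ξ‖) := fun ξ ↦ by
    nlinarith [Real.pi_gt_three, norm_nonneg ξ]
  refine (OpBound.const _ h₁).add (OpBound.sum _ (fun i _ ↦ OpBound.sum _ (fun j _ ↦ ?_) h₀) h₀) h₀
  exact ((OpBound.const _ fun _ ↦ le_rfl).smul fun ξ ↦ norm_frequency_le ξ i).add
    ((OpBound.const _ fun _ ↦ le_rfl).smul fun ξ ↦ norm_frequency_le ξ j) h₀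

lemma uniformlySmooth_one {F : Type*} [NormedAddCommGroup F] [NormedSpace ℝ F] {h : 𝔼 → F}
    (hh : ContDiff ℝ ∞ h) (hb : ∀ m, ∃ C : ℝ, ∀ x, ‖iteratedFDeriv ℝ m h x‖ ≤ C) {ι : Type*} :
    UniformlySmooth fun _ : ι ↦ h :=
  ⟨fun _ ↦ hh, fun l ↦ by
    obtain ⟨C, hC⟩ := hb l
    exact ⟨C, fun _ ↦ hC⟩⟩

/-- The symbol `1 + 4π² ∑ aⁱʲ ξᵢ ξⱼ`, normalized by `(1 + ‖ξ‖)²`. -/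
noncomputable def normalizedSymbol (a : Fin n → Fin n → EuclideanSpace ℝ (Fin n) → ℝ)
    (ξ y : EuclideanSpace ℝ (Fin n)) : ℝ :=
  ((1 + ‖ξ‖) ^ 2)⁻¹ • 1
    + ∑ i, ∑ j, (4 * Real.pi ^ 2 * (ξ i * ξ j) * ((1 + ‖ξ‖) ^ 2)⁻¹) • a i j y

variable {a : Fin n → Fin n → EuclideanSpace ℝ (Fin n) → ℝ}

lemma uniformlySmooth_normalizedSymbol (ha : ∀ i j, UniformlySmooth fun _ : 𝔼 ↦ a i j) :
    UniformlySmooth (normalizedSymbol a) := by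
  have hξ : ∀ ξ : 𝔼, ((1 + ‖ξ‖) ^ 2)⁻¹ ≤ 1 := fun ξ ↦
    inv_le_one_of_one_le₀ (one_le_pow₀ (by simp))
  refine ((UniformlySmooth.const (1 : ℝ)).smul (B := 1) fun ξ ↦ ?_).add
    (UniformlySmooth.sum _ fun i _ ↦ UniformlySmooth.sum _ fun j _ ↦
      (ha i j).smul (B := 4 * Real.pi ^ 2) fun ξ ↦ ?_)
  · rw [abs_of_nonneg (by positivity)]
    exact hξ ξ
  · have h₁ : |ξ i| ≤ 1 + ‖ξ‖ := (PiLp.norm_apply_le ξ i).trans (by linarith)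
    have h₂ : |ξ j| ≤ 1 + ‖ξ‖ := (PiLp.norm_apply_le ξ j).trans (by linarith)
    have h₃ : 0 < (1 + ‖ξ‖) ^ 2 := by positivity
    rw [abs_mul, abs_mul, abs_of_nonneg (by positivity : (0 : ℝ) ≤ 4 * Real.pi ^ 2), abs_mul,
      abs_of_pos (inv_pos.2 h₃), ← div_eq_mul_inv, div_le_iff₀ h₃]
    gcongr
    nlinarith [mul_le_mul h₁ h₂ (abs_nonneg _) (by positivity)]

lemma le_normalizedSymbol {l₀ : ℝ} (hl₀ : 0 ≤ l₀)
    (hell : ∀ x ξ : 𝔼, l₀ * ‖ξ‖ ^ 2 ≤ ∑ i, ∑ j, a i j x * ξ i * ξ j) (ξ y : 𝔼) :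
    min 1 l₀ / 2 ≤ normalizedSymbol a ξ y := by
  have h₃ : 0 < (1 + ‖ξ‖) ^ 2 := by positivity
  have h₁ : normalizedSymbol a ξ y
      = (1 + 4 * Real.pi ^ 2 * ∑ i, ∑ j, a i j y * ξ i * ξ j) / (1 + ‖ξ‖) ^ 2 := by
    simp only [normalizedSymbol, smul_eq_mul, mul_one, add_div, Finset.mul_sum, Finset.sum_div,
      one_div]
    congr 1
    refine Finset.sum_congr rfl fun i _ ↦ Finset.sum_congr rfl fun j _ ↦ ?_
    ring
  rw [h₁, le_div_iff₀ h₃]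
  have hm₁ := min_le_left 1 l₀
  have hm₂ := min_le_right 1 l₀
  have hpi : 1 ≤ 4 * Real.pi ^ 2 := by nlinarith [Real.pi_gt_three]
  calc min 1 l₀ / 2 * (1 + ‖ξ‖) ^ 2 ≤ min 1 l₀ * (1 + ‖ξ‖ ^ 2) := by
        nlinarith [mul_nonneg (le_min zero_le_one hl₀) (sq_nonneg (1 - ‖ξ‖))]
    _ ≤ 1 + l₀ * ‖ξ‖ ^ 2 := by nlinarith [sq_nonneg ‖ξ‖]
    _ ≤ 1 + ∑ i, ∑ j, a i j y * ξ i * ξ j := by linarith [hell y ξ]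
    _ ≤ _ := by
      have h₄ : 0 ≤ ∑ i, ∑ j, a i j y * ξ i * ξ j := le_trans (by positivity) (hell y ξ)
      nlinarith

lemma leadingPart_smulLeftCLM_inv {l₀ : ℝ} (hl₀ : 0 < l₀)
    (ha : ∀ i j, UniformlySmooth fun _ : 𝔼 ↦ a i j)
    (hell : ∀ x ξ : 𝔼, l₀ * ‖ξ‖ ^ 2 ≤ ∑ i, ∑ j, a i j x * ξ i * ξ j) (ξ : 𝔼) (w : 𝓢(𝔼, ℂ)) :
    leadingPart (fun i j ↦ SchwartzMap.smulLeftCLM ℂ fun y ↦ (a i j y : ℂ)) ξ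
      (SchwartzMap.smulLeftCLM ℂ (fun y ↦ (((normalizedSymbol a ξ y)⁻¹ : ℝ) : ℂ)) w)
      = ((1 + ‖ξ‖) ^ 2 : ℂ) • w := by
  have hκ : 0 < min 1 l₀ / 2 := by positivity
  have h₁ := (((uniformlySmooth_normalizedSymbol ha).inv hκ
    (le_normalizedSymbol hl₀.le hell)).ofReal).hasTemperateGrowth ξ
  have h₂ := fun i j ↦ (ha i j).ofReal.hasTemperateGrowth ξ
  ext y
  have h₃ : (normalizedSymbol a ξ y : ℂ) ≠ 0 :=
    mod_cast (hκ.trans_le (le_normalizedSymbol hl₀.le hell ξ y)).ne'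
  have h₄ : (1 + ‖ξ‖ : ℂ) ≠ 0 := by
    have : (1 + ‖ξ‖ : ℝ) ≠ 0 := by positivity
    exact mod_cast this
  have h₅ : (1 + ‖ξ‖ : ℂ) ^ 2 * normalizedSymbol a ξ y
      = 1 - ∑ i, ∑ j, frequency ξ j * frequency ξ i * a i j y := by
    simp only [normalizedSymbol, frequency]
    push_cast
    rw [mul_add, sub_eq_add_neg, Finset.mul_sum, ← Finset.sum_neg_distrib]
    congr 1
    · simp [h₄]
    refine Finset.sum_congr rfl fun i _ ↦ ?_
    rw [Finset.mul_sum, ← Finset.sum_neg_distrib]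
    refine Finset.sum_congr rfl fun j _ ↦ ?_
    simp only [smul_eq_mul]
    push_cast
    field_simp
    rw [Complex.I_sq]
    ring
  simp only [leadingPart, sub_apply, sum_apply, smul_apply, one_apply_eq_self,
    SchwartzMap.smulLeftCLM_apply_apply h₁, SchwartzMap.smulLeftCLM_apply_apply (h₂ _ _),
    smul_eq_mul]
  calc _ = (1 - ∑ i, ∑ j, frequency ξ j * frequency ξ i * a i j y)
        * ((((normalizedSymbol a ξ y)⁻¹ : ℝ) : ℂ) * w y) := by
        simp only [sub_mul, one_mul, Finset.sum_mul, mul_assoc]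
    _ = _ := by
        rw [← h₅, Complex.ofReal_inv]
        field_simp

/-- Rapid decay of `ξ ↦ f (e_ξ w)` for an eigendistribution `f` of a uniformly elliptic operator. -/
lemma exists_decay_of_elliptic {l₀ : ℝ} (hl₀ : 0 < l₀)
    (ha : ∀ i j, UniformlySmooth fun _ : 𝔼 ↦ a i j)
    (hell : ∀ x ξ : 𝔼, l₀ * ‖ξ‖ ^ 2 ≤ ∑ i, ∑ j, a i j x * ξ i * ξ j)
    (hd : ∀ ξ φ, d (modulation ξ φ) = modulation ξ (d φ)) {f : 𝓢(𝔼, ℂ) →L[ℂ] ℂ}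
    (hf : ∀ φ, f (divergenceForm
      (fun i j ↦ SchwartzMap.smulLeftCLM ℂ fun y ↦ (a i j y : ℂ)) d φ) = 0) (K : ℕ) :
    ∃ C : ℝ, 0 ≤ C ∧ ∃ N, ∀ ξ w,
      ‖f (modulation ξ w)‖ ≤ C * ((1 + ‖ξ‖) ^ K)⁻¹ * supSeminorm 𝔼 N w := by
  have hκ : 0 < min 1 l₀ / 2 := by positivity
  let Q : 𝔼 → 𝓢(𝔼, ℂ) →L[ℂ] 𝓢(𝔼, ℂ) := fun ξ ↦ (-((1 + ‖ξ‖ : ℂ) ^ 2)⁻¹) •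
    SchwartzMap.smulLeftCLM ℂ (fun y ↦ (((normalizedSymbol a ξ y)⁻¹ : ℝ) : ℂ))
  have hQ : OpBound Q fun ξ ↦ ((1 + ‖ξ‖) ^ 2)⁻¹ := by
    refine OpBound.smul (fun ξ ↦ ?_) ((uniformlySmooth_normalizedSymbol ha).inv hκ
      (le_normalizedSymbol hl₀.le hell)).ofReal.opBound
    have h₁ : (1 + ‖ξ‖ : ℂ) = ((1 + ‖ξ‖ : ℝ) : ℂ) := by push_cast; rfl
    rw [norm_neg, norm_inv, norm_pow, h₁, Complex.norm_real, Real.norm_of_nonneg (by positivity)]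
  have hT := (opBound_lowerPart (b := fun i j ↦ SchwartzMap.smulLeftCLM ℂ fun y ↦ (a i j y : ℂ))
    (d := d)).comp hQ fun ξ ↦ by positivity
  refine exists_decay_of_opBound (hT.mono (B := 2 * Real.pi) (by positivity) fun ξ ↦ ?_)
    (fun ξ w ↦ ?_) K
  · have : 1 + ‖ξ‖ ≠ 0 := by positivity
    apply le_of_eq
    field_simp
  · have h₁ := hf (modulation ξ (Q ξ w))
    rw [divergenceForm_modulation (fun i j ξ φ ↦
      smulLeftCLM_modulation ((ha i j).ofReal.hasTemperateGrowth ξ) ξ φ) hd, map_add, map_add] at h₁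
    have h₂ : (1 + ‖ξ‖ : ℂ) ^ 2 ≠ 0 := by
      have : (1 + ‖ξ‖ : ℝ) ^ 2 ≠ 0 := by positivity
      exact mod_cast this
    rw [show Q ξ w = (-((1 + ‖ξ‖ : ℂ) ^ 2)⁻¹) • SchwartzMap.smulLeftCLM ℂ
      (fun y ↦ (((normalizedSymbol a ξ y)⁻¹ : ℝ) : ℂ)) w from rfl, map_smul (leadingPart _ ξ),
      leadingPart_smulLeftCLM_inv hl₀ ha hell, smul_smul, neg_mul, inv_mul_cancel₀ h₂, neg_smul,
      one_smul, map_neg, map_neg, neg_add_eq_zero] at h₁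
    exact h₁

end Elliptic

section Exchange

variable {E : Type*} [NormedAddCommGroup E] [NormedSpace ℝ E]

/-- Bounded continuous functions with values in the space of `l`-th derivatives. -/
def DerivSpace (E : Type*) [NormedAddCommGroup E] [NormedSpace ℝ E] (l : ℕ) : Type _ :=
  E →ᵇ (E [×l]→L[ℝ] ℂ)

namespace DerivSpace

noncomputable instance (l : ℕ) : NormedAddCommGroup (DerivSpace E l) :=
  BoundedContinuousFunction.instNormedAddCommGroup

noncomputable instance (l : ℕ) : NormedSpace ℂ (DerivSpace E l) :=
  BoundedContinuousFunction.instNormedSpace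

instance (l : ℕ) : CompleteSpace (DerivSpace E l) :=
  BoundedContinuousFunction.instCompleteSpace

/-- Evaluation at a point. -/
noncomputable def eval (l : ℕ) (x : E) : DerivSpace E l →L[ℂ] (E [×l]→L[ℝ] ℂ) :=
  BoundedContinuousFunction.evalCLM ℂ x

lemma ext {l : ℕ} {u v : DerivSpace E l} (h : ∀ x, eval l x u = eval l x v) : u = v :=
  BoundedContinuousFunction.ext h

lemma norm_eval_le {l : ℕ} (u : DerivSpace E l) (x : E) : ‖eval l x u‖ ≤ ‖u‖ :=
  BoundedContinuousFunction.norm_coe_le_norm u x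

lemma norm_le {l : ℕ} {u : DerivSpace E l} {C : ℝ} (hC : 0 ≤ C) (h : ∀ x, ‖eval l x u‖ ≤ C) :
    ‖u‖ ≤ C :=
  (BoundedContinuousFunction.norm_le hC).2 h

end DerivSpace

/-- The weighted derivative `x ↦ ‖x‖ᵏ Dˡφ(x)` of a Schwartz function. -/
noncomputable def weightedDerivFun (k l : ℕ) (φ : 𝓢(E, ℂ)) : DerivSpace E l :=
  BoundedContinuousFunction.ofNormedAddCommGroup (fun x ↦ ‖x‖ ^ k • iteratedFDeriv ℝ l φ x)
    ((continuous_norm.pow k).smul ((φ.smooth ⊤).continuous_iteratedFDeriv (mod_cast le_top)))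
    (SchwartzMap.seminorm ℂ k l φ) fun x ↦ by
      rw [norm_smul, norm_pow, norm_norm]
      exact SchwartzMap.le_seminorm ℂ k l φ x

lemma eval_weightedDerivFun (k l : ℕ) (φ : 𝓢(E, ℂ)) (x : E) :
    DerivSpace.eval l x (weightedDerivFun k l φ) = ‖x‖ ^ k • iteratedFDeriv ℝ l φ x := rfl

lemma norm_weightedDerivFun (k l : ℕ) (φ : 𝓢(E, ℂ)) :
    ‖weightedDerivFun k l φ‖ = SchwartzMap.seminorm ℂ k l φ := by
  refine le_antisymm (DerivSpace.norm_le (apply_nonneg _ _) fun x ↦ ?_)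
    (SchwartzMap.seminorm_le_bound ℂ k l φ (norm_nonneg _) fun x ↦ ?_)
  · rw [eval_weightedDerivFun, norm_smul, norm_pow, norm_norm]
    exact SchwartzMap.le_seminorm ℂ k l φ x
  · have h := DerivSpace.norm_eval_le (weightedDerivFun k l φ) x
    rwa [eval_weightedDerivFun, norm_smul, norm_pow, norm_norm] at h

/-- The weighted derivative as a continuous linear map. -/
noncomputable def weightedDeriv (E : Type*) [NormedAddCommGroup E] [NormedSpace ℝ E] (k l : ℕ) :
    𝓢(E, ℂ) →L[ℂ] DerivSpace E l :=
  SchwartzMap.mkCLMtoNormedSpace (σ := RingHom.id ℂ) (weightedDerivFun k l)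
    (fun φ ψ ↦ DerivSpace.ext fun x ↦ by
      change ‖x‖ ^ k • iteratedFDeriv ℝ l (φ + ψ : E → ℂ) x
        = ‖x‖ ^ k • iteratedFDeriv ℝ l φ x + ‖x‖ ^ k • iteratedFDeriv ℝ l ψ x
      rw [iteratedFDeriv_add_apply ((φ.smooth l).contDiffAt) ((ψ.smooth l).contDiffAt), smul_add])
    (fun z φ ↦ DerivSpace.ext fun x ↦ by
      rw [map_smul, eval_weightedDerivFun, eval_weightedDerivFun, RingHom.id_apply, smul_comm,
        ← iteratedFDeriv_const_smul_apply ((φ.smooth l).contDiffAt)]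
      rfl)
    ⟨{(k, l)}, 1, zero_le_one, fun φ ↦ by
      rw [norm_weightedDerivFun, Finset.sup_singleton, one_mul]
      rfl⟩

lemma eval_weightedDeriv (k l : ℕ) (φ : 𝓢(E, ℂ)) (x : E) :
    DerivSpace.eval l x (weightedDeriv E k l φ) = ‖x‖ ^ k • iteratedFDeriv ℝ l φ x := rfl

lemma norm_weightedDeriv (k l : ℕ) (φ : 𝓢(E, ℂ)) :
    ‖weightedDeriv E k l φ‖ = SchwartzMap.seminorm ℂ k l φ :=
  norm_weightedDerivFun k l φ

variable {α : Type*} [TopologicalSpace α] [SecondCountableTopology α] [MeasurableSpace α]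
  [OpensMeasurableSpace α] {ν : Measure α} {Φ : α → 𝓢(E, ℂ)}

lemma integrable_weightedDeriv (hΦ : Continuous Φ)
    (hint : ∀ N, Integrable (fun t ↦ supSeminorm E N (Φ t)) ν) (k l : ℕ) :
    Integrable (fun t ↦ weightedDeriv E k l (Φ t)) ν :=
  (hint (k + l)).mono' ((weightedDeriv E k l).continuous.comp hΦ).aestronglyMeasurable
    (.of_forall fun _ ↦ (norm_weightedDeriv k l _).trans_le (exists_seminorm_le_supSeminorm k l _))

lemma integrable_iteratedFDeriv (hΦ : Continuous Φ)
    (hint : ∀ N, Integrable (fun t ↦ supSeminorm E N (Φ t)) ν) (l : ℕ) (y : E) :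
    Integrable (fun t ↦ iteratedFDeriv ℝ l (Φ t) y) ν := by
  have h := (DerivSpace.eval l y).integrable_comp
    (integrable_weightedDeriv hΦ hint 0 l)
  simpa [eval_weightedDeriv] using h

lemma iteratedFDeriv_integral (hΦ : Continuous Φ)
    (hint : ∀ N, Integrable (fun t ↦ supSeminorm E N (Φ t)) ν) (l : ℕ) (y : E) :
    iteratedFDeriv ℝ l (fun y ↦ ∫ t, Φ t y ∂ν) y = ∫ t, iteratedFDeriv ℝ l (Φ t) y ∂ν := by
  induction l generalizing y with
  | zero =>
    simp only [iteratedFDeriv_zero_eq_comp, Function.comp_apply]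
    exact ((continuousMultilinearCurryFin0 ℝ E
      ℂ).symm.toContinuousLinearEquiv.integral_comp_comm _).symm
  | succ l ih =>
    have hint' := integrable_iteratedFDeriv hΦ hint
    have hd : HasFDerivAt (fun y ↦ ∫ t, iteratedFDeriv ℝ l (Φ t) y ∂ν)
        (∫ t, fderiv ℝ (iteratedFDeriv ℝ l (Φ t)) y ∂ν) y := by
      refine hasFDerivAt_integral_of_dominated_of_fderiv_le
        (F' := fun y t ↦ fderiv ℝ (iteratedFDeriv ℝ l (Φ t)) y) (s := Set.univ)
        (bound := fun t ↦ supSeminorm E (l + 1) (Φ t))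
        Filter.univ_mem (.of_forall fun y ↦ (hint' l y).1) (hint' l y) ?_ (.of_forall fun t y _ ↦ ?_)
        (hint _) (.of_forall fun t y _ ↦ ?_)
      · simp only [fderiv_iteratedFDeriv, Function.comp_apply]
        exact (LinearIsometryEquiv.continuous _).comp_aestronglyMeasurable (hint' (l + 1) y).1
      · rw [norm_fderiv_iteratedFDeriv]
        exact (SchwartzMap.norm_iteratedFDeriv_le_seminorm ℂ (Φ t) (l + 1) y).trans
          (seminorm_le_supSeminorm (by lia) le_rfl _)
      · exact (((Φ t).smooth ⊤).differentiable_iteratedFDeriv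
          (mod_cast ENat.natCast_lt_top l) y).hasFDerivAt
    rw [iteratedFDeriv_succ_eq_comp_left, Function.comp_apply, funext ih, hd.fderiv]
    simp only [iteratedFDeriv_succ_eq_comp_left, Function.comp_apply]
    exact (ContinuousLinearEquiv.integral_comp_comm (𝕜 := ℝ) (μ := ν)
      (E := E →L[ℝ] E [×l]→L[ℝ] ℂ) (F := E [×(l + 1)]→L[ℝ] ℂ) (continuousMultilinearCurryLeftEquiv ℝ
        (fun _ : Fin (l + 1) ↦ E) ℂ).symm.toContinuousLinearEquiv
      fun t ↦ fderiv ℝ (iteratedFDeriv ℝ l (Φ t)) y).symm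

lemma weightedDeriv_eq_integral (hΦ : Continuous Φ)
    (hint : ∀ N, Integrable (fun t ↦ supSeminorm E N (Φ t)) ν) {ψ : 𝓢(E, ℂ)}
    (hψ : ∀ y, ψ y = ∫ t, Φ t y ∂ν) (k l : ℕ) :
    weightedDeriv E k l ψ = ∫ t, weightedDeriv E k l (Φ t) ∂ν := by
  refine DerivSpace.ext fun x ↦ ?_
  rw [← (DerivSpace.eval l x).integral_comp_comm (integrable_weightedDeriv hΦ hint k l)]
  change ‖x‖ ^ k • iteratedFDeriv ℝ l ψ x = ∫ t, ‖x‖ ^ k • iteratedFDeriv ℝ l (Φ t) x ∂ν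
  rw [integral_smul, ← iteratedFDeriv_integral hΦ hint, ← funext hψ]

/-- A functional dominated by the norm of an injective linear map factors continuously. -/
lemma exists_clm_comp_eq_of_norm_le {V X : Type*} [AddCommGroup V] [Module ℂ V]
    [NormedAddCommGroup X] [NormedSpace ℂ X] (J : V →ₗ[ℂ] X) (f : V →ₗ[ℂ] ℂ)
    (hJ : Function.Injective J) {C : ℝ} (hle : ∀ v, ‖f v‖ ≤ C * ‖J v‖) :
    ∃ F : X →L[ℂ] ℂ, ∀ v, F (J v) = f v := by
  let e := LinearEquiv.ofInjective J hJ
  obtain ⟨F, hF, -⟩ := exists_extension_norm_eq (𝕜 := ℂ) J.range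
    ((f ∘ₗ e.symm.toLinearMap).mkContinuous C fun x ↦ by
      obtain ⟨v, rfl⟩ := e.surjective x
      have he : (e v : X) = J v := rfl
      simpa [he] using hle v)
  refine ⟨F, fun v ↦ (hF (e v)).trans ?_⟩
  simp

/-- Continuous functionals on Schwartz space commute with absolutely convergent integrals. -/
lemma apply_eq_integral (f : 𝓢(E, ℂ) →L[ℂ] ℂ) (hΦ : Continuous Φ)
    (hint : ∀ N, Integrable (fun t ↦ supSeminorm E N (Φ t)) ν) {ψ : 𝓢(E, ℂ)}
    (hψ : ∀ y, ψ y = ∫ t, Φ t y ∂ν) : f ψ = ∫ t, f (Φ t) ∂ν := by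
  obtain ⟨C, hC, N, hf⟩ := exists_norm_apply_le_supSeminorm f
  let J : 𝓢(E, ℂ) →L[ℂ] (∀ i : Fin (N + 1) × Fin (N + 1), DerivSpace E i.2) :=
    ContinuousLinearMap.pi fun i ↦ weightedDeriv E i.1 i.2
  have hJ : ∀ φ i, J φ i = weightedDeriv E i.1 i.2 φ := fun _ _ ↦ rfl
  have hle : ∀ φ, ‖f φ‖ ≤ C * ‖J φ‖ := fun φ ↦ by
    refine (hf φ).trans (mul_le_mul_of_nonneg_left (supSeminorm_le (norm_nonneg _)
      fun k hk l hl ↦ ?_) hC)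
    exact (norm_weightedDeriv k l φ).symm.trans_le
      (norm_le_pi_norm (J φ) (⟨k, by lia⟩, ⟨l, by lia⟩))
  have hinj : Function.Injective J := (injective_iff_map_eq_zero J).2 fun φ h ↦ by
    have h₁ : ‖weightedDeriv E 0 0 φ‖ = 0 := by
      rw [show weightedDeriv E 0 0 φ = 0 from congr_fun h (0, 0), norm_zero]
    ext x
    have h₂ := SchwartzMap.norm_le_seminorm ℂ φ x
    rw [← norm_weightedDeriv, h₁] at h₂
    simpa using h₂
  obtain ⟨F, hFJ⟩ := exists_clm_comp_eq_of_norm_le J.toLinearMap f.toLinearMap hinj hle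
  change ∀ φ, F (J φ) = f φ at hFJ
  have hintJ : Integrable (fun t ↦ J (Φ t)) ν :=
    Integrable.of_eval fun i ↦ integrable_weightedDeriv hΦ hint i.1 i.2
  have hJψ : J ψ = ∫ t, J (Φ t) ∂ν := by
    ext1 i
    rw [hJ, weightedDeriv_eq_integral hΦ hint hψ, eval_integral fun i ↦
      integrable_weightedDeriv hΦ hint i.1 i.2]
    rfl
  rw [← hFJ, hJψ, ← F.integral_comp_comm hintJ]
  simp only [hFJ]

end Exchange

section Representation

variable {E : Type*} [NormedAddCommGroup E] [InnerProductSpace ℝ E]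

/-- The windowed Fourier transform `ξ ↦ f (exp (2πi ⟪ξ, ·⟫) w)` of `f` decays faster than any
power of `ξ`, with constants controlled by a Schwartz seminorm of the window `w`. -/
def RapidDecay (f : 𝓢(E, ℂ) →L[ℂ] ℂ) : Prop :=
  ∀ K : ℕ, ∃ C : ℝ, 0 ≤ C ∧ ∃ N, ∀ ξ w,
    ‖f (modulation ξ w)‖ ≤ C * ((1 + ‖ξ‖) ^ K)⁻¹ * supSeminorm E N w

lemma continuous_apply_modulation (f : 𝓢(E, ℂ) →L[ℂ] ℂ) (w : 𝓢(E, ℂ)) :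
    Continuous fun ξ ↦ f (modulation ξ w) :=
  f.continuous.comp (continuous_modulation w)

variable [FiniteDimensional ℝ E] [MeasurableSpace E] [BorelSpace E] {f : 𝓢(E, ℂ) →L[ℂ] ℂ}

lemma integrable_one_add_norm_pow_inv :
    Integrable fun ξ : E ↦ ((1 + ‖ξ‖) ^ (Module.finrank ℝ E + 1))⁻¹ := by
  have h := integrable_one_add_norm (E := E) (μ := volume)
    (r := ((Module.finrank ℝ E + 1 : ℕ) : ℝ)) (by push_cast; linarith)
  refine h.congr (.of_forall fun ξ ↦ ?_)
  simp only
  rw [Real.rpow_neg (by positivity), Real.rpow_natCast]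

lemma RapidDecay.exists_integral_le (hf : RapidDecay f) (k : ℕ) :
    ∃ C : ℝ, 0 ≤ C ∧ ∃ N, ∀ w, Integrable (fun ξ ↦ ‖ξ‖ ^ k * ‖f (modulation ξ w)‖) ∧
      ∫ ξ, ‖ξ‖ ^ k * ‖f (modulation ξ w)‖ ≤ C * supSeminorm E N w := by
  obtain ⟨C, hC, N, h⟩ := hf (k + (Module.finrank ℝ E + 1))
  set I : E → ℝ := fun ξ ↦ ((1 + ‖ξ‖) ^ (Module.finrank ℝ E + 1))⁻¹
  have hI : Integrable I := integrable_one_add_norm_pow_inv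
  refine ⟨C * ∫ ξ, I ξ, mul_nonneg hC (integral_nonneg fun ξ ↦ by positivity), N, fun w ↦ ?_⟩
  have hle : ∀ ξ, ‖ξ‖ ^ k * ‖f (modulation ξ w)‖ ≤ C * supSeminorm E N w * I ξ := fun ξ ↦ by
    have hP : 0 ≤ supSeminorm E N w := apply_nonneg _ _
    have hpos : (0 : ℝ) < 1 + ‖ξ‖ := by positivity
    calc _ ≤ (1 + ‖ξ‖) ^ k * (C * ((1 + ‖ξ‖) ^ (k + (Module.finrank ℝ E + 1)))⁻¹
          * supSeminorm E N w) := by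
          gcongr
          · linarith
          · exact h ξ w
      _ = _ := by
        simp only [I, pow_add (1 + ‖ξ‖) k]
        field_simp
  have hint : Integrable (fun ξ ↦ ‖ξ‖ ^ k * ‖f (modulation ξ w)‖) :=
    (hI.const_mul _).mono'
      ((continuous_norm.pow k).mul (continuous_apply_modulation f w).norm).aestronglyMeasurable
      (.of_forall fun ξ ↦ by
        rw [Real.norm_of_nonneg (by positivity)]
        exact hle ξ)
  refine ⟨hint, (integral_mono hint (hI.const_mul _) hle).trans_eq ?_⟩
  rw [integral_const_mul]
  ring

lemma RapidDecay.integrable (hf : RapidDecay f) (w : 𝓢(E, ℂ)) (k : ℕ) :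
    Integrable fun ξ ↦ ‖ξ‖ ^ k * ‖f (modulation ξ w)‖ := by
  obtain ⟨_, _, _, h⟩ := hf.exists_integral_le k
  exact (h w).1

lemma RapidDecay.integrable_apply_modulation (hf : RapidDecay f) (w : 𝓢(E, ℂ)) :
    Integrable fun ξ ↦ f (modulation ξ w) := by
  refine (integrable_norm_iff (continuous_apply_modulation f w).aestronglyMeasurable).1 ?_
  simpa using hf.integrable w 0

/-- The function representing the distribution `w f`. -/
noncomputable def windowed (f : 𝓢(E, ℂ) →L[ℂ] ℂ) (w : 𝓢(E, ℂ)) : E → ℂ :=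
  𝓕 fun ξ ↦ f (modulation ξ w)

lemma RapidDecay.contDiff_windowed (hf : RapidDecay f) (w : 𝓢(E, ℂ)) :
    ContDiff ℝ ∞ (windowed f w) :=
  Real.contDiff_fourier (N := ⊤) fun k _ ↦ hf.integrable w k

lemma RapidDecay.exists_iteratedFDeriv_windowed_le (hf : RapidDecay f) (l : ℕ) :
    ∃ C : ℝ, 0 ≤ C ∧ ∃ N, ∀ w x,
      ‖iteratedFDeriv ℝ l (windowed f w) x‖ ≤ C * supSeminorm E N w := by
  obtain ⟨C, hC, N, h⟩ := hf.exists_integral_le l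
  refine ⟨(2 * Real.pi) ^ l * C, by positivity, N, fun w x ↦ ?_⟩
  rw [windowed, Real.iteratedFDeriv_fourier (N := ⊤) (fun k _ ↦ hf.integrable w k)
    (continuous_apply_modulation f w).aestronglyMeasurable le_top]
  refine (VectorFourier.norm_fourierIntegral_le_integral_norm _ _ _ _ _).trans ?_
  calc _ ≤ ∫ ξ, (2 * Real.pi) ^ l * (‖ξ‖ ^ l * ‖f (modulation ξ w)‖) := by
        refine integral_mono_of_nonneg (.of_forall fun _ ↦ norm_nonneg _)
          ((hf.integrable w l).const_mul _) (.of_forall fun ξ ↦ ?_)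
        refine (VectorFourier.norm_fourierPowSMulRight_le _ _ _ _).trans ?_
        rw [mul_assoc]
        refine mul_le_mul_of_nonneg_right (pow_le_pow_left₀ (by positivity) ?_ l) (by positivity)
        exact mul_le_of_le_one_right (by positivity) (norm_innerSL_le ℝ)
    _ ≤ _ := by
      rw [integral_const_mul, mul_assoc]
      gcongr
      exact (h w).2

lemma continuous_fourier_smul_modulation (φ w : 𝓢(E, ℂ)) :
    Continuous fun ξ ↦ 𝓕 φ ξ • modulation ξ w :=
  (𝓕 φ).continuous.smul (continuous_modulation w)

lemma integrable_supSeminorm_fourier_smul_modulation (φ w : 𝓢(E, ℂ)) (N : ℕ) :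
    Integrable fun ξ ↦ supSeminorm E N (𝓕 φ ξ • modulation ξ w) := by
  have hmaj : Integrable fun ξ ↦ 2 ^ N * 2 * ((2 * Real.pi) ^ N * 2 ^ (N - 1))
      * supSeminorm E (N + N + 1) w * (‖ξ‖ ^ 0 * ‖𝓕 φ ξ‖ + ‖ξ‖ ^ N * ‖𝓕 φ ξ‖) :=
    (((𝓕 φ).integrable_pow_mul volume 0).add ((𝓕 φ).integrable_pow_mul volume N)).const_mul _
  refine hmaj.mono' ((continuous_supSeminorm N).comp
    (continuous_fourier_smul_modulation φ w)).aestronglyMeasurable (.of_forall fun ξ ↦ ?_)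
  have hP : 0 ≤ supSeminorm E (N + N + 1) w := apply_nonneg _ _
  rw [Real.norm_of_nonneg (apply_nonneg _ _), map_smul_eq_mul]
  calc _ ≤ ‖𝓕 φ ξ‖ * (2 ^ N * 2 * ((2 * Real.pi) ^ N * (2 ^ (N - 1) * (1 ^ N + ‖ξ‖ ^ N)))
        * supSeminorm E (N + N + 1) w) := by
        gcongr
        refine (supSeminorm_modulation_le N ξ w).trans ?_
        gcongr
        exact add_pow_le zero_le_one (norm_nonneg _) N
    _ = _ := by ring

/-- The distribution `w f` is represented by the function `windowed f w`. -/
lemma RapidDecay.apply_eq_integral_windowed (hf : RapidDecay f) {w φ ψ : 𝓢(E, ℂ)}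
    (hψ : ∀ y, ψ y = w y * φ y) : f ψ = ∫ x, windowed f w x * φ x := by
  have hinv : ∀ y, ψ y = ∫ ξ, (𝓕 φ ξ • modulation ξ w) y := fun y ↦ by
    have h : φ y = ∫ ξ, Real.fourierChar ⟪ξ, y⟫ • 𝓕 φ ξ := by
      conv_lhs => rw [← FourierTransform.fourierInv_fourier_eq (F := 𝓢(E, ℂ)) φ]
      rw [SchwartzMap.fourierInv_coe, Real.fourierInv_eq]
    rw [hψ, h, ← integral_const_mul]
    refine integral_congr_ae (.of_forall fun ξ ↦ ?_)
    simp only [smul_apply, modulation_apply, planeWave, innerSL_apply_apply,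
      Circle.smul_def, smul_eq_mul]
    ring
  rw [apply_eq_integral f (continuous_fourier_smul_modulation φ w)
    (integrable_supSeminorm_fourier_smul_modulation φ w) hinv]
  simp only [map_smul]
  have h := VectorFourier.integral_fourierIntegral_smul_eq_flip (L := innerₗ E) (μ := volume)
    (ν := volume) Real.continuous_fourierChar continuous_inner φ.integrable
    (hf.integrable_apply_modulation w)
  rw [flip_innerₗ] at h
  refine h.trans (integral_congr_ae (.of_forall fun x ↦ ?_))
  exact mul_comm _ _

end Representation

section Cutoff

variable {E : Type*} [NormedAddCommGroup E] [InnerProductSpace ℝ E]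

lemma supSeminorm_compSubConstCLM_le (N : ℕ) (z : E) (φ : 𝓢(E, ℂ)) :
    supSeminorm E N (φ.compSubConstCLM ℂ z) ≤ 2 ^ N * 2 * (1 + ‖z‖) ^ N * supSeminorm E N φ := by
  have hP : 0 ≤ supSeminorm E N φ := apply_nonneg _ _
  have hz : 1 ≤ 1 + ‖z‖ := by simp
  refine supSeminorm_le (by positivity) fun k hk l hl ↦
    SchwartzMap.seminorm_le_bound ℂ k l _ (by positivity) fun x ↦ ?_
  have hD : iteratedFDeriv ℝ l (φ.compSubConstCLM ℂ z) x = iteratedFDeriv ℝ l φ (x - z) :=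
    iteratedFDeriv_comp_sub l z x
  rw [hD]
  have h₀ : ‖iteratedFDeriv ℝ l φ (x - z)‖ ≤ supSeminorm E N φ :=
    (SchwartzMap.norm_iteratedFDeriv_le_seminorm ℂ φ l _).trans
      (seminorm_le_supSeminorm (by lia) hl _)
  have h₁ : ‖x - z‖ ^ k * ‖iteratedFDeriv ℝ l φ (x - z)‖ ≤ supSeminorm E N φ :=
    (SchwartzMap.le_seminorm ℂ k l φ _).trans (seminorm_le_supSeminorm hk hl _)
  have hx : ‖x‖ ≤ ‖x - z‖ + ‖z‖ := by simpa using norm_add_le (x - z) z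
  have hpow : 2 ^ (k - 1) ≤ (2 : ℝ) ^ N := pow_le_pow_right₀ one_le_two (by lia)
  calc _ ≤ 2 ^ (k - 1) * (‖x - z‖ ^ k + ‖z‖ ^ k) * ‖iteratedFDeriv ℝ l φ (x - z)‖ := by
        gcongr
        exact (pow_le_pow_left₀ (norm_nonneg _) hx k).trans
          (add_pow_le (norm_nonneg _) (norm_nonneg _) k)
    _ = 2 ^ (k - 1) * (‖x - z‖ ^ k * ‖iteratedFDeriv ℝ l φ (x - z)‖
        + ‖z‖ ^ k * ‖iteratedFDeriv ℝ l φ (x - z)‖) := by ring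
    _ ≤ 2 ^ N * ((1 + ‖z‖) ^ N * supSeminorm E N φ + (1 + ‖z‖) ^ N * supSeminorm E N φ) := by
        refine mul_le_mul hpow (add_le_add (h₁.trans (le_mul_of_one_le_left hP (one_le_pow₀ hz)))
          (mul_le_mul ?_ h₀ (norm_nonneg _) (by positivity))) (by positivity) (by positivity)
        exact (pow_le_pow_left₀ (norm_nonneg _) (by linarith) k).trans (pow_le_pow_right₀ hz hk)
    _ = _ := by ring

variable [FiniteDimensional ℝ E]

/-- A Schwartz function equal to `1` on the unit ball. -/
noncomputable def cutoff (E : Type*) [NormedAddCommGroup E] [InnerProductSpace ℝ E]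
    [FiniteDimensional ℝ E] : 𝓢(E, ℂ) :=
  ((default : ContDiffBump (0 : E)).hasCompactSupport.comp_left
    Complex.ofReal_zero).toSchwartzMap
    (Complex.ofRealCLM.contDiff.comp (default : ContDiffBump (0 : E)).contDiff)

lemma cutoff_eq_one {x : E} (hx : ‖x‖ ≤ 1) : cutoff E x = 1 := by
  have h := (default : ContDiffBump (0 : E)).one_of_mem_closedBall (x := x)
    (mem_closedBall_zero_iff.2 hx)
  change (((default : ContDiffBump (0 : E)) x : ℝ) : ℂ) = 1
  rw [h, Complex.ofReal_one]

/-- A Schwartz function equal to `1` on the ball of radius `1` around `z`. -/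
noncomputable def cutoffAt (z : E) : 𝓢(E, ℂ) := (cutoff E).compSubConstCLM ℂ z

lemma cutoffAt_eq_one {z x : E} (h : ‖x - z‖ ≤ 1) : cutoffAt z x = 1 := cutoff_eq_one h

/-- Cutting off a Schwartz function at larger and larger scales converges in Schwartz space. -/
lemma tendsto_of_eq_cutoff_mul {φ : 𝓢(E, ℂ)} {ε : ℕ → ℝ} (hε : Filter.Tendsto ε .atTop (nhds 0))
    {ψ : ℕ → 𝓢(E, ℂ)} (hψ : ∀ m y, ψ m y = cutoff E (ε m • y) * φ y) :
    Filter.Tendsto ψ .atTop (nhds φ) := by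
  rw [(schwartz_withSeminorms ℂ E ℂ).tendsto_nhds]
  rintro ⟨k, l⟩ δ hδ
  have hnorm : ∀ m, ‖ε m • ContinuousLinearMap.id ℝ E‖ ≤ |ε m| := fun m ↦ by
    rw [norm_smul, Real.norm_eq_abs]
    exact mul_le_of_le_one_right (abs_nonneg _) ContinuousLinearMap.norm_id_le
  set B := supSeminorm E (l + 1) (cutoff E)
  have hB : 0 ≤ B := apply_nonneg _ _
  have hP : 0 ≤ supSeminorm E (k + l + 1) φ := apply_nonneg _ _
  have hlim : Filter.Tendsto (fun m ↦ 2 ^ l * 2 * (B * |ε m|) * supSeminorm E (k + l + 1) φ)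
      .atTop (nhds 0) := by
    simpa using ((hε.abs.const_mul B).const_mul (2 ^ l * 2)).mul_const
      (supSeminorm E (k + l + 1) φ)
  have habs : Filter.Tendsto (fun m ↦ |ε m|) .atTop (nhds 0) := by simpa using hε.abs
  filter_upwards [hlim.eventually_lt_const hδ, habs.eventually_le_const one_pos] with m h₁ h₂
  refine lt_of_le_of_lt ?_ h₁
  have h₃ := seminorm_comp_clm_sub_mul_le (k := k) (l := l) (B := B)
    (L := ε m • ContinuousLinearMap.id ℝ E) (φ := φ) (ψ := ψ m - φ) ((cutoff E).smooth ⊤)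
    (fun j hj y ↦ (SchwartzMap.norm_iteratedFDeriv_le_seminorm ℂ _ j y).trans
      (seminorm_le_supSeminorm (by lia) hj _))
    ((hnorm m).trans h₂)
    (fun y ↦ by
      rw [sub_apply, hψ, cutoff_eq_one (x := (0 : E)) (by simp), sub_mul, one_mul]
      rfl)
  refine h₃.trans ?_
  gcongr
  exact hnorm m

end Cutoff

section Representation

variable {E : Type*} [NormedAddCommGroup E] [InnerProductSpace ℝ E] [FiniteDimensional ℝ E]
  [MeasurableSpace E] [BorelSpace E] {f : 𝓢(E, ℂ) →L[ℂ] ℂ}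

lemma RapidDecay.windowed_mul_comm (hf : RapidDecay f) (w w' : 𝓢(E, ℂ)) (x : E) :
    windowed f w x * w' x = windowed f w' x * w x := by
  have hcont : ∀ w w' : 𝓢(E, ℂ), Continuous fun x ↦ windowed f w x * w' x := fun w w' ↦
    (hf.contDiff_windowed w).continuous.mul w'.continuous
  refine congr_fun (((hcont w w').ae_eq_iff_eq volume (hcont w' w)).1
    (ae_eq_of_integral_contDiff_smul_eq (hcont w w').locallyIntegrable
      (hcont w' w).locallyIntegrable fun g hg hg' ↦ ?_)) x
  let φ : 𝓢(E, ℂ) := (hg'.comp_left Complex.ofReal_zero).toSchwartzMap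
    (Complex.ofRealCLM.contDiff.comp hg)
  have hφ : ∀ y, φ y = g y := fun _ ↦ rfl
  have happ : ∀ (v φ : 𝓢(E, ℂ)) y, SchwartzMap.smulLeftCLM ℂ v φ y = v y * φ y := fun v φ y ↦ by
    rw [SchwartzMap.smulLeftCLM_apply_apply v.hasTemperateGrowth, smul_eq_mul]
  have h₁ := hf.apply_eq_integral_windowed (happ w (SchwartzMap.smulLeftCLM ℂ w' φ))
  have h₂ := hf.apply_eq_integral_windowed (w := w') (φ := SchwartzMap.smulLeftCLM ℂ w φ)
    (ψ := SchwartzMap.smulLeftCLM ℂ w (SchwartzMap.smulLeftCLM ℂ w' φ)) fun y ↦ by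
      simp only [happ]
      ring
  simp only [happ, hφ] at h₁ h₂
  calc _ = ∫ y, windowed f w y * (w' y * g y) :=
        integral_congr_ae (.of_forall fun y ↦ by simp only [Complex.real_smul]; ring)
    _ = ∫ y, windowed f w' y * (w y * g y) := h₁.symm.trans h₂
    _ = _ := integral_congr_ae (.of_forall fun y ↦ by simp only [Complex.real_smul]; ring)

/-- The function representing a distribution satisfying `RapidDecay`. -/
noncomputable def density (f : 𝓢(E, ℂ) →L[ℂ] ℂ) (x : E) : ℂ := windowed f (cutoffAt x) x

lemma RapidDecay.density_mul (hf : RapidDecay f) (w : 𝓢(E, ℂ)) (x : E) :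
    density f x * w x = windowed f w x := by
  rw [density, hf.windowed_mul_comm, cutoffAt_eq_one (by simp), mul_one]

lemma RapidDecay.density_eventuallyEq (hf : RapidDecay f) (z : E) :
    density f =ᶠ[nhds z] windowed f (cutoffAt z) := by
  filter_upwards [Metric.ball_mem_nhds z one_pos] with x hx
  rw [← hf.density_mul, cutoffAt_eq_one (mem_ball_iff_norm.1 hx).le, mul_one]

lemma RapidDecay.contDiff_density (hf : RapidDecay f) : ContDiff ℝ ∞ (density f) :=
  contDiff_iff_contDiffAt.2 fun z ↦
    (hf.contDiff_windowed _).contDiffAt.congr_of_eventuallyEq (hf.density_eventuallyEq z)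

lemma RapidDecay.exists_iteratedFDeriv_density_le (hf : RapidDecay f) (l : ℕ) :
    ∃ C : ℝ, 0 ≤ C ∧ ∃ N : ℕ, ∀ x, ‖iteratedFDeriv ℝ l (density f) x‖ ≤ C * (1 + ‖x‖) ^ N := by
  obtain ⟨C, hC, N, h⟩ := hf.exists_iteratedFDeriv_windowed_le l
  have hP : 0 ≤ supSeminorm E N (cutoff E) := apply_nonneg _ _
  refine ⟨C * (2 ^ N * 2 * supSeminorm E N (cutoff E)), by positivity, N, fun x ↦ ?_⟩
  rw [((hf.density_eventuallyEq x).iteratedFDeriv ℝ l).eq_of_nhds]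
  calc _ ≤ C * (2 ^ N * 2 * (1 + ‖x‖) ^ N * supSeminorm E N (cutoff E)) :=
        (h _ x).trans (mul_le_mul_of_nonneg_left (supSeminorm_compSubConstCLM_le N x _) hC)
    _ = _ := by ring

lemma integrable_mul_of_le_pow {g : E → ℂ} (hg : Continuous g) {C : ℝ} {N : ℕ}
    (hle : ∀ x, ‖g x‖ ≤ C * (1 + ‖x‖) ^ N) (φ : 𝓢(E, ℂ)) : Integrable fun x ↦ g x * φ x := by
  have hC : 0 ≤ C := by simpa using (norm_nonneg _).trans (hle 0)
  have hmaj : Integrable fun x ↦ C * 2 ^ (N - 1) * (‖x‖ ^ 0 * ‖φ x‖ + ‖x‖ ^ N * ‖φ x‖) :=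
    ((φ.integrable_pow_mul volume 0).add (φ.integrable_pow_mul volume N)).const_mul _
  refine hmaj.mono' (hg.mul φ.continuous).aestronglyMeasurable (.of_forall fun x ↦ ?_)
  rw [norm_mul]
  calc _ ≤ C * (2 ^ (N - 1) * (1 ^ N + ‖x‖ ^ N)) * ‖φ x‖ := by
        gcongr
        refine (hle x).trans ?_
        gcongr
        exact add_pow_le zero_le_one (norm_nonneg _) N
    _ = _ := by ring

/-- A distribution satisfying `RapidDecay` is represented by the smooth function `density f`. -/
lemma RapidDecay.apply_eq_integral_density (hf : RapidDecay f) (φ : 𝓢(E, ℂ)) :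
    f φ = ∫ x, density f x * φ x := by
  obtain ⟨C, -, N, hle⟩ := hf.exists_iteratedFDeriv_density_le 0
  simp only [norm_iteratedFDeriv_zero] at hle
  have hint := integrable_mul_of_le_pow hf.contDiff_density.continuous hle φ
  have hε₀ : ∀ m : ℕ, (1 / ((m : ℝ) + 1)) ≠ 0 := fun m ↦ by positivity
  let w : ℕ → 𝓢(E, ℂ) := fun m ↦ SchwartzMap.compCLMOfContinuousLinearEquiv ℂ
    (ContinuousLinearEquiv.smulLeft (Units.mk0 _ (hε₀ m))) (cutoff E)
  have hw : ∀ m y, w m y = cutoff E ((1 / ((m : ℝ) + 1)) • y) := fun _ _ ↦ rfl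
  let ψ : ℕ → 𝓢(E, ℂ) := fun m ↦ SchwartzMap.smulLeftCLM ℂ (w m) φ
  have hψ : ∀ m y, ψ m y = w m y * φ y := fun m y ↦ by
    rw [SchwartzMap.smulLeftCLM_apply_apply (w m).hasTemperateGrowth, smul_eq_mul]
  have hε := tendsto_one_div_add_atTop_nhds_zero_nat (𝕜 := ℝ)
  refine tendsto_nhds_unique ((f.continuous.tendsto φ).comp (tendsto_of_eq_cutoff_mul hε hψ)) ?_
  have hrep : ∀ m, f (ψ m) = ∫ x, density f x * φ x * w m x := fun m ↦ by
    rw [hf.apply_eq_integral_windowed (hψ m)]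
    refine integral_congr_ae (.of_forall fun x ↦ ?_)
    simp only [← hf.density_mul]
    ring
  simp only [Function.comp_def, hrep]
  refine tendsto_integral_of_dominated_convergence
    (fun x ↦ SchwartzMap.seminorm ℂ 0 0 (cutoff E) * ‖density f x * φ x‖)
    (fun m ↦ (hint.1.mul (w m).continuous.aestronglyMeasurable)) (hint.norm.const_mul _)
    (fun m ↦ .of_forall fun x ↦ ?_) (.of_forall fun x ↦ ?_)
  · rw [norm_mul, mul_comm, hw]
    gcongr
    exact SchwartzMap.norm_le_seminorm ℂ _ _
  · have h : Filter.Tendsto (fun m ↦ w m x) .atTop (nhds 1) := by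
      have h₀ := ((cutoff E).continuous.tendsto ((0 : ℝ) • x)).comp (hε.smul_const x)
      rwa [cutoff_eq_one (by simp)] at h₀
    simpa using h.const_mul (density f x * φ x)

end Representation

section Eigendistribution

variable {n : ℕ}

lemma rapidDecay_of_eigendistribution {a : Fin n → Fin n → EuclideanSpace ℝ (Fin n) → ℝ}
    (ha_smooth : ∀ i j, ContDiff ℝ ∞ (a i j))
    (ha_bdd : ∀ i j m, ∃ C : ℝ, ∀ x, ‖iteratedFDeriv ℝ m (a i j) x‖ ≤ C)
    {l₀ : ℝ} (hl₀ : 0 < l₀)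
    (hell : ∀ x ξ : EuclideanSpace ℝ (Fin n), l₀ * ‖ξ‖ ^ 2 ≤ ∑ i, ∑ j, a i j x * ξ i * ξ j)
    {c : EuclideanSpace ℝ (Fin n) → ℝ} (hc_smooth : ContDiff ℝ ∞ c)
    (hc_bdd : ∀ m, ∃ C : ℝ, ∀ x, ‖iteratedFDeriv ℝ m c x‖ ≤ C) {μ : ℝ}
    {f : 𝓢(EuclideanSpace ℝ (Fin n), ℂ) →L[ℂ] ℂ}
    (heigen : ∀ φ ψ : 𝓢(EuclideanSpace ℝ (Fin n), ℂ),
      (∀ x, ψ x =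
        -(∑ i, ∑ j, fderiv ℝ
            (fun y => (a i j y : ℂ) * fderiv ℝ (⇑φ) y (EuclideanSpace.single j 1)) x
            (EuclideanSpace.single i 1)) + (c x : ℂ) * φ x) →
      f ψ = (μ : ℂ) * f φ) : RapidDecay f := by
  have ha : ∀ i j, UniformlySmooth fun _ : EuclideanSpace ℝ (Fin n) ↦ a i j := fun i j ↦
    uniformlySmooth_one (ha_smooth i j) (ha_bdd i j)
  have ha' : ∀ i j, (fun y ↦ (a i j y : ℂ)).HasTemperateGrowth := fun i j ↦
    (ha i j).ofReal.hasTemperateGrowth 0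
  have hc : (fun y ↦ (c y : ℂ)).HasTemperateGrowth :=
    (uniformlySmooth_one (ι := EuclideanSpace ℝ (Fin n)) hc_smooth
      hc_bdd).ofReal.hasTemperateGrowth 0
  let b := fun i j ↦ SchwartzMap.smulLeftCLM ℂ fun y ↦ (a i j y : ℂ)
  let d₀ := SchwartzMap.smulLeftCLM ℂ fun y ↦ (c y : ℂ)
  have hdf : ∀ φ, divergenceForm b (d₀ - (μ : ℂ) • ContinuousLinearMap.id ℂ _) φ
      = divergenceForm b d₀ φ - (μ : ℂ) • φ := fun φ ↦ by
    simp only [divergenceForm, sub_apply, smul_apply,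
      ContinuousLinearMap.id_apply]
    abel
  have hA : ∀ φ x, divergenceForm b d₀ φ x =
        -(∑ i, ∑ j, fderiv ℝ
            (fun y => (a i j y : ℂ) * fderiv ℝ (⇑φ) y (EuclideanSpace.single j 1)) x
            (EuclideanSpace.single i 1)) + (c x : ℂ) * φ x := fun φ x ↦ by
    have hb : ∀ i j, (b i j (partialDeriv j φ) : EuclideanSpace ℝ (Fin n) → ℂ)
        = fun y ↦ (a i j y : ℂ) * fderiv ℝ φ y (EuclideanSpace.single j 1) := fun i j ↦ by
      ext y
      rw [SchwartzMap.smulLeftCLM_apply_apply (ha' i j), partialDeriv_apply, smul_eq_mul]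
    simp only [divergenceForm, sub_apply, sum_apply,
      ContinuousLinearMap.comp_apply, partialDeriv_apply, hb]
    rw [SchwartzMap.smulLeftCLM_apply_apply hc, smul_eq_mul]
    ring
  refine exists_decay_of_elliptic hl₀ ha hell
    (d := d₀ - (μ : ℂ) • ContinuousLinearMap.id ℂ _) (fun ξ φ ↦ ?_) fun φ ↦ ?_
  · simp only [sub_apply, smul_apply, ContinuousLinearMap.id_apply,
      map_sub, map_smul, d₀, smulLeftCLM_modulation hc]
  · rw [hdf, map_sub, map_smul, heigen φ _ (hA φ), smul_eq_mul, sub_self]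

end Eigendistribution

end EllipticRegularity

/-- Let `A φ = −∑ᵢⱼ ∂ᵢ(aⁱʲ ∂ⱼ φ) + c φ` be a uniformly elliptic operator on
`ℝⁿ` with smooth symmetric coefficients all of whose derivatives are bounded, and let `f` be
a tempered distribution with `⟨f, A φ⟩ = μ ⟨f, φ⟩` for all Schwartz functions `φ`. Then `f`
is represented by a smooth function `g`, and for every `m` there are `C_m > 0`, `N` with
`∑_{|α| ≤ m} |D^α g(x)| ≤ C_m (1 + |x|)^N` for all `x`. -/
theorem eigendistributions_are_smooth
    (n : ℕ) (hn : 1 ≤ n)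
    (a : Fin n → Fin n → EuclideanSpace ℝ (Fin n) → ℝ)
    (ha_smooth : ∀ i j, ContDiff ℝ (⊤ : ℕ∞) (a i j))
    (ha_symm : ∀ i j x, a i j x = a j i x)
    (ha_bdd : ∀ i j m, ∃ C : ℝ, ∀ x, ‖iteratedFDeriv ℝ m (a i j) x‖ ≤ C)
    (l₀ l₁ : ℝ) (hl₀ : 0 < l₀) (hl₀₁ : l₀ ≤ l₁)
    (hell : ∀ x ξ : EuclideanSpace ℝ (Fin n),
      l₀ * ‖ξ‖ ^ 2 ≤ ∑ i, ∑ j, a i j x * ξ i * ξ j ∧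
      ∑ i, ∑ j, a i j x * ξ i * ξ j ≤ l₁ * ‖ξ‖ ^ 2)
    (c : EuclideanSpace ℝ (Fin n) → ℝ)
    (hc_smooth : ContDiff ℝ (⊤ : ℕ∞) c)
    (hc_bdd : ∀ m, ∃ C : ℝ, ∀ x, ‖iteratedFDeriv ℝ m c x‖ ≤ C)
    (μ : ℝ)
    (f : SchwartzMap (EuclideanSpace ℝ (Fin n)) ℂ →L[ℂ] ℂ)
    (heigen : ∀ φ ψ : SchwartzMap (EuclideanSpace ℝ (Fin n)) ℂ,
      (∀ x, ψ x =
        -(∑ i, ∑ j, fderiv ℝ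
            (fun y => (a i j y : ℂ) * fderiv ℝ (⇑φ) y (EuclideanSpace.single j 1)) x
            (EuclideanSpace.single i 1)) + (c x : ℂ) * φ x) →
      f ψ = (μ : ℂ) * f φ) :
    ∃ g : EuclideanSpace ℝ (Fin n) → ℂ, ContDiff ℝ (⊤ : ℕ∞) g ∧
      (∀ φ : SchwartzMap (EuclideanSpace ℝ (Fin n)) ℂ, f φ = ∫ x, g x * φ x) ∧
      (∀ m : ℕ, ∃ C : ℝ, 0 < C ∧ ∃ N : ℕ, ∀ x,
        ∑ i ∈ Finset.range (m + 1), ‖iteratedFDeriv ℝ i g x‖ ≤ C * (1 + ‖x‖) ^ N) := by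
  have hf := EllipticRegularity.rapidDecay_of_eigendistribution ha_smooth ha_bdd hl₀
    (fun x ξ ↦ (hell x ξ).1) hc_smooth hc_bdd heigen
  refine ⟨EllipticRegularity.density f, hf.contDiff_density, hf.apply_eq_integral_density,
    fun m ↦ ?_⟩
  choose C hC N h using hf.exists_iteratedFDeriv_density_le
  refine ⟨∑ i ∈ Finset.range (m + 1), C i + 1,
    add_pos_of_nonneg_of_pos (Finset.sum_nonneg fun i _ ↦ hC i) one_pos,
    ∑ i ∈ Finset.range (m + 1), N i, fun x ↦ ?_⟩
  have hx : 1 ≤ 1 + ‖x‖ := by simp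
  calc _ ≤ ∑ i ∈ Finset.range (m + 1), C i * (1 + ‖x‖) ^ ∑ i ∈ Finset.range (m + 1), N i := by
        refine Finset.sum_le_sum fun i hi ↦ (h i x).trans
          (mul_le_mul_of_nonneg_left (pow_le_pow_right₀ hx ?_) (hC i))
        exact Finset.single_le_sum (f := N) (fun _ _ ↦ Nat.zero_le _) hi
    _ ≤ _ := by
      rw [← Finset.sum_mul]
      gcongr
      simp
end

section
/- Let n ≥ 1, let B = B_R(x₀) ⊆ ℝⁿ be an open ball, and let V : ℝⁿ → ℝ be a continuous function with V(x) > 0 for almost every x ∈ B. Then for every ε > 0 there exists a constant c_ε > 0 such that ∫_B |u|² ≤ ε ∫_B |Du|² + c_ε ∫_B V |u|² for every smooth function u : ℝⁿ → ℂ. -/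
open MeasureTheory

section Homothety

variable {E : Type*} [NormedAddCommGroup E] [NormedSpace ℝ E] [FiniteDimensional ℝ E]
  [MeasurableSpace E] [BorelSpace E] (μ : Measure E) [μ.IsAddHaarMeasure]

/-- Change of variables `x ↦ t • x + v` for the Lebesgue integral. -/
lemma lintegral_comp_smul_add {t : ℝ} (ht : 0 < t) (v : E) {h : E → ENNReal} (hh : Measurable h) :
    ∫⁻ x, h (t • x + v) ∂μ =
      ENNReal.ofReal ((t ^ Module.finrank ℝ E)⁻¹) * ∫⁻ x, h x ∂μ := by
  have h1 : ∫⁻ x, h (t • x + v) ∂μ = ∫⁻ y, h (y + v) ∂(Measure.map (fun x => t • x) μ) := by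
    rw [lintegral_map (by fun_prop) (by fun_prop)]
  rw [h1, Measure.map_addHaar_smul μ ht.ne', lintegral_smul_measure, lintegral_add_right_eq_self,
    abs_of_pos (by positivity), smul_eq_mul]

/-- A contraction of a convex set towards one of its points expands integrals at most by the
inverse of its Jacobian. -/
lemma Convex.setLIntegral_comp_homothety_le {K : Set E} (hK : Convex ℝ K) (hKm : MeasurableSet K)
    {t : ℝ} (ht : 0 < t) (ht1 : t ≤ 1) {w : E} (hw : w ∈ K) {h : E → ENNReal}
    (hh : Measurable h) :
    ∫⁻ x in K, h (t • x + (1 - t) • w) ∂μ ≤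
      ENNReal.ofReal ((t ^ Module.finrank ℝ E)⁻¹) * ∫⁻ x in K, h x ∂μ := by
  rw [← lintegral_indicator hKm, ← lintegral_indicator hKm,
    ← lintegral_comp_smul_add μ ht ((1 - t) • w) (hh.indicator hKm)]
  refine lintegral_mono fun x => ?_
  by_cases hx : x ∈ K
  · have : t • x + (1 - t) • w ∈ K := hK hx hw ht.le (by linarith) (by ring)
    simp [hx, this]
  · simp [hx]

/-- A contraction by a factor at least `1 / 2` of a convex set towards one of its points expands
integrals at most by `2 ^ d`. -/
lemma Convex.setLIntegral_comp_homothety_le_two_pow {K : Set E} (hK : Convex ℝ K)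
    (hKm : MeasurableSet K) {s : ℝ} (hs : 0 ≤ s) (hs1 : s ≤ 1 / 2) {w : E} (hw : w ∈ K)
    {h : E → ENNReal} (hh : Measurable h) :
    ∫⁻ x in K, h ((1 - s) • x + s • w) ∂μ ≤
      2 ^ Module.finrank ℝ E * ∫⁻ x in K, h x ∂μ := by
  have h1 := hK.setLIntegral_comp_homothety_le μ hKm (t := 1 - s) (by linarith) (by linarith) hw hh
  rw [sub_sub_cancel] at h1
  refine h1.trans (mul_le_mul_left ?_ _)
  rw [← ENNReal.ofReal_ofNat 2, ← ENNReal.ofReal_pow (by norm_num), ← inv_pow]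
  refine ENNReal.ofReal_le_ofReal (pow_le_pow_left₀ (inv_nonneg.2 (by linarith)) ?_ _)
  rw [inv_le_comm₀ (by linarith) (by norm_num)]
  linarith

end Homothety

lemma ENNReal.add_sq_le (a b : ENNReal) : (a + b) ^ 2 ≤ 2 * (a ^ 2 + b ^ 2) := by
  have := ENNReal.rpow_add_le_mul_rpow_add_rpow a b (p := 2) (by norm_num)
  norm_num at this
  exact this

lemma sq_lintegral_le_measure_univ_mul {α : Type*} [MeasurableSpace α] (μ : Measure α)
    {f : α → ENNReal} (hf : AEMeasurable f μ) :
    (∫⁻ a, f a ∂μ) ^ 2 ≤ μ Set.univ * ∫⁻ a, f a ^ 2 ∂μ := by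
  have h := ENNReal.lintegral_mul_norm_pow_le (μ := μ) (f := fun _ => 1) (g := fun a => f a ^ 2)
    aemeasurable_const (hf.pow_const 2) (p := 1 / 2) (q := 1 / 2) (by norm_num) (by norm_num)
    (by norm_num)
  have e : ∀ a : ENNReal, (a ^ 2) ^ (1 / 2 : ℝ) = a := fun a => by
    rw [← ENNReal.rpow_natCast, ← ENNReal.rpow_mul]; norm_num
  have e' : ∀ a : ENNReal, (a ^ (1 / 2 : ℝ)) ^ 2 = a := fun a => by
    rw [← ENNReal.rpow_natCast, ← ENNReal.rpow_mul]; norm_num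
  simp only [ENNReal.one_rpow, one_mul, e, lintegral_one] at h
  calc _ ≤ _ := pow_le_pow_left' h 2
    _ = _ := by rw [mul_pow, e', e']

section Segment

variable {E F : Type*} [NormedAddCommGroup E] [NormedSpace ℝ E]
  [NormedAddCommGroup F] [NormedSpace ℝ F] [CompleteSpace F]

/-- The squared increment of a `C¹` function along a segment is controlled by the integral of the
squared derivative along that segment. -/
lemma ContDiff.enorm_sub_sq_le_setLIntegral {u : E → F} (hu : ContDiff ℝ 1 u) {θ : ℝ}
    (hθ : 0 ≤ θ) (x w : E) :
    ‖u x - u ((1 - θ) • x + θ • w)‖ₑ ^ 2 ≤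
      ENNReal.ofReal θ * ‖w - x‖ₑ ^ 2 *
        ∫⁻ s in Set.Ioc 0 θ, ‖fderiv ℝ u ((1 - s) • x + s • w)‖ₑ ^ 2 := by
  have hc : Continuous (fderiv ℝ u) := hu.continuous_fderiv one_ne_zero
  have hd : ∀ s : ℝ, HasDerivAt (fun s : ℝ => u ((1 - s) • x + s • w))
      (fderiv ℝ u ((1 - s) • x + s • w) (w - x)) s := fun s => by
    have h1 : HasDerivAt (fun s : ℝ => (1 - s) • x + s • w) (w - x) s := by
      have := (((hasDerivAt_id s).const_sub 1).smul_const x).fun_add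
        ((hasDerivAt_id s).smul_const w)
      simpa [sub_eq_neg_add] using this
    exact ((hu.differentiable one_ne_zero _).hasFDerivAt).comp_hasDerivAt s h1
  have hφ : Continuous fun s : ℝ => fderiv ℝ u ((1 - s) • x + s • w) := by fun_prop
  have hφ' : Continuous fun s : ℝ => fderiv ℝ u ((1 - s) • x + s • w) (w - x) :=
    hφ.clm_apply continuous_const
  have hF := intervalIntegral.integral_eq_sub_of_hasDerivAt (a := 0) (b := θ)
    (fun s _ => hd s) (hφ'.intervalIntegrable _ _)
  simp only [sub_zero, one_smul, zero_smul, add_zero] at hF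
  rw [intervalIntegral.integral_of_le hθ] at hF
  rw [enorm_sub_rev, ← hF]
  calc _ ≤ (∫⁻ s in Set.Ioc 0 θ, ‖fderiv ℝ u ((1 - s) • x + s • w)‖ₑ * ‖w - x‖ₑ) ^ 2 := by
        refine pow_le_pow_left' ((enorm_integral_le_lintegral_enorm _).trans ?_) 2
        exact lintegral_mono fun s => ContinuousLinearMap.le_opENorm _ _
    _ = ‖w - x‖ₑ ^ 2 * (∫⁻ s in Set.Ioc 0 θ, ‖fderiv ℝ u ((1 - s) • x + s • w)‖ₑ) ^ 2 := by
        rw [lintegral_mul_const _ hφ.enorm.measurable, mul_pow, mul_comm]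
    _ ≤ ‖w - x‖ₑ ^ 2 * (ENNReal.ofReal θ *
        ∫⁻ s in Set.Ioc 0 θ, ‖fderiv ℝ u ((1 - s) • x + s • w)‖ₑ ^ 2) := by
        gcongr
        refine (sq_lintegral_le_measure_univ_mul _ hφ.enorm.aemeasurable).trans_eq ?_
        simp
    _ = _ := by ring

end Segment

section Averaging

variable {E F : Type*} [NormedAddCommGroup E] [NormedSpace ℝ E] [FiniteDimensional ℝ E]
  [MeasurableSpace E] [BorelSpace E] (μ : Measure E) [μ.IsAddHaarMeasure]
  [NormedAddCommGroup F] [NormedSpace ℝ F] [CompleteSpace F]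

/-- A Poincaré-type inequality for increments towards the points of a convex set. -/
lemma Convex.lintegral_lintegral_enorm_sub_sq_le {K : Set E} (hK : Convex ℝ K)
    (hKm : MeasurableSet K) {D : ENNReal} (hD : ∀ x ∈ K, ∀ w ∈ K, ‖w - x‖ₑ ≤ D)
    {u : E → F} (hu : ContDiff ℝ 1 u) {θ : ℝ} (hθ : 0 ≤ θ) (hθ1 : θ ≤ 1 / 2) :
    ∫⁻ x in K, ∫⁻ w in K, ‖u x - u ((1 - θ) • x + θ • w)‖ₑ ^ 2 ∂μ ∂μ ≤
      ENNReal.ofReal θ ^ 2 * D ^ 2 * 2 ^ Module.finrank ℝ E * μ K *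
        ∫⁻ x in K, ‖fderiv ℝ u x‖ₑ ^ 2 ∂μ := by
  have hc : Continuous (fderiv ℝ u) := hu.continuous_fderiv one_ne_zero
  set G : E → ENNReal := fun x => ‖fderiv ℝ u x‖ₑ ^ 2 with hG
  have hGm : Measurable G := (hc.enorm.measurable).pow_const 2
  have hm : Measurable fun p : (E × ℝ) × E => G ((1 - p.1.2) • p.1.1 + p.1.2 • p.2) :=
    hGm.comp (Continuous.measurable (by fun_prop))
  have hm2 : Measurable fun p : E × ℝ => ∫⁻ w in K, G ((1 - p.2) • p.1 + p.2 • w) ∂μ :=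
    hm.lintegral_prod_right'
  calc _ ≤ ∫⁻ x in K, ∫⁻ w in K, ENNReal.ofReal θ * D ^ 2 *
        ∫⁻ s in Set.Ioc 0 θ, G ((1 - s) • x + s • w) ∂volume ∂μ ∂μ := by
        refine setLIntegral_mono' hKm fun x hx => setLIntegral_mono' hKm fun w hw => ?_
        refine (hu.enorm_sub_sq_le_setLIntegral hθ x w).trans ?_
        gcongr
        exact hD x hx w hw
    _ = ENNReal.ofReal θ * D ^ 2 *
        ∫⁻ x in K, ∫⁻ s in Set.Ioc 0 θ, ∫⁻ w in K, G ((1 - s) • x + s • w) ∂μ ∂volume ∂μ := by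
        rw [← lintegral_const_mul _ (by exact hm2.lintegral_prod_right')]
        refine lintegral_congr fun x => ?_
        rw [lintegral_const_mul _ ?_, lintegral_lintegral_swap]
        · exact (hGm.comp (Continuous.measurable (by fun_prop :
            Continuous fun p : E × ℝ => (1 - p.2) • x + p.2 • p.1))).aemeasurable
        · exact (hGm.comp (Continuous.measurable (by fun_prop :
            Continuous fun p : E × ℝ => (1 - p.2) • x + p.2 • p.1))).lintegral_prod_right'
    _ = ENNReal.ofReal θ * D ^ 2 *
        ∫⁻ s in Set.Ioc 0 θ, ∫⁻ w in K, ∫⁻ x in K, G ((1 - s) • x + s • w) ∂μ ∂μ ∂volume := by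
        congr 1
        rw [lintegral_lintegral_swap hm2.aemeasurable]
        refine lintegral_congr fun s => ?_
        rw [lintegral_lintegral_swap]
        exact (hGm.comp (Continuous.measurable (by fun_prop :
            Continuous fun p : E × E => (1 - s) • p.1 + s • p.2))).aemeasurable
    _ ≤ ENNReal.ofReal θ * D ^ 2 *
        ∫⁻ _ in Set.Ioc 0 θ, ∫⁻ _ in K, 2 ^ Module.finrank ℝ E * (∫⁻ x in K, G x ∂μ) ∂μ := by
        refine mul_le_mul_right (setLIntegral_mono' measurableSet_Ioc fun s hs =>
          setLIntegral_mono' hKm fun w hw => ?_) _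
        exact hK.setLIntegral_comp_homothety_le_two_pow μ hKm hs.1.le (hs.2.trans hθ1) hw hGm
    _ = _ := by
        simp only [lintegral_const, Measure.restrict_apply_univ, Real.volume_Ioc, sub_zero]
        ring

/-- If the sublevel set `{V < η}` occupies a small enough part of a convex set, the `L²` norm of a
`C¹` function is controlled by its derivative and its `V`-weighted `L²` norm. -/
lemma Convex.lintegral_enorm_sq_le {K : Set E} (hK : Convex ℝ K)
    (hKm : MeasurableSet K) (hKfin : μ K ≠ ⊤) {D : ENNReal}
    (hD : ∀ x ∈ K, ∀ w ∈ K, ‖w - x‖ₑ ≤ D)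
    {V : E → ℝ} (hV : Measurable V) {θ η : ℝ} (hθ : 0 < θ) (hθ1 : θ ≤ 1 / 2) (hη : 0 < η)
    (hVη : ENNReal.ofReal ((θ ^ Module.finrank ℝ E)⁻¹) * μ (K ∩ {x | V x < η}) ≤ μ K / 2)
    {u : E → F} (hu : ContDiff ℝ 1 u) :
    μ K / 2 * ∫⁻ x in K, ‖u x‖ₑ ^ 2 ∂μ ≤
      2 * (ENNReal.ofReal θ ^ 2 * D ^ 2 * 2 ^ Module.finrank ℝ E * μ K *
        ∫⁻ x in K, ‖fderiv ℝ u x‖ₑ ^ 2 ∂μ) +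
      2 * (ENNReal.ofReal η)⁻¹ * (μ K * (2 ^ Module.finrank ℝ E *
        ∫⁻ x in K, ENNReal.ofReal (V x) * ‖u x‖ₑ ^ 2 ∂μ)) := by
  have hum : Measurable fun x => ‖u x‖ₑ ^ 2 := hu.continuous.enorm.measurable.pow_const 2
  set H : E → ENNReal := fun x => ENNReal.ofReal (V x) * ‖u x‖ₑ ^ 2 with hH
  have hHm : Measurable H := (ENNReal.measurable_ofReal.comp hV).mul hum
  have hm1 : Measurable fun p : E × E => ‖u p.1 - u ((1 - θ) • p.1 + θ • p.2)‖ₑ ^ 2 := by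
    have := hu.continuous
    exact (Continuous.measurable (by fun_prop : Continuous fun p : E × E =>
      ‖u p.1 - u ((1 - θ) • p.1 + θ • p.2)‖ₑ)).pow_const 2
  have hm2 : Measurable fun p : E × E => H ((1 - θ) • p.1 + θ • p.2) :=
    hHm.comp (Continuous.measurable (by fun_prop))
  have key : ∀ x ∈ K, μ K / 2 * ‖u x‖ₑ ^ 2 ≤
      2 * (∫⁻ w in K, ‖u x - u ((1 - θ) • x + θ • w)‖ₑ ^ 2 ∂μ) +
      2 * (ENNReal.ofReal η)⁻¹ * ∫⁻ w in K, H ((1 - θ) • x + θ • w) ∂μ := by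
    intro x hx
    have hφ : Measurable fun w : E => (1 - θ) • x + θ • w :=
      Continuous.measurable (by fun_prop)
    set S : Set E := {y | V y < η}
    have hS : MeasurableSet S := measurableSet_lt hV measurable_const
    set T : Set E := (fun w : E => (1 - θ) • x + θ • w) ⁻¹' S
    have hT : MeasurableSet T := hφ hS
    have hbad : μ (K ∩ T) ≤ μ K / 2 := by
      refine le_trans ?_ hVη
      have h1 := hK.setLIntegral_comp_homothety_le μ hKm hθ (by linarith) hx
        (h := S.indicator 1) (measurable_one.indicator hS)
      have e1 : ∀ w, S.indicator (1 : E → ENNReal) (θ • w + (1 - θ) • x) =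
          T.indicator 1 w := fun w => by
        rw [add_comm]; rfl
      simp only [e1] at h1
      rwa [lintegral_indicator_one hT, lintegral_indicator_one hS, Measure.restrict_apply hT,
        Measure.restrict_apply hS, Set.inter_comm T, Set.inter_comm S] at h1
    have hgood : μ K / 2 ≤ μ (K \ T) := by
      rw [← Set.sdiff_self_inter]
      refine le_trans ?_ le_measure_sdiff
      calc μ K / 2 = μ K - μ K / 2 := (ENNReal.sub_half hKfin).symm
        _ ≤ _ := tsub_le_tsub_left hbad _
    calc μ K / 2 * ‖u x‖ₑ ^ 2 ≤ ∫⁻ _ in K \ T, ‖u x‖ₑ ^ 2 ∂μ := by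
          rw [setLIntegral_const, mul_comm]
          gcongr
      _ ≤ ∫⁻ w in K \ T, (2 * ‖u x - u ((1 - θ) • x + θ • w)‖ₑ ^ 2 +
          2 * (ENNReal.ofReal η)⁻¹ * H ((1 - θ) • x + θ • w)) ∂μ := by
          refine setLIntegral_mono' (hKm.diff hT) fun w hw => ?_
          set y := (1 - θ) • x + θ • w
          have hy : η ≤ V y := not_lt.1 hw.2
          calc ‖u x‖ₑ ^ 2 = ‖(u x - u y) + u y‖ₑ ^ 2 := by rw [sub_add_cancel]
            _ ≤ (‖u x - u y‖ₑ + ‖u y‖ₑ) ^ 2 := pow_le_pow_left' (enorm_add_le _ _) 2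
            _ ≤ 2 * (‖u x - u y‖ₑ ^ 2 + ‖u y‖ₑ ^ 2) := ENNReal.add_sq_le _ _
            _ ≤ _ := by
              rw [mul_add, mul_assoc 2]
              gcongr
              rw [hH, ← mul_assoc]
              refine le_mul_of_one_le_left' ?_
              rw [← ENNReal.inv_mul_cancel (ENNReal.ofReal_pos.2 hη).ne' ENNReal.ofReal_ne_top]
              gcongr
      _ ≤ ∫⁻ w in K, (2 * ‖u x - u ((1 - θ) • x + θ • w)‖ₑ ^ 2 +
          2 * (ENNReal.ofReal η)⁻¹ * H ((1 - θ) • x + θ • w)) ∂μ :=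
          lintegral_mono_set Set.sdiff_subset
      _ = _ := by
          have a1 := hm1.comp (measurable_prodMk_left (x := x))
          have a2 := hm2.comp (measurable_prodMk_left (x := x))
          rw [lintegral_add_left (by exact a1.const_mul 2), lintegral_const_mul _ (by exact a1),
            lintegral_const_mul _ (by exact a2)]
  calc _ = ∫⁻ x in K, μ K / 2 * ‖u x‖ₑ ^ 2 ∂μ := (lintegral_const_mul _ hum).symm
    _ ≤ ∫⁻ x in K, (2 * (∫⁻ w in K, ‖u x - u ((1 - θ) • x + θ • w)‖ₑ ^ 2 ∂μ) +
      2 * (ENNReal.ofReal η)⁻¹ * ∫⁻ w in K, H ((1 - θ) • x + θ • w) ∂μ) ∂μ :=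
        setLIntegral_mono' hKm key
    _ = 2 * (∫⁻ x in K, ∫⁻ w in K, ‖u x - u ((1 - θ) • x + θ • w)‖ₑ ^ 2 ∂μ ∂μ) +
      2 * (ENNReal.ofReal η)⁻¹ * ∫⁻ w in K, ∫⁻ x in K, H ((1 - θ) • x + θ • w) ∂μ ∂μ := by
        have b1 := hm1.lintegral_prod_right' (ν := μ.restrict K)
        have b2 := hm2.lintegral_prod_right' (ν := μ.restrict K)
        rw [lintegral_add_left (by exact b1.const_mul 2), lintegral_const_mul _ (by exact b1),
          lintegral_const_mul _ (by exact b2)]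
        congr 2
        exact lintegral_lintegral_swap hm2.aemeasurable
    _ ≤ _ := by
        gcongr ?_ + ?_
        · gcongr
          exact hK.lintegral_lintegral_enorm_sub_sq_le μ hKm hD hu hθ.le hθ1
        · refine mul_le_mul_right ?_ _
          calc _ ≤ ∫⁻ _ in K, 2 ^ Module.finrank ℝ E * (∫⁻ x in K, H x ∂μ) ∂μ :=
                setLIntegral_mono' hKm fun w hw =>
                  hK.setLIntegral_comp_homothety_le_two_pow μ hKm hθ.le hθ1 hw hHm
            _ = _ := by rw [setLIntegral_const, mul_comm]

end Averaging

/-- If `V > 0` almost everywhere on a set of finite measure, then the sublevel sets `{V < η}` have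
arbitrarily small measure in that set. -/
lemma exists_measure_inter_sublevel_le {α : Type*} [MeasurableSpace α] (μ : Measure α)
    {K : Set α} (hKm : MeasurableSet K) (hKfin : μ K ≠ ⊤) {V : α → ℝ} (hV : Measurable V)
    (hpos : ∀ᵐ x ∂(μ.restrict K), 0 < V x) {δ : ENNReal} (hδ : 0 < δ) :
    ∃ η > (0 : ℝ), μ (K ∩ {x | V x < η}) ≤ δ := by
  have hm : ∀ k : ℕ, MeasurableSet (K ∩ {x | V x < 1 / ((k : ℝ) + 1)}) := fun k =>
    hKm.inter (measurableSet_lt hV measurable_const)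
  have ht := tendsto_measure_iInter_atTop (μ := μ) (fun k => (hm k).nullMeasurableSet)
    (fun i j hij => Set.inter_subset_inter_right K fun x (hx : V x < _) =>
      hx.trans_le (one_div_le_one_div_of_le (by positivity) (by gcongr)))
    ⟨0, measure_ne_top_of_subset Set.inter_subset_left hKfin⟩
  have h0 : μ (⋂ k : ℕ, K ∩ {x | V x < 1 / ((k : ℝ) + 1)}) = 0 := by
    rw [ae_restrict_iff' hKm] at hpos
    refine measure_mono_null (fun x hx => ?_) hpos
    simp only [Set.mem_iInter, Set.mem_inter_iff, Set.mem_ofPred_eq] at hx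
    intro hlt
    obtain ⟨k, hk⟩ := exists_nat_one_div_lt (hlt (hx 0).1)
    exact lt_asymm hk (hx k).2
  rw [h0] at ht
  obtain ⟨k, hk⟩ := (ht.eventually (ge_mem_nhds hδ)).exists
  exact ⟨1 / ((k : ℝ) + 1), by positivity, hk⟩


/-- compactness lemma. Let `B = B_R(x₀) ⊆ ℝⁿ` be an open ball (`R > 0`),
and `V : ℝⁿ → ℝ` continuous with `V > 0` a.e. on `B`. Then for every `ε > 0` there is
`c_ε > 0` with `∫_B |u|² ≤ ε ∫_B |Du|² + c_ε ∫_B V |u|²` for all smooth `u : ℝⁿ → ℂ`. -/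
theorem compactness_lemma
    (n : ℕ) (hn : 1 ≤ n)
    (x₀ : EuclideanSpace ℝ (Fin n)) (R : ℝ) (hR : 0 < R)
    (V : EuclideanSpace ℝ (Fin n) → ℝ) (hV_cont : Continuous V)
    (hV_pos : ∀ᵐ x ∂(volume.restrict (Metric.ball x₀ R)), 0 < V x) :
    ∀ ε > (0 : ℝ), ∃ cε > (0 : ℝ), ∀ u : EuclideanSpace ℝ (Fin n) → ℂ, ContDiff ℝ (⊤ : ℕ∞) u →
      ∫ x in Metric.ball x₀ R, ‖u x‖ ^ 2 ≤
        ε * ∫ x in Metric.ball x₀ R, ‖fderiv ℝ u x‖ ^ 2 +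
        cε * ∫ x in Metric.ball x₀ R, V x * ‖u x‖ ^ 2 := by
  intro ε hε
  set K := Metric.ball x₀ R
  have hKm : MeasurableSet K := measurableSet_ball
  have hK : Convex ℝ K := convex_ball x₀ R
  have hKfin : volume K ≠ ⊤ := measure_ball_lt_top.ne
  have hKpos : 0 < volume K := Metric.measure_ball_pos _ _ hR
  set m := volume.real K with hm
  have hm0 : 0 < m := ENNReal.toReal_pos hKpos.ne' hKfin
  have hmK : (volume K).toReal = m := rfl
  have hD : ∀ x ∈ K, ∀ w ∈ K, ‖w - x‖ₑ ≤ ENNReal.ofReal (2 * R) := fun x hx w hw => by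
    rw [← ofReal_norm, ← dist_eq_norm]
    refine ENNReal.ofReal_le_ofReal ((dist_triangle_right w x x₀).trans ?_)
    linarith [Metric.mem_ball.1 hx, Metric.mem_ball.1 hw]
  set θ : ℝ := min (1 / 2) (ε / (16 * R ^ 2 * 2 ^ n))
  have hθ : 0 < θ := lt_min (by norm_num) (by positivity)
  have hθ1 : θ ≤ 1 / 2 := min_le_left _ _
  have hθε : 16 * R ^ 2 * 2 ^ n * θ ^ 2 ≤ ε := by
    have h1 : θ * (16 * R ^ 2 * 2 ^ n) ≤ ε := (le_div_iff₀ (by positivity)).1 (min_le_right _ _)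
    have h2 : θ ^ 2 ≤ θ := by nlinarith
    have h3 : 0 ≤ 16 * R ^ 2 * 2 ^ n := by positivity
    nlinarith
  obtain ⟨η, hη, hVη⟩ := exists_measure_inter_sublevel_le volume hKm hKfin hV_cont.measurable
    hV_pos (δ := (ENNReal.ofReal ((θ ^ n)⁻¹))⁻¹ * (volume K / 2))
    (ENNReal.mul_pos (ENNReal.inv_ne_zero.2 ENNReal.ofReal_ne_top)
      (ENNReal.half_pos hKpos.ne').ne')
  refine ⟨4 * 2 ^ n / (η * ε * m), by positivity, fun u hu => ?_⟩
  have hu1 : ContDiff ℝ 1 u := hu.of_le (by exact_mod_cast le_top)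
  have hintegrable : ∀ f : EuclideanSpace ℝ (Fin n) → ℝ, Continuous f → IntegrableOn f K :=
    fun f hf =>
    (hf.continuousOn.integrableOn_compact (isCompact_closedBall x₀ R)).mono_set
      Metric.ball_subset_closedBall
  have hu_cont := hu1.continuous
  have hdu_cont : Continuous (fderiv ℝ u) := hu1.continuous_fderiv one_ne_zero
  have hV_nonneg : 0 ≤ᵐ[volume.restrict K] fun x => V x * ‖u x‖ ^ 2 := by
    filter_upwards [hV_pos] with x hx
    exact mul_nonneg hx.le (by positivity)
  have h1 : ∫⁻ x in K, ‖u x‖ₑ ^ 2 = ENNReal.ofReal (∫ x in K, ‖u x‖ ^ 2) := by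
    rw [ofReal_integral_eq_lintegral_ofReal (hintegrable _ (by fun_prop))
      (Filter.Eventually.of_forall fun x => by positivity)]
    simp [ENNReal.ofReal_pow]
  have h2 : ∫⁻ x in K, ‖fderiv ℝ u x‖ₑ ^ 2 = ENNReal.ofReal (∫ x in K, ‖fderiv ℝ u x‖ ^ 2) := by
    rw [ofReal_integral_eq_lintegral_ofReal (hintegrable _ (by fun_prop))
      (Filter.Eventually.of_forall fun x => by positivity)]
    simp [ENNReal.ofReal_pow]
  have h3 : ∫⁻ x in K, ENNReal.ofReal (V x) * ‖u x‖ₑ ^ 2 =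
      ENNReal.ofReal (∫ x in K, V x * ‖u x‖ ^ 2) := by
    rw [ofReal_integral_eq_lintegral_ofReal (hintegrable _ (by fun_prop)) hV_nonneg]
    simp [ENNReal.ofReal_pow, ENNReal.ofReal_mul']
  have hmain := hK.lintegral_enorm_sq_le volume hKm hKfin hD hV_cont.measurable hθ hθ1 hη
    (by
      rw [finrank_euclideanSpace_fin]
      refine (mul_le_mul_right hVη _).trans_eq ?_
      rw [← mul_assoc, ENNReal.mul_inv_cancel (ENNReal.ofReal_pos.2 (by positivity)).ne'
        ENNReal.ofReal_ne_top, one_mul]) hu1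
  rw [finrank_euclideanSpace_fin, h1, h2, h3, ← ENNReal.ofReal_inv_of_pos hη,
    ← ENNReal.ofReal_toReal hKfin, hmK] at hmain
  rw [integral_add (hintegrable _ (by fun_prop)) (integrableOn_const hKfin), setIntegral_const, ← hm,
    smul_eq_mul]
  have hI1 : 0 ≤ ∫ x in K, ‖u x‖ ^ 2 := integral_nonneg fun x => by positivity
  have hI2 : 0 ≤ ∫ x in K, ‖fderiv ℝ u x‖ ^ 2 := integral_nonneg fun x => by positivity
  have hI3 : 0 ≤ ∫ x in K, V x * ‖u x‖ ^ 2 := integral_nonneg_of_ae hV_nonneg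
  generalize (∫ x in K, ‖u x‖ ^ 2) = I₁ at *
  generalize (∫ x in K, ‖fderiv ℝ u x‖ ^ 2) = I₂ at *
  generalize (∫ x in K, V x * ‖u x‖ ^ 2) = I₃ at *
  have hreal : m / 2 * I₁ ≤ 2 * (θ ^ 2 * (2 * R) ^ 2 * 2 ^ n * m * I₂) +
      2 * η⁻¹ * (m * (2 ^ n * I₃)) := by
    have := ENNReal.toReal_mono (by finiteness) hmain
    rw [ENNReal.toReal_add (by finiteness) (by finiteness)] at this
    simpa [ENNReal.toReal_mul, ENNReal.toReal_ofReal, hm0.le, hθ.le, hη.le, hR.le, hI1, hI2,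
      hI3] using this
  have hdiv : I₁ ≤ 16 * R ^ 2 * 2 ^ n * θ ^ 2 * I₂ + 4 * 2 ^ n / η * I₃ := by
    refine le_of_mul_le_mul_left (hreal.trans_eq ?_) (half_pos hm0)
    field_simp
    ring
  calc I₁ ≤ _ := hdiv
    _ ≤ ε * I₂ + 4 * 2 ^ n / η * I₃ := by gcongr
    _ = _ := by field_simp
end

section
/- Let n ≥ 2, and let q, V : ℝⁿ → ℝ be continuous functions with V(x) > 0 for almost every x ∈ ℝⁿ. Assume there are positive constants ε₀, δ, m₀, R₁ such that q(x) + m₀ V(x) ≥ ε₀ |x|^{−2+δ} for all x with |x| ≥ R₁. Then there exists m₁ ≥ m₀ such that for all m ≥ m₁ and all smooth compactly supported u : ℝⁿ → ℂ, ∫_{B_{R₁}(0)} |u|² ≤ ∫_{ℝⁿ} ( (n−1) |Du|² + (q + m V) |u|² ). -/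
open MeasureTheory

/-- The mean value inequality in `L²` form along the segment from `x` to `x + z`. -/
theorem norm_sub_sq_le_integral_fderiv {E F : Type*} [NormedAddCommGroup E] [NormedSpace ℝ E]
    [NormedAddCommGroup F] [NormedSpace ℝ F] [CompleteSpace F] {u : E → F}
    (hu : ContDiff ℝ 1 u) (x z : E) :
    ‖u (x + z) - u x‖ ^ 2 ≤ ‖z‖ ^ 2 * ∫ t in (0 : ℝ)..1, ‖fderiv ℝ u (x + t • z)‖ ^ 2 := by
  have hDc : Continuous (fun t : ℝ => fderiv ℝ u (x + t • z)) :=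
    (hu.continuous_fderiv one_ne_zero).comp (by fun_prop)
  set f : ℝ → ℝ := fun t => ‖fderiv ℝ u (x + t • z)‖ with hf
  have hfc : Continuous f := hDc.norm
  have hftc : ∫ t in (0 : ℝ)..1, fderiv ℝ u (x + t • z) z = u (x + z) - u x := by
    have hderiv : ∀ t ∈ Set.uIcc (0 : ℝ) 1,
        HasDerivAt (fun t : ℝ => u (x + t • z)) (fderiv ℝ u (x + t • z) z) t := fun t _ => by
      have hline : HasDerivAt (fun t : ℝ => x + t • z) z t := by
        simpa using ((hasDerivAt_id t).smul_const z).const_add x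
      exact ((hu.differentiable one_ne_zero _).hasFDerivAt).comp_hasDerivAt t hline
    have h := intervalIntegral.integral_eq_sub_of_hasDerivAt hderiv
      ((hDc.clm_apply continuous_const).intervalIntegrable 0 1)
    simpa using h
  have hle : ‖u (x + z) - u x‖ ≤ (∫ t in (0 : ℝ)..1, f t) * ‖z‖ := by
    rw [← hftc, ← intervalIntegral.integral_mul_const]
    exact intervalIntegral.norm_integral_le_of_norm_le zero_le_one
      (Filter.Eventually.of_forall fun t _ => (fderiv ℝ u (x + t • z)).le_opNorm z)
      ((hfc.mul continuous_const).intervalIntegrable 0 1)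
  have hjensen : (∫ t in (0 : ℝ)..1, f t) ^ 2 ≤ ∫ t in (0 : ℝ)..1, f t ^ 2 := by
    set c := ∫ t in (0 : ℝ)..1, f t with hc
    have hnonneg : 0 ≤ ∫ t in (0 : ℝ)..1, (f t ^ 2 - 2 * c * f t + c ^ 2) :=
      intervalIntegral.integral_nonneg zero_le_one fun t _ => by nlinarith [sq_nonneg (f t - c)]
    rw [intervalIntegral.integral_add
        ((by fun_prop : Continuous fun t => f t ^ 2 - 2 * c * f t).intervalIntegrable 0 1)
        (continuous_const.intervalIntegrable 0 1),
      intervalIntegral.integral_sub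
        ((by fun_prop : Continuous fun t => f t ^ 2).intervalIntegrable 0 1)
        ((by fun_prop : Continuous fun t => 2 * c * f t).intervalIntegrable 0 1),
      intervalIntegral.integral_const_mul, ← hc] at hnonneg
    simp at hnonneg
    nlinarith
  calc ‖u (x + z) - u x‖ ^ 2 ≤ ((∫ t in (0 : ℝ)..1, f t) * ‖z‖) ^ 2 := by gcongr
    _ = ‖z‖ ^ 2 * (∫ t in (0 : ℝ)..1, f t) ^ 2 := by ring
    _ ≤ _ := by gcongr

section Translation

variable {E F : Type*} [NormedAddCommGroup E] [NormedSpace ℝ E] [FiniteDimensional ℝ E]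
  [MeasurableSpace E] [BorelSpace E] {μ : Measure E} [μ.IsAddHaarMeasure]
  [NormedAddCommGroup F] [NormedSpace ℝ F] [CompleteSpace F] {u : E → F}

theorem lintegral_enorm_translate_sub_sq_le (hu : ContDiff ℝ 1 u) (z : E) :
    ∫⁻ x, ‖u (x + z) - u x‖ₑ ^ 2 ∂μ ≤ ‖z‖ₑ ^ 2 * ∫⁻ x, ‖fderiv ℝ u x‖ₑ ^ 2 ∂μ := by
  have hD : Continuous (fderiv ℝ u) := hu.continuous_fderiv one_ne_zero
  have hpoint : ∀ x, ‖u (x + z) - u x‖ₑ ^ 2 ≤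
      ‖z‖ₑ ^ 2 * ∫⁻ t in Set.Ioc (0 : ℝ) 1, ‖fderiv ℝ u (x + t • z)‖ₑ ^ 2 := fun x => by
    have hc : Continuous fun t : ℝ => ‖fderiv ℝ u (x + t • z)‖ ^ 2 := by fun_prop
    have h := ENNReal.ofReal_le_ofReal (norm_sub_sq_le_integral_fderiv hu x z)
    rw [ENNReal.ofReal_mul (by positivity), intervalIntegral.integral_of_le zero_le_one,
      ofReal_integral_eq_lintegral_ofReal
        ((hc.intervalIntegrable 0 1).1) (Filter.Eventually.of_forall fun t => by positivity)] at h
    simpa only [ENNReal.ofReal_pow (norm_nonneg _), ofReal_norm] using h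
  calc ∫⁻ x, ‖u (x + z) - u x‖ₑ ^ 2 ∂μ
      ≤ ∫⁻ x, ‖z‖ₑ ^ 2 * (∫⁻ t in Set.Ioc (0 : ℝ) 1, ‖fderiv ℝ u (x + t • z)‖ₑ ^ 2) ∂μ :=
        lintegral_mono hpoint
    _ = ‖z‖ₑ ^ 2 * ∫⁻ x, (∫⁻ t in Set.Ioc (0 : ℝ) 1, ‖fderiv ℝ u (x + t • z)‖ₑ ^ 2) ∂μ :=
        lintegral_const_mul' _ _ (by finiteness)
    _ = ‖z‖ₑ ^ 2 * ∫⁻ t in Set.Ioc (0 : ℝ) 1, ∫⁻ x, ‖fderiv ℝ u (x + t • z)‖ₑ ^ 2 ∂μ := by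
        rw [lintegral_lintegral_swap]
        exact Continuous.aemeasurable (by unfold Function.uncurry; fun_prop)
    _ = ‖z‖ₑ ^ 2 * ∫⁻ x, ‖fderiv ℝ u x‖ₑ ^ 2 ∂μ := by
        simp [lintegral_add_right_eq_self (μ := μ) (fun x => ‖fderiv ℝ u x‖ₑ ^ 2)]

/-- If every ball of radius `h` centred in `A` meets `G` in measure at least `c`, then the
`L²` norm of `u` over `A` is controlled by its `L²` norm over `G` and its Dirichlet energy. -/
theorem mul_setLIntegral_enorm_sq_le (hu : ContDiff ℝ 1 u) {A G : Set E}
    (hA : MeasurableSet A) (hG : MeasurableSet G) {h : ℝ} {c : ENNReal}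
    (hc : ∀ x ∈ A, c ≤ μ (Metric.ball x h ∩ G)) :
    c * ∫⁻ x in A, ‖u x‖ₑ ^ 2 ∂μ ≤ 2 * μ (Metric.ball 0 h) *
      (∫⁻ x in G, ‖u x‖ₑ ^ 2 ∂μ + ENNReal.ofReal h ^ 2 * ∫⁻ x, ‖fderiv ℝ u x‖ₑ ^ 2 ∂μ) := by
  have hcont : Continuous u := hu.continuous
  have hmeas : ∀ z : E, Measurable fun x => G.indicator (fun y => ‖u y‖ₑ ^ 2) (x + z) := fun z =>
    ((by fun_prop : Continuous fun y => ‖u y‖ₑ ^ 2).measurable.indicator hG).comp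
      (measurable_add_const z)
  have hpair : ∀ x z : E, G.indicator 1 (x + z) * ‖u x‖ₑ ^ 2 ≤
      2 * (G.indicator (fun y => ‖u y‖ₑ ^ 2) (x + z) + ‖u (x + z) - u x‖ₑ ^ 2) := fun x z => by
    by_cases hxz : x + z ∈ G
    · have htri : ‖u x‖ₑ ≤ ‖u (x + z)‖ₑ + ‖u (x + z) - u x‖ₑ := by
        simpa using enorm_sub_le (a := u (x + z)) (b := u (x + z) - u x)
      have hsq := ENNReal.rpow_add_le_mul_rpow_add_rpow ‖u (x + z)‖ₑ ‖u (x + z) - u x‖ₑ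
        one_le_two
      norm_num at hsq
      simp only [Set.indicator_of_mem hxz, Pi.one_apply, one_mul]
      calc ‖u x‖ₑ ^ 2 ≤ (‖u (x + z)‖ₑ + ‖u (x + z) - u x‖ₑ) ^ 2 := by gcongr
        _ ≤ _ := by simpa using hsq
    · simp [Set.indicator_of_notMem hxz]
  have hmass : ∀ x, ∫⁻ z in Metric.ball 0 h, G.indicator 1 (x + z) ∂μ
      = μ (Metric.ball x h ∩ G) := fun x => by
    rw [← lintegral_indicator measurableSet_ball]
    have hshift : ∀ z, (Metric.ball (0 : E) h).indicator
        (fun z => G.indicator (1 : E → ENNReal) (x + z)) z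
          = (Metric.ball x h ∩ G).indicator 1 (x + z) := fun z => by
      by_cases h1 : ‖z‖ < h <;> by_cases h2 : x + z ∈ G <;> simp [Set.indicator, h1, h2]
    simp_rw [hshift]
    rw [lintegral_add_left_eq_self (fun y => (Metric.ball x h ∩ G).indicator 1 y) x,
      lintegral_indicator_one (measurableSet_ball.inter hG)]
  calc c * ∫⁻ x in A, ‖u x‖ₑ ^ 2 ∂μ
      ≤ ∫⁻ x in A, c * ‖u x‖ₑ ^ 2 ∂μ := lintegral_const_mul_le _ _
    _ ≤ ∫⁻ x in A, μ (Metric.ball x h ∩ G) * ‖u x‖ₑ ^ 2 ∂μ :=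
        setLIntegral_mono' hA fun x hx => by gcongr; exact hc x hx
    _ ≤ ∫⁻ x, μ (Metric.ball x h ∩ G) * ‖u x‖ₑ ^ 2 ∂μ := setLIntegral_le_lintegral _ _
    _ = ∫⁻ x, ∫⁻ z in Metric.ball 0 h, G.indicator 1 (x + z) * ‖u x‖ₑ ^ 2 ∂μ ∂μ := by
        congr 1 with x
        rw [lintegral_mul_const' _ _ (by finiteness), hmass]
    _ = ∫⁻ z in Metric.ball 0 h, ∫⁻ x, G.indicator 1 (x + z) * ‖u x‖ₑ ^ 2 ∂μ ∂μ := by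
        refine lintegral_lintegral_swap (Measurable.aemeasurable ?_)
        exact ((measurable_one.indicator hG).comp (measurable_fst.add measurable_snd)).mul
          (Continuous.measurable (by fun_prop))
    _ ≤ ∫⁻ _ in Metric.ball (0 : E) h, 2 * (∫⁻ x in G, ‖u x‖ₑ ^ 2 ∂μ
          + ENNReal.ofReal h ^ 2 * ∫⁻ x, ‖fderiv ℝ u x‖ₑ ^ 2 ∂μ) ∂μ := by
        refine setLIntegral_mono' measurableSet_ball fun z hz => ?_
        refine (lintegral_mono fun x => hpair x z).trans ?_
        rw [lintegral_const_mul' _ _ (by finiteness), lintegral_add_left (hmeas z),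
          lintegral_add_right_eq_self (fun y => G.indicator (fun y => ‖u y‖ₑ ^ 2) y) z,
          lintegral_indicator hG]
        have hzh : ‖z‖ₑ ≤ ENNReal.ofReal h := by
          rw [← ofReal_norm]
          exact ENNReal.ofReal_le_ofReal (mem_ball_zero_iff.1 hz).le
        gcongr
        exact (lintegral_enorm_translate_sub_sq_le hu z).trans (by gcongr)
    _ = _ := by rw [setLIntegral_const]; ring

end Translation

theorem exists_pos_measure_lt_inter_le {X : Type*} [MeasurableSpace X] {μ : Measure X}
    {V : X → ℝ} (hV : Measurable V) (hpos : ∀ᵐ x ∂μ, 0 < V x) {S : Set X} (hS : MeasurableSet S)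
    (hSfin : μ S ≠ ⊤) {ε : ENNReal} (hε : 0 < ε) :
    ∃ η : ℝ, 0 < η ∧ μ ({x | V x < η} ∩ S) ≤ ε := by
  have hmeas : ∀ k : ℕ, MeasurableSet ({x | V x < 1 / ((k : ℝ) + 1)} ∩ S) := fun k =>
    (measurableSet_lt hV measurable_const).inter hS
  have hanti : Antitone fun k : ℕ => {x | V x < 1 / ((k : ℝ) + 1)} ∩ S := fun i j hij x hx =>
    ⟨lt_of_lt_of_le (show V x < 1 / ((j : ℝ) + 1) from hx.1)
      (Nat.one_div_le_one_div hij), hx.2⟩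
  have hlim := tendsto_measure_iInter_atTop (μ := μ) (fun k => (hmeas k).nullMeasurableSet) hanti
    ⟨0, measure_ne_top_of_subset Set.inter_subset_right hSfin⟩
  have hzero : μ (⋂ k : ℕ, {x | V x < 1 / ((k : ℝ) + 1)} ∩ S) = 0 := by
    refine measure_mono_null (t := {x | ¬ 0 < V x}) (fun x hx hVx => ?_) (ae_iff.1 hpos)
    obtain ⟨k, hk⟩ := exists_nat_one_div_lt hVx
    exact absurd (Set.mem_iInter.1 hx k).1 (not_lt.2 hk.le)
  rw [hzero] at hlim
  obtain ⟨k, hk⟩ := (hlim.eventually_lt_const hε).exists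
  exact ⟨1 / ((k : ℝ) + 1), Nat.one_div_pos_of_nat, hk.le⟩

/-- A continuous, almost everywhere positive potential controls the `L²` norm on a ball up to an
arbitrarily small multiple of the Dirichlet energy. -/
theorem exists_setIntegral_norm_sq_le {E F : Type*} [NormedAddCommGroup E] [NormedSpace ℝ E]
    [FiniteDimensional ℝ E] [MeasurableSpace E] [BorelSpace E] {μ : Measure E}
    [μ.IsAddHaarMeasure] [NormedAddCommGroup F] [NormedSpace ℝ F] [CompleteSpace F]
    {V : E → ℝ} (hV : Continuous V) (hpos : ∀ᵐ x ∂μ, 0 < V x) (R : ℝ) {ε : ℝ} (hε : 0 < ε) :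
    ∃ C : ℝ, 0 ≤ C ∧ ∀ u : E → F, ContDiff ℝ 1 u → HasCompactSupport u →
      ∫ x in Metric.ball 0 R, ‖u x‖ ^ 2 ∂μ ≤
        C * ∫ x, V x * ‖u x‖ ^ 2 ∂μ + ε * ∫ x, ‖fderiv ℝ u x‖ ^ 2 ∂μ := by
  set h : ℝ := √(ε / 4) with hh
  have hhpos : 0 < h := by positivity
  have hhsq : 4 * h ^ 2 = ε := by rw [hh, Real.sq_sqrt (by positivity)]; ring
  set b := μ (Metric.ball (0 : E) h) with hb
  have hb0 : b ≠ 0 := (Metric.measure_ball_pos μ 0 hhpos).ne'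
  have hbtop : b ≠ ⊤ := measure_ball_lt_top.ne
  obtain ⟨η, hη, hηle⟩ := exists_pos_measure_lt_inter_le hV.measurable hpos
    (measurableSet_ball (x := (0 : E)) (ε := R + h)) measure_ball_lt_top.ne (ENNReal.half_pos hb0)
  have hnonneg : ∀ᵐ x ∂μ, 0 ≤ V x := hpos.mono fun x hx => hx.le
  have hG : MeasurableSet {x | η ≤ V x} := measurableSet_le measurable_const hV.measurable
  have hdens : ∀ x ∈ Metric.ball (0 : E) R, b / 2 ≤ μ (Metric.ball x h ∩ {x | η ≤ V x}) := by
    intro x hx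
    have hsub : Metric.ball x h \ {x | η ≤ V x} ⊆ {x | V x < η} ∩ Metric.ball 0 (R + h) := by
      rintro y ⟨hy, hyV⟩
      refine ⟨show V y < η from not_le.1 hyV, ?_⟩
      have := dist_triangle y x 0
      rw [Metric.mem_ball] at *
      linarith
    have hsplit := measure_inter_add_sdiff (μ := μ) (Metric.ball x h) hG
    rw [Measure.addHaar_ball_center, ← hb] at hsplit
    have hdiff := (measure_mono hsub).trans hηle
    have : b / 2 + b / 2 ≤ μ (Metric.ball x h ∩ {x | η ≤ V x}) + b / 2 := by
      rw [ENNReal.add_halves]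
      conv_lhs => rw [← hsplit]
      gcongr
    exact (ENNReal.add_le_add_iff_right (ENNReal.div_ne_top hbtop two_ne_zero)).1 this
  refine ⟨4 / η, by positivity, fun u hu hsupp => ?_⟩
  have hcont : Continuous u := hu.continuous
  have hD : Continuous (fderiv ℝ u) := hu.continuous_fderiv one_ne_zero
  have hui : Integrable (fun x => ‖u x‖ ^ 2) μ :=
    (by fun_prop : Continuous fun x => ‖u x‖ ^ 2).integrable_of_hasCompactSupport
      (hsupp.comp_left (g := fun y => ‖y‖ ^ 2) (by simp))
  have hDi : Integrable (fun x => ‖fderiv ℝ u x‖ ^ 2) μ :=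
    (by fun_prop : Continuous fun x => ‖fderiv ℝ u x‖ ^ 2).integrable_of_hasCompactSupport
      ((hsupp.fderiv ℝ).comp_left (g := fun y => ‖y‖ ^ 2) (by simp))
  have hVi : Integrable (fun x => V x * ‖u x‖ ^ 2) μ :=
    (by fun_prop : Continuous fun x => V x * ‖u x‖ ^ 2).integrable_of_hasCompactSupport
      ((hsupp.comp_left (g := fun y => ‖y‖ ^ 2) (by simp)).mul_left)
  have hmain : ∫ x in Metric.ball 0 R, ‖u x‖ ^ 2 ∂μ ≤
      4 * (∫ x in {x | η ≤ V x}, ‖u x‖ ^ 2 ∂μ + h ^ 2 * ∫ x, ‖fderiv ℝ u x‖ ^ 2 ∂μ) := by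
    have hkey := mul_setLIntegral_enorm_sq_le hu measurableSet_ball hG hdens
    have hofReal : ∀ s : Set E, ∫⁻ x in s, ‖u x‖ₑ ^ 2 ∂μ =
        ENNReal.ofReal (∫ x in s, ‖u x‖ ^ 2 ∂μ) := fun s => by
      rw [ofReal_integral_eq_lintegral_ofReal hui.integrableOn
        (Filter.Eventually.of_forall fun x => by positivity)]
      simp only [ENNReal.ofReal_pow (norm_nonneg _), ofReal_norm]
    have hDofReal : ∫⁻ x, ‖fderiv ℝ u x‖ₑ ^ 2 ∂μ =
        ENNReal.ofReal (∫ x, ‖fderiv ℝ u x‖ ^ 2 ∂μ) := by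
      rw [ofReal_integral_eq_lintegral_ofReal hDi
        (Filter.Eventually.of_forall fun x => by positivity)]
      simp only [ENNReal.ofReal_pow (norm_nonneg _), ofReal_norm]
    have hreal := ENNReal.toReal_mono (by rw [hofReal, hDofReal]; finiteness) hkey
    rw [hofReal, hofReal, hDofReal, ← hb, ← ENNReal.ofReal_pow hhpos.le,
      ← ENNReal.ofReal_mul (by positivity), ← ENNReal.ofReal_add (by positivity) (by positivity)]
      at hreal
    simp only [ENNReal.toReal_mul, ENNReal.toReal_div, ENNReal.toReal_ofNat] at hreal
    rw [ENNReal.toReal_ofReal (by positivity), ENNReal.toReal_ofReal (by positivity)] at hreal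
    have hbpos : 0 < b.toReal := ENNReal.toReal_pos hb0 hbtop
    refine le_of_mul_le_mul_left ?_ (half_pos hbpos)
    linarith
  have hpot : η * ∫ x in {x | η ≤ V x}, ‖u x‖ ^ 2 ∂μ ≤ ∫ x, V x * ‖u x‖ ^ 2 ∂μ := by
    rw [← integral_const_mul]
    refine (setIntegral_mono_on (hui.integrableOn.const_mul η) hVi.integrableOn hG
      fun x hx => ?_).trans (setIntegral_le_integral hVi (hnonneg.mono fun x hx => by positivity))
    exact mul_le_mul_of_nonneg_right hx (by positivity)
  have hpot' : 4 * ∫ x in {x | η ≤ V x}, ‖u x‖ ^ 2 ∂μ ≤ 4 / η * ∫ x, V x * ‖u x‖ ^ 2 ∂μ := by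
    rw [div_mul_eq_mul_div, le_div_iff₀ hη]
    linarith
  rw [← hhsq]
  linarith

/-- positivity of the quadratic form. Let `n ≥ 2`, `q, V : ℝⁿ → ℝ`
continuous with `V > 0` a.e., and suppose `q + m₀ V ≥ ε₀ |x|^(−2+δ)` for `|x| ≥ R₁`, where
`ε₀, δ, m₀, R₁ > 0`. Then there is `m₁ ≥ m₀` so that for all `m ≥ m₁` and all smooth
compactly supported `u : ℝⁿ → ℂ`,
`∫_{B_{R₁}(0)} |u|² ≤ ∫_{ℝⁿ} ((n−1)|Du|² + (q + m V)|u|²)`. -/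
theorem positivity_lemma
    (n : ℕ) (hn : 2 ≤ n)
    (q V : EuclideanSpace ℝ (Fin n) → ℝ)
    (hq_cont : Continuous q) (hV_cont : Continuous V)
    (hV_pos : ∀ᵐ x : EuclideanSpace ℝ (Fin n), 0 < V x)
    (ε₀ δ m₀ R₁ : ℝ) (hε₀ : 0 < ε₀) (hδ : 0 < δ) (hm₀ : 0 < m₀) (hR₁ : 0 < R₁)
    (hlower : ∀ x : EuclideanSpace ℝ (Fin n), R₁ ≤ ‖x‖ →
      ε₀ * ‖x‖ ^ (-2 + δ) ≤ q x + m₀ * V x) :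
    ∃ m₁ : ℝ, m₀ ≤ m₁ ∧ ∀ m : ℝ, m₁ ≤ m →
      ∀ u : EuclideanSpace ℝ (Fin n) → ℂ, ContDiff ℝ (⊤ : ℕ∞) u → HasCompactSupport u →
        ∫ x in Metric.ball (0 : EuclideanSpace ℝ (Fin n)) R₁, ‖u x‖ ^ 2 ≤
          ∫ x, ((n - 1 : ℝ) * ‖fderiv ℝ u x‖ ^ 2 + (q x + m * V x) * ‖u x‖ ^ 2) := by
  obtain ⟨K, hK⟩ := (isCompact_closedBall (0 : EuclideanSpace ℝ (Fin n)) R₁).bddBelow_image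
    (hq_cont.add (continuous_const.mul hV_cont) :
      Continuous fun x => q x + m₀ * V x).continuousOn
  set L : ℝ := |K| + 1 with hL
  have hLpos : 0 < L := by positivity
  obtain ⟨C, hC0, hC⟩ := exists_setIntegral_norm_sq_le (F := ℂ) hV_cont hV_pos R₁
    (inv_pos.2 hLpos)
  refine ⟨m₀ + L * C, le_add_of_nonneg_right (by positivity), fun m hm u hu hsupp => ?_⟩
  have hu1 : ContDiff ℝ 1 u := hu.of_le (by exact_mod_cast le_top)
  have hball := hC u hu1 hsupp
  have hcont : Continuous u := hu1.continuous
  have hD : Continuous (fderiv ℝ u) := hu1.continuous_fderiv one_ne_zero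
  have husupp : HasCompactSupport fun x => ‖u x‖ ^ 2 :=
    hsupp.comp_left (g := fun y => ‖y‖ ^ 2) (by simp)
  have hui : Integrable fun x => ‖u x‖ ^ 2 :=
    (by fun_prop : Continuous fun x => ‖u x‖ ^ 2).integrable_of_hasCompactSupport husupp
  have hDi : Integrable fun x => ‖fderiv ℝ u x‖ ^ 2 :=
    (by fun_prop : Continuous fun x => ‖fderiv ℝ u x‖ ^ 2).integrable_of_hasCompactSupport
      ((hsupp.fderiv ℝ).comp_left (g := fun y => ‖y‖ ^ 2) (by simp))
  have hVi : Integrable fun x => V x * ‖u x‖ ^ 2 :=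
    (by fun_prop : Continuous fun x => V x * ‖u x‖ ^ 2).integrable_of_hasCompactSupport
      husupp.mul_left
  have hqi : Integrable fun x => (q x + m * V x) * ‖u x‖ ^ 2 :=
    (by fun_prop : Continuous fun x =>
      (q x + m * V x) * ‖u x‖ ^ 2).integrable_of_hasCompactSupport husupp.mul_left
  have hn1 : (1 : ℝ) ≤ (n : ℝ) - 1 := by
    have : (2 : ℝ) ≤ n := by exact_mod_cast hn
    linarith
  have hindi : Integrable
      ((Metric.ball (0 : EuclideanSpace ℝ (Fin n)) R₁).indicator fun x => ‖u x‖ ^ 2) :=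
    hui.indicator measurableSet_ball
  have hdiff : Integrable fun x => L * C * (V x * ‖u x‖ ^ 2) - |K| *
      (Metric.ball (0 : EuclideanSpace ℝ (Fin n)) R₁).indicator (fun x => ‖u x‖ ^ 2) x :=
    (hVi.const_mul _).sub (hindi.const_mul _)
  have hlow : ∫ x, (‖fderiv ℝ u x‖ ^ 2 + (L * C * (V x * ‖u x‖ ^ 2) - |K| *
      (Metric.ball (0 : EuclideanSpace ℝ (Fin n)) R₁).indicator (fun x => ‖u x‖ ^ 2) x)) ≤
      ∫ x, ((n - 1 : ℝ) * ‖fderiv ℝ u x‖ ^ 2 + (q x + m * V x) * ‖u x‖ ^ 2) := by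
    refine integral_mono_ae (hDi.add hdiff) ((hDi.const_mul _).add hqi) (hV_pos.mono fun x hx => ?_)
    have hgrad : ‖fderiv ℝ u x‖ ^ 2 ≤ (n - 1 : ℝ) * ‖fderiv ℝ u x‖ ^ 2 :=
      le_mul_of_one_le_left (by positivity) hn1
    have hmV : L * C * V x ≤ (m - m₀) * V x :=
      mul_le_mul_of_nonneg_right (by linarith) hx.le
    refine add_le_add hgrad ?_
    by_cases hxR : x ∈ Metric.ball (0 : EuclideanSpace ℝ (Fin n)) R₁
    · have hKx : K ≤ q x + m₀ * V x :=
        hK (Set.mem_image_of_mem _ (Metric.ball_subset_closedBall hxR))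
      rw [Set.indicator_of_mem hxR, ← mul_assoc, ← sub_mul]
      refine mul_le_mul_of_nonneg_right ?_ (by positivity)
      linarith [neg_abs_le K]
    · have hlx := hlower x (by simpa using hxR)
      have hrx : 0 ≤ ε₀ * ‖x‖ ^ (-2 + δ) := by positivity
      rw [Set.indicator_of_notMem hxR, mul_zero, sub_zero, ← mul_assoc]
      exact mul_le_mul_of_nonneg_right (by linarith) (by positivity)
  rw [integral_add hDi hdiff, integral_sub (hVi.const_mul _) (hindi.const_mul _),
    integral_const_mul, integral_const_mul,
    integral_indicator measurableSet_ball] at hlow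
  have hscaled := mul_le_mul_of_nonneg_left hball hLpos.le
  rw [mul_add, ← mul_assoc, ← mul_assoc, mul_inv_cancel₀ hLpos.ne', one_mul, hL] at hscaled
  rw [hL] at hlow
  linarith
end

section
/- Let n ≥ 2, let a^{ij} : ℝⁿ → ℝ (1 ≤ i, j ≤ n) be smooth symmetric uniformly elliptic coefficients with all derivatives bounded, and c : ℝⁿ → ℝ smooth with all derivatives bounded; set A u = −∑_{i,j} ∂_i(a^{ij} ∂_j u) + c u. Assume: (i) (positivity of the quadratic form) there is R₁ > 0 such that ∫_{B_{R₁}(0)} |u|² ≤ ∫_{ℝⁿ} ( ∑_{i,j} a^{ij} ∂_i ū ∂_j u + c |u|² ) for all smooth compactly supported u : ℝⁿ → ℂ; (ii) there are constants ε₀, δ > 0 with c(x) ≥ ε₀ |x|^{−2+δ} for all |x| ≥ R₁. Let f : ℝⁿ → ℂ be a smooth solution of A f = 0 such that for every m ∈ ℕ there are constants C_m, N_m with ∑_{|α| ≤ m} |D^α f(x)| ≤ C_m (1 + |x|)^{N_m} for all x. Then f ≡ 0. -/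
open MeasureTheory

/-- The integral of a directional derivative of a compactly supported `C¹` function vanishes. -/
theorem integral_fderiv_apply_eq_zero {n : ℕ} {W : EuclideanSpace ℝ (Fin n) → ℂ}
    (hW : ContDiff ℝ 1 W) (hWc : HasCompactSupport W) (v : EuclideanSpace ℝ (Fin n)) :
    ∫ x, fderiv ℝ W x v = 0 := by
  have hW' : Integrable (fun x => fderiv ℝ W x v) :=
    ((hW.continuous_fderiv one_ne_zero).clm_apply continuous_const).integrable_of_hasCompactSupport
      (hWc.fderiv_apply (𝕜 := ℝ) v)
  have h := integral_smul_fderiv_eq_neg_fderiv_smul_of_integrable (μ := volume)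
    (f := fun _ : EuclideanSpace ℝ (Fin n) => (1 : ℝ)) (g := W) (v := v)
    (by simp) (by simpa using hW')
    (by simpa using hW.continuous.integrable_of_hasCompactSupport hWc)
    (fun _ _ => differentiableAt_const _) (fun x _ => hW.differentiable one_ne_zero x)
  simpa using h

/-- For a solution `f` of `A f = 0` and a real cutoff `η`, the quadratic form of `A` at `η f`
only sees the gradient of `η`. -/
theorem integral_form_cutoff_mul_solution {n : ℕ}
    {a : Fin n → Fin n → EuclideanSpace ℝ (Fin n) → ℝ}
    (ha_smooth : ∀ i j, ContDiff ℝ (⊤ : ℕ∞) (a i j))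
    (ha_symm : ∀ i j x, a i j x = a j i x)
    {c : EuclideanSpace ℝ (Fin n) → ℝ}
    {f : EuclideanSpace ℝ (Fin n) → ℂ} (hf_smooth : ContDiff ℝ (⊤ : ℕ∞) f)
    (hf_eq : ∀ x, -(∑ i, ∑ j, fderiv ℝ
          (fun y => (a i j y : ℂ) * fderiv ℝ f y (EuclideanSpace.single j 1)) x
          (EuclideanSpace.single i 1)) + (c x : ℂ) * f x = 0)
    {η : EuclideanSpace ℝ (Fin n) → ℝ} (hη : ContDiff ℝ (⊤ : ℕ∞) η) (hηc : HasCompactSupport η) :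
    ∫ x, ((∑ i, ∑ j, (a i j x : ℂ) *
            (starRingEnd ℂ (fderiv ℝ (fun y => (η y : ℂ) * f y) x (EuclideanSpace.single i 1)) *
              fderiv ℝ (fun y => (η y : ℂ) * f y) x (EuclideanSpace.single j 1))).re
          + c x * ‖(η x : ℂ) * f x‖ ^ 2) =
      ∫ x, (∑ i, ∑ j, a i j x * fderiv ℝ η x (EuclideanSpace.single i 1) *
          fderiv ℝ η x (EuclideanSpace.single j 1)) * ‖f x‖ ^ 2 := by
  let e : Fin n → EuclideanSpace ℝ (Fin n) := fun i => EuclideanSpace.single i 1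
  let Y : Fin n → Fin n → EuclideanSpace ℝ (Fin n) → ℂ :=
    fun i j y => (a i j y : ℂ) * fderiv ℝ f y (e j)
  let W : Fin n → Fin n → EuclideanSpace ℝ (Fin n) → ℂ :=
    fun i j y => ((η y : ℂ) * (η y : ℂ) * starRingEnd ℂ (f y)) * Y i j y
  have hηC : ContDiff ℝ (⊤ : ℕ∞) (fun y => (η y : ℂ)) := Complex.ofRealCLM.contDiff.comp hη
  have hconj : ContDiff ℝ (⊤ : ℕ∞) (fun y => starRingEnd ℂ (f y)) :=
    Complex.conjCLE.contDiff.comp hf_smooth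
  have hY : ∀ i j, ContDiff ℝ (⊤ : ℕ∞) (Y i j) := fun i j =>
    (Complex.ofRealCLM.contDiff.comp (ha_smooth i j)).mul
      ((hf_smooth.fderiv_right (m := (⊤ : ℕ∞)) (by simp)).clm_apply contDiff_const)
  have hW : ∀ i j, ContDiff ℝ (⊤ : ℕ∞) (W i j) := fun i j =>
    ((hηC.mul hηC).mul hconj).mul (hY i j)
  have hWc : ∀ i j, HasCompactSupport (W i j) := fun i j => by
    refine hηc.mono' ((Function.support_subset_iff'.2 fun x hx => ?_).trans subset_closure)
    simp [W, Function.notMem_support.1 hx]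
  have hW0 : ∀ i j, ∫ x, fderiv ℝ (W i j) x (e i) = 0 := fun i j =>
    integral_fderiv_apply_eq_zero ((hW i j).of_le (by simp)) (hWc i j) _
  have hWi : ∀ i j, Integrable (fun x => fderiv ℝ (W i j) x (e i)) := fun i j =>
    (((hW i j).continuous_fderiv (by simp)).clm_apply
      continuous_const).integrable_of_hasCompactSupport ((hWc i j).fderiv_apply (𝕜 := ℝ) _)
  have hpt : ∀ x, (∑ i, ∑ j, (a i j x : ℂ) *
            (starRingEnd ℂ (fderiv ℝ (fun y => (η y : ℂ) * f y) x (e i)) *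
              fderiv ℝ (fun y => (η y : ℂ) * f y) x (e j))).re
          + c x * ‖(η x : ℂ) * f x‖ ^ 2 =
      (∑ i, ∑ j, a i j x * fderiv ℝ η x (e i) * fderiv ℝ η x (e j)) * ‖f x‖ ^ 2
        + (∑ i, ∑ j, fderiv ℝ (W i j) x (e i)).re := by
    intro x
    have dη : HasFDerivAt (fun y => (η y : ℂ)) (Complex.ofRealCLM.comp (fderiv ℝ η x)) x :=
      Complex.ofRealCLM.hasFDerivAt.comp x (hη.differentiable (by simp) x).hasFDerivAt
    have df := (hf_smooth.differentiable (by simp) x).hasFDerivAt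
    have dconj : HasFDerivAt (fun y => starRingEnd ℂ (f y))
        ((Complex.conjCLE : ℂ →L[ℝ] ℂ).comp (fderiv ℝ f x)) x :=
      (Complex.conjCLE : ℂ →L[ℝ] ℂ).hasFDerivAt.comp x df
    have dY := fun i j => ((hY i j).differentiable (by simp) x).hasFDerivAt
    have hu : ∀ i, fderiv ℝ (fun y => (η y : ℂ) * f y) x (e i) =
        (fderiv ℝ η x (e i) : ℂ) * f x + η x * fderiv ℝ f x (e i) := by
      intro i
      rw [show fderiv ℝ (fun y => (η y : ℂ) * f y) x = _ from (dη.mul df).fderiv]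
      simp; ring
    have hWd : ∀ i j, fderiv ℝ (W i j) x (e i) =
        2 * η x * fderiv ℝ η x (e i) * starRingEnd ℂ (f x) * (a i j x * fderiv ℝ f x (e j))
        + η x ^ 2 * starRingEnd ℂ (fderiv ℝ f x (e i)) * (a i j x * fderiv ℝ f x (e j))
        + η x ^ 2 * starRingEnd ℂ (f x) * fderiv ℝ (Y i j) x (e i) := by
      intro i j
      rw [show fderiv ℝ (W i j) x = _ from (((dη.mul dη).mul dconj).mul (dY i j)).fderiv]
      simp [Y]; ring
    have heq : ∑ i, ∑ j, fderiv ℝ (Y i j) x (e i) = (c x : ℂ) * f x := by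
      linear_combination -hf_eq x
    have hdiv : ∑ i, ∑ j, (η x ^ 2 * starRingEnd ℂ (f x) * fderiv ℝ (Y i j) x (e i)).re
        = c x * (η x ^ 2 * ‖f x‖ ^ 2) := by
      simp_rw [← Complex.re_sum, ← Finset.mul_sum]
      rw [heq, show (η x : ℂ) ^ 2 * starRingEnd ℂ (f x) * ((c x : ℂ) * f x) =
        ((c x * (η x ^ 2 * ‖f x‖ ^ 2) : ℝ) : ℂ) by
          push_cast; rw [← Complex.conj_mul' (f x)]; ring, Complex.ofReal_re]
    have hanti : ∑ i, ∑ j, a i j x * η x * fderiv ℝ η x (e j) *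
          (starRingEnd ℂ (f x) * fderiv ℝ f x (e i)).re =
        ∑ i, ∑ j, a i j x * η x * fderiv ℝ η x (e i) *
          (starRingEnd ℂ (f x) * fderiv ℝ f x (e j)).re := by
      rw [Finset.sum_comm]
      simp_rw [fun i j => ha_symm i j x]
    have hterm : ∀ i j, ((a i j x : ℂ) *
            (starRingEnd ℂ (fderiv ℝ (fun y => (η y : ℂ) * f y) x (e i)) *
              fderiv ℝ (fun y => (η y : ℂ) * f y) x (e j))).re
        = a i j x * fderiv ℝ η x (e i) * fderiv ℝ η x (e j) * ‖f x‖ ^ 2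
          + (fderiv ℝ (W i j) x (e i)).re
          + a i j x * η x * fderiv ℝ η x (e j) * (starRingEnd ℂ (f x) * fderiv ℝ f x (e i)).re
          - a i j x * η x * fderiv ℝ η x (e i) * (starRingEnd ℂ (f x) * fderiv ℝ f x (e j)).re
          - (η x ^ 2 * starRingEnd ℂ (f x) * fderiv ℝ (Y i j) x (e i)).re := by
      intro i j
      rw [hu, hu, hWd, ← Complex.normSq_eq_norm_sq, Complex.normSq_apply]
      simp only [Complex.add_re, Complex.mul_re, Complex.add_im, Complex.mul_im, map_add, map_mul,
        Complex.conj_re, Complex.conj_im, Complex.ofReal_re, Complex.ofReal_im, Complex.conj_ofReal,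
        pow_two, Complex.re_ofNat, Complex.im_ofNat]
      ring
    simp_rw [Complex.re_sum, hterm, Finset.sum_sub_distrib, Finset.sum_add_distrib]
    rw [hdiv, hanti, norm_mul, mul_pow, Complex.norm_real, Real.norm_eq_abs, sq_abs]
    simp_rw [Finset.sum_mul]
    ring
  have hP : Integrable fun x => (∑ i, ∑ j, a i j x * fderiv ℝ η x (e i) * fderiv ℝ η x (e j)) *
      ‖f x‖ ^ 2 := by
    have hd : ∀ i, Continuous fun x => fderiv ℝ η x (e i) := fun i =>
      (hη.continuous_fderiv (by simp)).clm_apply continuous_const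
    refine Continuous.integrable_of_hasCompactSupport ?_ ?_
    · exact (continuous_finsetSum _ fun i _ => continuous_finsetSum _ fun j _ =>
        ((ha_smooth i j).continuous.mul (hd i)).mul (hd j)).mul (hf_smooth.continuous.norm.pow 2)
    · refine (hηc.fderiv (𝕜 := ℝ)).mono
        (Function.support_subset_iff'.2 fun x hx => ?_)
      simp [Function.notMem_support.1 hx]
  have hS : Integrable fun x => ∑ i, ∑ j, fderiv ℝ (W i j) x (e i) :=
    integrable_finsetSum _ fun i _ => integrable_finsetSum _ fun j _ => hWi i j
  change ∫ x, ((∑ i, ∑ j, (a i j x : ℂ) *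
            (starRingEnd ℂ (fderiv ℝ (fun y => (η y : ℂ) * f y) x (e i)) *
              fderiv ℝ (fun y => (η y : ℂ) * f y) x (e j))).re
          + c x * ‖(η x : ℂ) * f x‖ ^ 2) = _
  simp_rw [hpt]
  refine (integral_add hP hS.re).trans ?_
  rw [integral_re hS]
  rw [integral_finsetSum _ fun i _ => integrable_finsetSum _ fun j _ => hWi i j]
  simp_rw [integral_finsetSum _ fun j _ => hWi _ j, hW0]
  simp [e]

/-- The Hermitian extension of an elliptic real form is nonnegative. -/
theorem re_sum_conj_mul_nonneg {n : ℕ} {b : Fin n → Fin n → ℝ}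
    (hb : ∀ ξ : EuclideanSpace ℝ (Fin n), 0 ≤ ∑ i, ∑ j, b i j * ξ i * ξ j) (z : Fin n → ℂ) :
    0 ≤ (∑ i, ∑ j, (b i j : ℂ) * (starRingEnd ℂ (z i) * z j)).re := by
  have h₁ := hb (WithLp.toLp 2 fun i => (z i).re)
  have h₂ := hb (WithLp.toLp 2 fun i => (z i).im)
  refine (add_nonneg h₁ h₂).trans_eq ?_
  simp_rw [Complex.re_sum, ← Finset.sum_add_distrib]
  refine Finset.sum_congr rfl fun i _ => Finset.sum_congr rfl fun j _ => ?_
  simp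
  ring

/-- An upper ellipticity bound, evaluated on the coordinates of a continuous linear form. -/
theorem sum_mul_apply_single_le {n : ℕ} {b : Fin n → Fin n → ℝ} {l : ℝ} (hl : 0 ≤ l)
    (hb : ∀ ξ : EuclideanSpace ℝ (Fin n), ∑ i, ∑ j, b i j * ξ i * ξ j ≤ l * ‖ξ‖ ^ 2)
    (L : EuclideanSpace ℝ (Fin n) →L[ℝ] ℝ) :
    ∑ i, ∑ j, b i j * L (EuclideanSpace.single i 1) * L (EuclideanSpace.single j 1) ≤
      l * (n * ‖L‖ ^ 2) := by
  refine (hb (WithLp.toLp 2 fun i => L (EuclideanSpace.single i 1))).trans ?_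
  refine mul_le_mul_of_nonneg_left ?_ hl
  rw [EuclideanSpace.norm_sq_eq]
  calc ∑ i : Fin n, ‖L (EuclideanSpace.single i 1)‖ ^ 2 ≤ ∑ _i : Fin n, ‖L‖ ^ 2 := by
        gcongr with i
        simpa using L.le_opNorm (EuclideanSpace.single i 1)
    _ = n * ‖L‖ ^ 2 := by simp

/-- A nonnegative monotone function of polynomial growth with `J ρ ≤ C ρ⁻ˢ J (2ρ)`, `s > 0`,
vanishes. -/
theorem eq_zero_of_le_rpow_mul_two_mul {J : ℝ → ℝ} (hJ : Monotone J) (hJ₀ : ∀ ρ, 0 ≤ J ρ)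
    {ρ₀ B p C s : ℝ} (hρ₀ : 0 < ρ₀) (hC : 0 ≤ C) (hs : 0 < s)
    (hgrowth : ∀ ρ, ρ₀ ≤ ρ → J ρ ≤ B * ρ ^ p)
    (hdouble : ∀ ρ, ρ₀ ≤ ρ → J ρ ≤ C * ρ ^ (-s) * J (2 * ρ)) (ρ : ℝ) : J ρ = 0 := by
  have hiter : ∀ k : ℕ, ∃ A, ∀ ρ, ρ₀ ≤ ρ → J ρ ≤ A * ρ ^ (p - s * k) := by
    intro k
    induction k with
    | zero => exact ⟨B, by simpa using hgrowth⟩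
    | succ k ih =>
      obtain ⟨A, hA⟩ := ih
      refine ⟨C * A * 2 ^ (p - s * k), fun ρ hρ => (hdouble ρ hρ).trans ?_⟩
      have hρ' : 0 < ρ := hρ₀.trans_le hρ
      calc C * ρ ^ (-s) * J (2 * ρ) ≤ C * ρ ^ (-s) * (A * (2 * ρ) ^ (p - s * k)) := by
            gcongr
            exact hA _ (by linarith)
        _ = C * A * 2 ^ (p - s * k) * (ρ ^ (-s) * ρ ^ (p - s * k)) := by
            rw [Real.mul_rpow zero_le_two hρ'.le]; ring
        _ = _ := by
            rw [← Real.rpow_add hρ']; push_cast; ring_nf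
  obtain ⟨k, hk⟩ := exists_nat_gt (p / s)
  obtain ⟨A, hA⟩ := hiter k
  have hk' : 0 < s * k - p := by
    rw [div_lt_iff₀ hs] at hk; linarith
  have hlim : Filter.Tendsto (fun t : ℝ => A * t ^ (p - s * k)) Filter.atTop (nhds 0) := by
    simpa using (tendsto_rpow_neg_atTop hk').const_mul A
  refine le_antisymm (ge_of_tendsto hlim ?_) (hJ₀ ρ)
  filter_upwards [Filter.eventually_ge_atTop ρ, Filter.eventually_ge_atTop ρ₀] with t h₁ h₂
  exact (hJ h₁).trans (hA t h₂)

/-- There are cutoffs equal to `1` on `B_ρ` and supported in `B_{2ρ}` with gradient `O(1/ρ)`. -/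
theorem exists_smooth_cutoff (n : ℕ) : ∃ K : ℝ, 0 ≤ K ∧ ∀ ρ : ℝ, 0 < ρ →
    ∃ η : EuclideanSpace ℝ (Fin n) → ℝ, ContDiff ℝ (⊤ : ℕ∞) η ∧ HasCompactSupport η ∧
      (∀ x ∈ Metric.closedBall 0 ρ, η x = 1) ∧ (∀ x, ‖fderiv ℝ η x‖ ≤ K / ρ) ∧
      ∀ x ∉ Metric.closedBall 0 (2 * ρ), fderiv ℝ η x = 0 := by
  let χ : ContDiffBump (0 : EuclideanSpace ℝ (Fin n)) := ⟨1, 2, one_pos, one_lt_two⟩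
  have hχ : ContDiff ℝ (⊤ : ℕ∞) χ := χ.contDiff
  obtain ⟨K, hK⟩ := (hχ.continuous_fderiv (by simp)).bounded_above_of_compact_support
    (χ.hasCompactSupport.fderiv (𝕜 := ℝ))
  refine ⟨K, (norm_nonneg _).trans (hK 0), fun ρ hρ => ⟨fun x => χ (ρ⁻¹ • x), ?_, ?_, ?_, ?_, ?_⟩⟩
  · exact hχ.comp (contDiff_const_smul _)
  · exact χ.hasCompactSupport.comp_smul (inv_ne_zero hρ.ne')
  · intro x hx
    refine χ.one_of_mem_closedBall ?_
    rw [mem_closedBall_zero_iff] at hx ⊢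
    rw [norm_smul, norm_inv, Real.norm_of_nonneg hρ.le, inv_mul_le_iff₀ hρ]
    simpa [χ] using hx
  · intro x
    rw [fderiv_comp_smul, norm_smul, norm_inv, Real.norm_of_nonneg hρ.le, inv_mul_eq_div]
    gcongr
    exact hK _
  · intro x hx
    rw [fderiv_comp_smul, fderiv_of_notMem_tsupport, smul_zero]
    rw [χ.tsupport_eq, mem_closedBall_zero_iff, norm_smul, norm_inv, Real.norm_of_nonneg hρ.le,
      inv_mul_le_iff₀ hρ]
    rw [mem_closedBall_zero_iff] at hx
    simpa [χ, mul_comm] using hx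

/-- If the quadratic form dominates the `L²`-norm on `B_R`, then a multiple of it dominates the
potential energy for `c` raised by the constant `T` on `B_R`. -/
theorem integral_indicator_add_potential_le {n : ℕ}
    {a : Fin n → Fin n → EuclideanSpace ℝ (Fin n) → ℝ}
    (ha : ∀ i j, Continuous (a i j))
    (ha_nonneg : ∀ x ξ : EuclideanSpace ℝ (Fin n), 0 ≤ ∑ i, ∑ j, a i j x * ξ i * ξ j)
    {c : EuclideanSpace ℝ (Fin n) → ℝ} (hc : Continuous c) {R T : ℝ} (hT : 0 ≤ T)
    {u : EuclideanSpace ℝ (Fin n) → ℂ} (hu : ContDiff ℝ (⊤ : ℕ∞) u) (huc : HasCompactSupport u)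
    (hform : ∫ x in Metric.ball (0 : EuclideanSpace ℝ (Fin n)) R, ‖u x‖ ^ 2 ≤
        ∫ x, ((∑ i, ∑ j, (a i j x : ℂ) *
            (starRingEnd ℂ (fderiv ℝ u x (EuclideanSpace.single i 1)) *
              fderiv ℝ u x (EuclideanSpace.single j 1))).re
          + c x * ‖u x‖ ^ 2)) :
    Integrable (fun x => ((Metric.ball 0 R).indicator (fun _ => T) x + c x) * ‖u x‖ ^ 2) ∧
    ∫ x, ((Metric.ball 0 R).indicator (fun _ => T) x + c x) * ‖u x‖ ^ 2 ≤
      (T + 1) * ∫ x, ((∑ i, ∑ j, (a i j x : ℂ) *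
            (starRingEnd ℂ (fderiv ℝ u x (EuclideanSpace.single i 1)) *
              fderiv ℝ u x (EuclideanSpace.single j 1))).re
          + c x * ‖u x‖ ^ 2) := by
  have hu2 : Continuous fun x => ‖u x‖ ^ 2 := hu.continuous.norm.pow 2
  have hsupp : ∀ g : EuclideanSpace ℝ (Fin n) → ℝ, (∀ x, u x = 0 → g x = 0) →
      HasCompactSupport g := fun g hg =>
    huc.mono (Function.support_subset_iff'.2 fun x hx => hg x (Function.notMem_support.1 hx))
  have hi : Integrable fun x => ‖u x‖ ^ 2 :=
    hu2.integrable_of_hasCompactSupport (hsupp _ fun x hx => by simp [hx])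
  have hci : Integrable fun x => c x * ‖u x‖ ^ 2 :=
    (hc.mul hu2).integrable_of_hasCompactSupport (hsupp _ fun x hx => by simp [hx])
  have hd : ∀ i : Fin n, Continuous fun x => fderiv ℝ u x (EuclideanSpace.single i 1) := fun i =>
    (hu.continuous_fderiv (by simp)).clm_apply continuous_const
  have hgi : Integrable fun x => (∑ i, ∑ j, (a i j x : ℂ) *
            (starRingEnd ℂ (fderiv ℝ u x (EuclideanSpace.single i 1)) *
              fderiv ℝ u x (EuclideanSpace.single j 1))).re := by
    refine Continuous.integrable_of_hasCompactSupport ?_ ?_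
    · exact Complex.continuous_re.comp <|
        continuous_finsetSum _ fun i _ => continuous_finsetSum _ fun j _ =>
          (Complex.continuous_ofReal.comp (ha i j)).mul
            ((Complex.continuous_conj.comp (hd i)).mul (hd j))
    · refine (huc.fderiv (𝕜 := ℝ)).mono (Function.support_subset_iff'.2 fun x hx => ?_)
      simp [Function.notMem_support.1 hx]
  have hind : Integrable ((Metric.ball 0 R).indicator fun x => ‖u x‖ ^ 2) :=
    hi.indicator measurableSet_ball
  have hsplit : (fun x => ((Metric.ball 0 R).indicator (fun _ => T) x + c x) * ‖u x‖ ^ 2) =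
      fun x => T * (Metric.ball 0 R).indicator (fun x => ‖u x‖ ^ 2) x + c x * ‖u x‖ ^ 2 := by
    funext x
    by_cases hx : x ∈ Metric.ball 0 R <;> simp only [Set.indicator, hx, if_true, if_false] <;> ring
  rw [hsplit]
  refine ⟨(hind.const_mul T).add hci, ?_⟩
  rw [integral_add (hind.const_mul T) hci, integral_const_mul,
    integral_indicator measurableSet_ball, add_mul, one_mul]
  refine add_le_add (mul_le_mul_of_nonneg_left hform hT)
    (integral_mono hci (hgi.add hci) fun x => ?_)
  exact le_add_of_nonneg_left (re_sum_conj_mul_nonneg (ha_nonneg x) _)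

/-- A zero order term `c ≥ ε₀ |x|^(−2+δ)` outside a ball, with `T + c ≥ 1` inside, is
bounded below by a multiple of `ρ^(−2+s)` on large balls `B_ρ`, for some `s > 0`. -/
theorem exists_rpow_le_indicator_add {E : Type*} [NormedAddCommGroup E] {c : E → ℝ}
    {R T ε₀ δ : ℝ} (hR : 0 < R) (hε₀ : 0 < ε₀) (hδ : 0 < δ) (hT : ∀ x, 1 ≤ T + c x)
    (hc_lower : ∀ x, R ≤ ‖x‖ → ε₀ * ‖x‖ ^ (-2 + δ) ≤ c x) :
    ∃ κ s : ℝ, 0 < κ ∧ 0 < s ∧ ∀ ρ, max 1 R ≤ ρ → ∀ x ∈ Metric.closedBall (0 : E) ρ,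
      κ * ρ ^ (-2 + s) ≤ (Metric.ball 0 R).indicator (fun _ => T) x + c x := by
  have hsδ : 0 ≤ δ - min δ 2 := sub_nonneg.2 (min_le_left _ _)
  have hs2 : -2 + min δ 2 ≤ 0 := by linarith [min_le_right δ 2]
  refine ⟨min 1 (ε₀ * R ^ (δ - min δ 2)), min δ 2, by positivity, by positivity,
    fun ρ hρ x hx => ?_⟩
  have hρ1 : 1 ≤ ρ := (le_max_left _ _).trans hρ
  rw [mem_closedBall_zero_iff] at hx
  by_cases hxR : x ∈ Metric.ball 0 R
  · rw [Set.indicator_of_mem hxR]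
    refine le_trans ?_ (hT x)
    exact mul_le_one₀ (min_le_left _ _) (by positivity)
      (Real.rpow_le_one_of_one_le_of_nonpos hρ1 hs2)
  · rw [Set.indicator_of_notMem hxR, zero_add]
    rw [mem_ball_zero_iff, not_lt] at hxR
    have hx0 : 0 < ‖x‖ := hR.trans_le hxR
    calc min 1 (ε₀ * R ^ (δ - min δ 2)) * ρ ^ (-2 + min δ 2)
        ≤ (ε₀ * ‖x‖ ^ (δ - min δ 2)) * ‖x‖ ^ (-2 + min δ 2) := by
          refine mul_le_mul ((min_le_right _ _).trans ?_)
            (Real.rpow_le_rpow_of_nonpos hx0 hx hs2) (by positivity) (by positivity)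
          gcongr
      _ = ε₀ * ‖x‖ ^ (-2 + δ) := by
          rw [mul_assoc, ← Real.rpow_add hx0]; ring_nf
      _ ≤ c x := hc_lower x hxR

/-- The `L²`-mass on balls of a function of polynomial growth grows polynomially. -/
theorem setIntegral_norm_sq_closedBall_le {n : ℕ} {f : EuclideanSpace ℝ (Fin n) → ℂ} {C : ℝ} {N : ℕ}
    (hf : ∀ x, ‖f x‖ ≤ C * (1 + ‖x‖) ^ N) : ∃ B p : ℝ, ∀ ρ, 1 ≤ ρ →
      ∫ x in Metric.closedBall (0 : EuclideanSpace ℝ (Fin n)) ρ, ‖f x‖ ^ 2 ≤ B * ρ ^ p := by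
  have hC : 0 ≤ C := by simpa using (norm_nonneg _).trans (hf 0)
  refine ⟨(C * 2 ^ N) ^ 2 * volume.real (Metric.ball (0 : EuclideanSpace ℝ (Fin n)) 1),
    ((2 * N + n : ℕ) : ℝ), fun ρ hρ => ?_⟩
  have hvol : volume.real (Metric.closedBall (0 : EuclideanSpace ℝ (Fin n)) ρ) =
      ρ ^ n * volume.real (Metric.ball (0 : EuclideanSpace ℝ (Fin n)) 1) := by
    simpa using Measure.addHaar_real_closedBall (volume : Measure (EuclideanSpace ℝ (Fin n))) 0
      (zero_le_one.trans hρ)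
  refine (Real.le_norm_self _).trans ((norm_setIntegral_le_of_norm_le_const (C := (C * (2 * ρ) ^ N) ^ 2)
    measure_closedBall_lt_top fun x hx => ?_).trans_eq ?_)
  · rw [mem_closedBall_zero_iff] at hx
    rw [norm_pow, norm_norm]
    gcongr
    refine (hf x).trans ?_
    gcongr
    linarith
  · rw [hvol, Real.rpow_natCast]
    ring

/-- positivity of the eigenvalues, zero eigenvalue excluded. Let
`A u = −∑ᵢⱼ ∂ᵢ(aⁱʲ ∂ⱼ u) + c u` be uniformly elliptic on `ℝⁿ` (`n ≥ 2`) with smooth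
symmetric coefficients with bounded derivatives. Assume (i) the quadratic form of `A`
dominates the `L²`-norm on the ball `B_{R₁}(0)`, i.e.
`∫_{B_{R₁}} |u|² ≤ ∫ (∑ᵢⱼ aⁱʲ ∂ᵢū ∂ⱼu + c |u|²)` for smooth compactly supported `u`, and
(ii) `c(x) ≥ ε₀ |x|^(−2+δ)` for `|x| ≥ R₁`. If `f` is a smooth solution of `A f = 0` all of
whose derivatives grow at most polynomially, then `f ≡ 0`. -/
theorem zero_is_not_an_eigenvalue
    (n : ℕ) (hn : 2 ≤ n)
    (a : Fin n → Fin n → EuclideanSpace ℝ (Fin n) → ℝ)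
    (ha_smooth : ∀ i j, ContDiff ℝ (⊤ : ℕ∞) (a i j))
    (ha_symm : ∀ i j x, a i j x = a j i x)
    (ha_bdd : ∀ i j m, ∃ C : ℝ, ∀ x, ‖iteratedFDeriv ℝ m (a i j) x‖ ≤ C)
    (l₀ l₁ : ℝ) (hl₀ : 0 < l₀) (hl₀₁ : l₀ ≤ l₁)
    (hell : ∀ x ξ : EuclideanSpace ℝ (Fin n),
      l₀ * ‖ξ‖ ^ 2 ≤ ∑ i, ∑ j, a i j x * ξ i * ξ j ∧
      ∑ i, ∑ j, a i j x * ξ i * ξ j ≤ l₁ * ‖ξ‖ ^ 2)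
    (c : EuclideanSpace ℝ (Fin n) → ℝ)
    (hc_smooth : ContDiff ℝ (⊤ : ℕ∞) c)
    (hc_bdd : ∀ m, ∃ C : ℝ, ∀ x, ‖iteratedFDeriv ℝ m c x‖ ≤ C)
    (R₁ : ℝ) (hR₁ : 0 < R₁)
    (hform : ∀ u : EuclideanSpace ℝ (Fin n) → ℂ, ContDiff ℝ (⊤ : ℕ∞) u → HasCompactSupport u →
      ∫ x in Metric.ball (0 : EuclideanSpace ℝ (Fin n)) R₁, ‖u x‖ ^ 2 ≤
        ∫ x, ((∑ i, ∑ j, (a i j x : ℂ) *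
            (starRingEnd ℂ (fderiv ℝ u x (EuclideanSpace.single i 1)) *
              fderiv ℝ u x (EuclideanSpace.single j 1))).re
          + c x * ‖u x‖ ^ 2))
    (ε₀ δ : ℝ) (hε₀ : 0 < ε₀) (hδ : 0 < δ)
    (hc_lower : ∀ x : EuclideanSpace ℝ (Fin n), R₁ ≤ ‖x‖ → ε₀ * ‖x‖ ^ (-2 + δ) ≤ c x)
    (f : EuclideanSpace ℝ (Fin n) → ℂ) (hf_smooth : ContDiff ℝ (⊤ : ℕ∞) f)
    (hf_eq : ∀ x, -(∑ i, ∑ j, fderiv ℝ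
          (fun y => (a i j y : ℂ) * fderiv ℝ f y (EuclideanSpace.single j 1)) x
          (EuclideanSpace.single i 1)) + (c x : ℂ) * f x = 0)
    (hf_growth : ∀ m : ℕ, ∃ C : ℝ, ∃ N : ℕ, ∀ x,
      ∑ i ∈ Finset.range (m + 1), ‖iteratedFDeriv ℝ i f x‖ ≤ C * (1 + ‖x‖) ^ N) :
    ∀ x, f x = 0 := by
  let J : ℝ → ℝ := fun ρ => ∫ x in Metric.closedBall (0 : EuclideanSpace ℝ (Fin n)) ρ, ‖f x‖ ^ 2
  have hf2 : Continuous fun x => ‖f x‖ ^ 2 := hf_smooth.continuous.norm.pow 2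
  have hfi : ∀ ρ, IntegrableOn (fun x => ‖f x‖ ^ 2)
      (Metric.closedBall (0 : EuclideanSpace ℝ (Fin n)) ρ) := fun ρ =>
    hf2.continuousOn.integrableOn_compact (isCompact_closedBall _ _)
  have hJ_mono : Monotone J := fun ρ ρ' h =>
    setIntegral_mono_set (hfi ρ') (Filter.Eventually.of_forall fun x => by positivity)
      (Metric.closedBall_subset_closedBall h).eventuallyLE
  have hJ_nonneg : ∀ ρ, 0 ≤ J ρ := fun ρ => integral_nonneg fun x => by positivity
  obtain ⟨C, N, hCN⟩ := hf_growth 0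
  obtain ⟨B, p, hBp⟩ := setIntegral_norm_sq_closedBall_le (f := f) (C := C) (N := N)
    fun x => by simpa using hCN x
  obtain ⟨M, hM⟩ := hc_bdd 0
  have hM₀ : 0 ≤ M := (norm_nonneg _).trans (hM 0)
  have hT : ∀ x, 1 ≤ (M + 1) + c x := fun x => by
    have h := hM x
    rw [norm_iteratedFDeriv_zero, Real.norm_eq_abs] at h
    linarith [neg_abs_le (c x)]
  obtain ⟨κ, s, hκ, hs, hV⟩ := exists_rpow_le_indicator_add hR₁ hε₀ hδ hT hc_lower
  obtain ⟨K, hK₀, hK⟩ := exists_smooth_cutoff n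
  have hρ₀ : 0 < max 1 R₁ := lt_max_of_lt_left one_pos
  have hl₁ : 0 ≤ l₁ := hl₀.le.trans hl₀₁
  have hdouble : ∀ ρ, max 1 R₁ ≤ ρ →
      J ρ ≤ (κ⁻¹ * (M + 1 + 1) * l₁ * n * K ^ 2) * ρ ^ (-s) * J (2 * ρ) := by
    intro ρ hρ
    have hρ_pos : 0 < ρ := hρ₀.trans_le hρ
    obtain ⟨η, hη, hηc, hη1, hηK, hη0⟩ := hK ρ hρ_pos
    have hu : ContDiff ℝ (⊤ : ℕ∞) (fun y => (η y : ℂ) * f y) :=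
      (Complex.ofRealCLM.contDiff.comp hη).mul hf_smooth
    have huc : HasCompactSupport (fun y => (η y : ℂ) * f y) :=
      hηc.mono (Function.support_subset_iff'.2 fun x hx => by
        simp [Function.notMem_support.1 hx])
    obtain ⟨hGi, hG⟩ := integral_indicator_add_potential_le (fun i j => (ha_smooth i j).continuous)
      (fun x ξ => le_trans (by positivity) (hell x ξ).1) hc_smooth.continuous
      (T := M + 1) (by positivity) hu huc (hform _ hu huc)
    rw [integral_form_cutoff_mul_solution ha_smooth ha_symm hf_smooth hf_eq hη hηc] at hG
    have hlow : κ * ρ ^ (-2 + s) * J ρ ≤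
        ∫ x, ((Metric.ball 0 R₁).indicator (fun _ => M + 1) x + c x) * ‖(η x : ℂ) * f x‖ ^ 2 := by
      rw [← integral_const_mul]
      refine (setIntegral_mono_on ((hfi ρ).const_mul _) hGi.integrableOn
        measurableSet_closedBall fun x hx => ?_).trans
        (setIntegral_le_integral hGi (Filter.Eventually.of_forall fun x => ?_))
      · rw [hη1 x hx, Complex.ofReal_one, one_mul]
        gcongr
        exact hV ρ hρ x hx
      · refine mul_nonneg (le_trans ?_ (hV (max (max 1 R₁) ‖x‖) (le_max_left _ _) x ?_))
          (by positivity)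
        · exact mul_nonneg hκ.le (Real.rpow_nonneg (hρ₀.le.trans (le_max_left _ _)) _)
        · rw [mem_closedBall_zero_iff]
          exact le_max_right _ _
    have hup : ∫ x, (∑ i, ∑ j, a i j x * fderiv ℝ η x (EuclideanSpace.single i 1) *
          fderiv ℝ η x (EuclideanSpace.single j 1)) * ‖f x‖ ^ 2 ≤
        l₁ * (n * (K / ρ) ^ 2) * J (2 * ρ) := by
      rw [← setIntegral_eq_integral_of_forall_compl_eq_zero
        (s := Metric.closedBall (0 : EuclideanSpace ℝ (Fin n)) (2 * ρ))
        fun x hx => by simp [hη0 x hx], ← integral_const_mul]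
      have hd : ∀ i : Fin n, Continuous fun x => fderiv ℝ η x (EuclideanSpace.single i 1) :=
        fun i => (hη.continuous_fderiv (by simp)).clm_apply continuous_const
      have hcont : Continuous fun x => (∑ i, ∑ j, a i j x *
          fderiv ℝ η x (EuclideanSpace.single i 1) *
          fderiv ℝ η x (EuclideanSpace.single j 1)) * ‖f x‖ ^ 2 :=
        (continuous_finsetSum _ fun i _ => continuous_finsetSum _ fun j _ =>
          ((ha_smooth i j).continuous.mul (hd i)).mul (hd j)).mul hf2
      refine setIntegral_mono
        (hcont.continuousOn.integrableOn_compact (isCompact_closedBall _ _))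
        ((hfi _).const_mul _) fun x => ?_
      refine mul_le_mul_of_nonneg_right ?_ (by positivity)
      refine (sum_mul_apply_single_le hl₁ (fun ξ => (hell x ξ).2) (fderiv ℝ η x)).trans ?_
      gcongr
      exact hηK x
    have hmain := (hlow.trans hG).trans (mul_le_mul_of_nonneg_left hup (by positivity))
    rw [mul_comm, ← le_div_iff₀ (by positivity)] at hmain
    refine hmain.trans_eq ?_
    rw [Real.rpow_add hρ_pos, Real.rpow_neg hρ_pos.le s, Real.rpow_neg hρ_pos.le 2, Real.rpow_two]
    field_simp
  have hJ0 := eq_zero_of_le_rpow_mul_two_mul hJ_mono hJ_nonneg hρ₀ (by positivity) hs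
    (fun ρ hρ => hBp ρ ((le_max_left _ _).trans hρ)) hdouble
  intro x
  by_contra hx
  have hpos : 0 < J (‖x‖ + 1) := by
    refine (setIntegral_pos_iff_support_of_nonneg_ae
      (Filter.Eventually.of_forall fun x => by positivity) (hfi _)).2 ?_
    have hopen : IsOpen ((Function.support fun x => ‖f x‖ ^ 2) ∩
        Metric.ball (0 : EuclideanSpace ℝ (Fin n)) (‖x‖ + 1)) :=
      hf2.isOpen_support.inter Metric.isOpen_ball
    refine (hopen.measure_pos volume ⟨x, ?_, ?_⟩).trans_le
      (measure_mono (Set.inter_subset_inter_right _ Metric.ball_subset_closedBall))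
    · simpa using hx
    · simp
  exact hpos.ne' (hJ0 _)
end
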